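/- For every ρ ∈ (0,1), the quantization errors of the Riemann–Liouville process X^ρ and of the fractional Brownian motion Z^ρ with Hurst exponent ρ satisfy e_n(X^ρ) ~ (Γ(ρ+1/2) / (Γ(2ρ+1) sin(πρ))^{1/2}) · e_n(Z^ρ) as n → ∞. -/

import Mathlib

open MeasureTheory ProbabilityTheory Filter Real
open scoped RealInnerProductSpace NNReal

/-- Lebesgue measure on `[0,1]`. -/
noncomputable def μ01 : MeasureTheory.Measure ℝ := MeasureTheory.volume.restrict (Set.Icc (0:ℝ) 1)

/-- The covariance kernel of the Riemann–Liouville process of index `ρ`: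
`K_ρ(s,t) = ∫₀^{s∧t} (t-r)^{ρ-1/2} (s-r)^{ρ-1/2} dr`. -/
noncomputable def rlKernel (ρ : ℝ) (s t : ℝ) : ℝ :=
  ∫ r in (0:ℝ)..(min s t), (t - r) ^ (ρ - 1/2) * (s - r) ^ (ρ - 1/2)

/-- The covariance kernel of fractional Brownian motion with Hurst exponent `ρ`:
`E(Z^ρ_s Z^ρ_t) = (s^{2ρ} + t^{2ρ} - |s-t|^{2ρ})/2`. -/
noncomputable def fbmKernel (ρ : ℝ) (s t : ℝ) : ℝ :=
  (s ^ (2*ρ) + t ^ (2*ρ) - |s - t| ^ (2*ρ)) / 2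

/-- The minimal `n`-th `L²`-quantization error of an `H`-valued random vector `X`. -/
noncomputable def quantErr {H : Type*} [NormedAddCommGroup H] [InnerProductSpace ℝ H]
    {Ω : Type*} [MeasurableSpace Ω] (P : Measure Ω) (X : Ω → H) (n : ℕ) : ℝ :=
  sInf { r : ℝ | ∃ α : Finset H, α.Nonempty ∧ α.card ≤ n ∧
    r = (∫ ω, sInf ((fun a => ‖X ω - a‖ ^ 2) '' (α : Set H)) ∂P) ^ (1/2 : ℝ) }

/-- Reverse water-filling distortion of a family of variances at level `θ`. -/
noncomputable def waterDist {ι : Type*} [Fintype ι] (v : ι → ℝ≥0) (θ : ℝ) : ℝ :=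
  ∑ k, min (v k : ℝ) θ

/-- Reverse water-filling rate (in nats) of a family of variances at level `θ`. -/
noncomputable def waterRate {ι : Type*} [Fintype ι] (v : ι → ℝ≥0) (θ : ℝ) : ℝ :=
  1 / 2 * ∑ k, max 0 (Real.log (v k / θ))

/-- The centered Gaussian measure on `ι → ℝ` with independent coordinates of variances `v`. -/
noncomputable def diagGaussian {ι : Type*} [Fintype ι] (v : ι → ℝ≥0) : Measure (ι → ℝ) :=
  Measure.pi fun k => gaussianReal 0 (v k)

instance {ι : Type*} [Fintype ι] (v : ι → ℝ≥0) : IsProbabilityMeasure (diagGaussian v) := by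
  unfold diagGaussian; infer_instance

lemma integrable_gaussianReal_iff {m : ℝ} {v : ℝ≥0} (hv : v ≠ 0) {f : ℝ → ℝ} :
    Integrable f (gaussianReal m v) ↔ Integrable fun x => gaussianPDFReal m v x * f x := by
  rw [gaussianReal_of_var_ne_zero _ hv,
    integrable_withDensity_iff_integrable_smul' (measurable_gaussianPDF _ _)
      (ae_of_all _ fun _ => gaussianPDF_lt_top)]
  simp

lemma gaussianPDFReal_mul_exp_tilt {v : ℝ≥0} {θ : ℝ≥0} (hv : v ≠ 0) (hθ : θ ≠ 0) (a x : ℝ) :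
    gaussianPDFReal 0 v x * rexp (-((x - a) ^ 2 / (2 * θ)) + x ^ 2 / (2 * v))
      = √(θ / v) * gaussianPDFReal a θ x := by
  have hv' : (0:ℝ) < v := by positivity
  have hθ' : (0:ℝ) < θ := by positivity
  simp only [gaussianPDFReal]
  rw [mul_assoc, ← Real.exp_add, Real.sqrt_div hθ'.le,
    Real.sqrt_mul (by positivity) (v:ℝ), Real.sqrt_mul (by positivity) (θ:ℝ)]
  have : -(x - 0) ^ 2 / (2 * (v:ℝ)) + (-((x - a) ^ 2 / (2 * θ)) + x ^ 2 / (2 * v))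
      = -(x - a) ^ 2 / (2 * θ) := by ring
  rw [this]
  have h1 : √(θ:ℝ) ≠ 0 := by positivity
  have h2 : √(v:ℝ) ≠ 0 := by positivity
  have h3 : √(2 * π) ≠ 0 := by positivity
  field_simp

/-- One-dimensional exponential moment behind the water-filling lower bound. -/
lemma gaussianReal_exp_tilt (v θ : ℝ≥0) (hθ : θ ≠ 0) (a : ℝ) :
    Integrable (fun x => rexp (-((x - a) ^ 2 / (2 * θ)) + x ^ 2 / (2 * max (v:ℝ) θ)))
        (gaussianReal 0 v) ∧
      ∫ x, rexp (-((x - a) ^ 2 / (2 * θ)) + x ^ 2 / (2 * max (v:ℝ) θ)) ∂(gaussianReal 0 v)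
        ≤ rexp (-(1 / 2 * max 0 (Real.log (v / θ)))) := by
  have hθ' : (0:ℝ) < θ := by positivity
  rcases le_or_gt v θ with h | h
  · have hm : max (v:ℝ) θ = θ := max_eq_right (by exact_mod_cast h)
    have hlog : max 0 (Real.log ((v:ℝ) / θ)) = 0 :=
      max_eq_left (Real.log_nonpos (by positivity)
        (by rw [div_le_one hθ']; exact_mod_cast h))
    have hfun : (fun x : ℝ => rexp (-((x - a) ^ 2 / (2 * θ)) + x ^ 2 / (2 * (θ:ℝ))))
        = fun x => rexp (-(a ^ 2 / (2 * θ))) * rexp (a / θ * x) := by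
      funext x
      rw [← Real.exp_add]
      congr 1
      field_simp
      ring
    rw [hm, hlog, hfun]
    refine ⟨(integrable_exp_mul_gaussianReal _).const_mul _, ?_⟩
    rw [integral_const_mul]
    have := congrFun (mgf_id_gaussianReal (μ := 0) (v := v)) (a / θ)
    simp only [mgf, id] at this
    rw [this, ← Real.exp_add, Real.exp_le_exp]
    have hvθ : (v:ℝ) ≤ θ := by exact_mod_cast h
    have : (v:ℝ) * (a / θ) ^ 2 / 2 ≤ θ * (a / θ) ^ 2 / 2 := by gcongr
    have h2 : (θ:ℝ) * (a / θ) ^ 2 / 2 = a ^ 2 / (2 * θ) := by field_simp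
    linarith
  · have hv : v ≠ 0 := (pos_of_gt h).ne'
    have hv' : (0:ℝ) < v := by positivity
    have hm : max (v:ℝ) θ = v := max_eq_left (by exact_mod_cast h.le)
    have hlog : max 0 (Real.log ((v:ℝ) / θ)) = Real.log (v / θ) :=
      max_eq_right (Real.log_nonneg (by rw [one_le_div hθ']; exact_mod_cast h.le))
    rw [hm, hlog]
    constructor
    · rw [integrable_gaussianReal_iff hv]
      simp_rw [gaussianPDFReal_mul_exp_tilt hv hθ]
      exact (integrable_gaussianPDFReal _ _).const_mul _
    · rw [integral_gaussianReal_eq_integral_smul hv]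
      simp_rw [smul_eq_mul, gaussianPDFReal_mul_exp_tilt hv hθ]
      rw [integral_const_mul, integral_gaussianPDFReal_eq_one _ hθ, mul_one]
      apply le_of_eq
      rw [Real.sqrt_eq_rpow, Real.rpow_def_of_pos (by positivity),
        Real.log_div hθ'.ne' hv'.ne', Real.log_div hv'.ne' hθ'.ne']
      congr 1
      ring

lemma integral_sq_gaussianReal (v : ℝ≥0) : ∫ x, x ^ 2 ∂(gaussianReal 0 v) = v := by
  have := variance_fun_id_gaussianReal (μ := 0) (v := v)
  rw [variance_of_integral_eq_zero (by fun_prop) (by simp)] at this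
  exact this

lemma integrable_sq_sub_gaussianReal (v : ℝ≥0) (a : ℝ) :
    Integrable (fun x => (x - a) ^ 2) (gaussianReal 0 v) := by
  have h : MemLp (fun x : ℝ => x - a) 2 (gaussianReal 0 v) :=
    (memLp_id_gaussianReal' 2 (by simp)).sub (memLp_const a)
  exact h.integrable_sq

lemma integrable_comp_eval_diagGaussian {ι : Type*} [Fintype ι] (v : ι → ℝ≥0) (k : ι)
    {f : ℝ → ℝ} (hf : Integrable f (gaussianReal 0 (v k))) :
    Integrable (fun x : ι → ℝ => f (x k)) (diagGaussian v) :=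
  (measurePreserving_eval (fun k => gaussianReal 0 (v k)) k).integrable_comp_of_integrable hf

lemma integral_comp_eval_diagGaussian {ι : Type*} [Fintype ι] (v : ι → ℝ≥0) (k : ι)
    {f : ℝ → ℝ} (hf : AEStronglyMeasurable f (gaussianReal 0 (v k))) :
    ∫ x : ι → ℝ, f (x k) ∂(diagGaussian v) = ∫ y, f y ∂(gaussianReal 0 (v k)) := by
  have h := measurePreserving_eval (fun k => gaussianReal 0 (v k)) k
  rw [← h.map_eq] at hf ⊢
  rw [integral_map h.measurable.aemeasurable hf]
  rfl

lemma Finset.sInf_image_mem {β : Type*} {α : Finset β} (hα : α.Nonempty) (f : β → ℝ) :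
    ∃ a ∈ α, sInf (f '' (α : Set β)) = f a := by
  obtain ⟨a, ha, h⟩ := (Set.Nonempty.image f (Finset.coe_nonempty.2 hα)).csInf_mem
    (α.finite_toSet.image f)
  exact ⟨a, by simpa using ha, h.symm⟩

lemma Finset.sInf_image_le {β : Type*} {α : Finset β} (f : β → ℝ) {a : β} (ha : a ∈ α) :
    sInf (f '' (α : Set β)) ≤ f a :=
  csInf_le (α.finite_toSet.image f).bddBelow ⟨a, by simpa using ha, rfl⟩

lemma Finset.sInf_image_eq_inf' {β : Type*} {α : Finset β} (hα : α.Nonempty) (f : β → ℝ) :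
    sInf (f '' (α : Set β)) = α.inf' hα f :=
  (Finset.inf'_eq_csInf_image α hα f).symm

lemma Finset.measurable_sInf_image {Ω β : Type*} [MeasurableSpace Ω] {α : Finset β}
    (hα : α.Nonempty) {f : β → Ω → ℝ} (hf : ∀ a ∈ α, Measurable (f a)) :
    Measurable fun x => sInf ((fun a => f a x) '' (α : Set β)) := by
  have : Measurable (α.inf' hα f) :=
    Finset.inf'_induction hα f (fun _ h₁ _ h₂ => h₁.inf h₂) hf
  convert! this using 1
  funext x
  rw [Finset.sInf_image_eq_inf' hα, Finset.inf'_apply]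

/-- Any codebook of `N` points has mean squared error at least the tangent at water level `θ` of the
distortion-rate function. -/
theorem diagGaussian_quantization_lower {ι : Type*} [Fintype ι] (v : ι → ℝ≥0) {θ : ℝ}
    (hθ : 0 < θ) {α : Finset (ι → ℝ)} (hα : α.Nonempty) :
    waterDist v θ + 2 * θ * (waterRate v θ - Real.log α.card) ≤
      ∫ x, sInf ((fun a : ι → ℝ => ∑ k, (x k - a k) ^ 2) '' (α : Set (ι → ℝ)))
        ∂(diagGaussian v) := by
  lift θ to ℝ≥0 using hθ.le
  have hθ0 : θ ≠ 0 := by rintro rfl; simp at hθ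
  set μ := diagGaussian v with hμ
  set m : (ι → ℝ) → ℝ := fun x => sInf ((fun a : ι → ℝ => ∑ k, (x k - a k) ^ 2) '' (α : Set (ι → ℝ)))
    with hm
  set g : (ι → ℝ) → ℝ := fun x => ∑ k, (x k) ^ 2 / (2 * max (v k : ℝ) θ) with hg
  have hsq : ∀ a : ι → ℝ, Integrable (fun x : ι → ℝ => ∑ k, (x k - a k) ^ 2) μ := fun a =>
    integrable_finsetSum _ fun k _ =>
      integrable_comp_eval_diagGaussian v k (integrable_sq_sub_gaussianReal (v k) (a k))
  have hmm : Measurable m := Finset.measurable_sInf_image hα fun a _ => by fun_prop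
  have hm0 : ∀ x, 0 ≤ m x := fun x => Real.sInf_nonneg (by
    rintro _ ⟨a, -, rfl⟩; positivity)
  have hmi : Integrable m μ := by
    obtain ⟨a, ha⟩ := hα
    refine (hsq a).mono' hmm.aestronglyMeasurable (ae_of_all _ fun x => ?_)
    rw [Real.norm_of_nonneg (hm0 x)]
    exact Finset.sInf_image_le (fun a : ι → ℝ => ∑ k, (x k - a k) ^ 2) ha
  have hgk : ∀ k, Integrable (fun x : ι → ℝ => (x k) ^ 2 / (2 * max (v k : ℝ) θ)) μ := fun k =>
    have h : Integrable (fun x : ι → ℝ => (x k) ^ 2) μ := by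
      simpa using integrable_comp_eval_diagGaussian v k (integrable_sq_sub_gaussianReal (v k) 0)
    h.div_const _
  have hgi : Integrable g μ := integrable_finsetSum _ fun k _ => hgk k
  have hgE : 2 * θ * ∫ x, g x ∂μ = waterDist v θ := by
    rw [hg, integral_finsetSum _ fun k _ => hgk k, Finset.mul_sum, waterDist]
    refine Finset.sum_congr rfl fun k _ => ?_
    rw [integral_div, integral_comp_eval_diagGaussian v k (f := fun y => y ^ 2) (by fun_prop),
      integral_sq_gaussianReal]
    rcases le_total (v k : ℝ) θ with h | h
    · rw [max_eq_right h, min_eq_left h]; field_simp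
    · rw [max_eq_left h, min_eq_right h]
      have : (0:ℝ) < v k := lt_of_lt_of_le hθ h
      field_simp
  set F : (ι → ℝ) → (ι → ℝ) → ℝ := fun a x =>
    ∏ k, rexp (-((x k - a k) ^ 2 / (2 * θ)) + (x k) ^ 2 / (2 * max (v k : ℝ) θ)) with hF
  have hFi : ∀ a, Integrable (F a) μ := fun a =>
    Integrable.fintype_prod fun k => (gaussianReal_exp_tilt (v k) θ hθ0 (a k)).1
  have hFE : ∀ a, ∫ x, F a x ∂μ ≤ rexp (-waterRate v θ) := fun a => by
    have h := integral_fintype_prod_eq_prod (μ := fun k => gaussianReal 0 (v k))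
      (fun k y => rexp (-((y - a k) ^ 2 / (2 * θ)) + y ^ 2 / (2 * max (v k : ℝ) θ)))
    rw [hμ, diagGaussian, hF, h, waterRate, Finset.mul_sum, ← Finset.sum_neg_distrib, Real.exp_sum]
    exact Finset.prod_le_prod (fun k _ => integral_nonneg fun _ => (Real.exp_pos _).le)
      fun k _ => (gaussianReal_exp_tilt (v k) θ hθ0 (a k)).2
  have hcard : (0:ℝ) < α.card := by exact_mod_cast hα.card_pos
  have key : ∀ x, -(m x / (2 * θ)) + g x + (waterRate v θ - Real.log α.card) + 1
      ≤ (∑ a ∈ α, F a x) * rexp (waterRate v θ - Real.log α.card) := fun x => by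
    refine (Real.add_one_le_exp _).trans ?_
    rw [Real.exp_add]
    gcongr
    obtain ⟨a, ha, h⟩ := Finset.sInf_image_mem hα (fun a : ι → ℝ => ∑ k, (x k - a k) ^ 2)
    have h1 : rexp (-(m x / (2 * θ)) + g x) = F a x := by
      have hmx : m x = ∑ k, (x k - a k) ^ 2 := h
      simp only [hmx, hF, hg]
      rw [← Real.exp_sum, Finset.sum_add_distrib, Finset.sum_neg_distrib, ← Finset.sum_div]
    rw [h1]
    exact Finset.single_le_sum (f := fun a => F a x)
      (fun a _ => Finset.prod_nonneg fun k _ => (Real.exp_pos _).le) ha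
  have hA : Integrable (fun x => -(m x / (2 * (θ:ℝ)))) μ := (hmi.div_const _).neg
  have hB : Integrable (fun x => -(m x / (2 * (θ:ℝ))) + g x) μ := hA.add hgi
  have hC : Integrable (fun x => -(m x / (2 * (θ:ℝ))) + g x
      + (waterRate v θ - Real.log α.card)) μ := hB.add (integrable_const _)
  have hInt := integral_mono (μ := μ) (hC.add (integrable_const 1))
    ((integrable_finsetSum α fun a _ => hFi a).mul_const _) key
  have hL : ∫ x, (-(m x / (2 * θ)) + g x + (waterRate v θ - Real.log α.card) + 1) ∂μ
      = -((∫ x, m x ∂μ) / (2 * θ)) + ∫ x, g x ∂μ + (waterRate v θ - Real.log α.card) + 1 := by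
    rw [integral_add hC (integrable_const _), integral_add hB (integrable_const _),
      integral_add hA hgi, integral_neg, integral_div]
    simp
  have hR : ∫ x, (∑ a ∈ α, F a x) * rexp (waterRate v θ - Real.log α.card) ∂μ ≤ 1 := by
    rw [integral_mul_const, integral_finsetSum _ fun a _ => hFi a]
    calc (∑ a ∈ α, ∫ x, F a x ∂μ) * rexp (waterRate v θ - Real.log α.card)
        ≤ (∑ a ∈ α, rexp (-waterRate v θ)) * rexp (waterRate v θ - Real.log α.card) := by
          gcongr with a ha
          exact hFE a
      _ = 1 := by
          rw [Finset.sum_const, nsmul_eq_mul, Real.exp_sub, Real.exp_log hcard, Real.exp_neg]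
          field_simp
  have hfin : -((∫ x, m x ∂μ) / (2 * θ)) + ∫ x, g x ∂μ + (waterRate v θ - Real.log α.card) ≤ 0 := by
    have := hL ▸ hInt
    linarith [hL, hInt, hR]
  have h2 : 2 * (θ:ℝ) * (-((∫ x, m x ∂μ) / (2 * θ)) + ∫ x, g x ∂μ
      + (waterRate v θ - Real.log α.card)) ≤ 0 :=
    mul_nonpos_of_nonneg_of_nonpos (by positivity) hfin
  have h3 : 2 * (θ:ℝ) * ((∫ x, m x ∂μ) / (2 * θ)) = ∫ x, m x ∂μ := by field_simp
  nlinarith [h2, h3, hgE]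

lemma exists_tuple_measure_uncovered_le {X Y : Type*} [MeasurableSpace X] [MeasurableSpace Y]
    (μ : Measure X) (P : Measure Y) [SFinite μ] [IsProbabilityMeasure P]
    {B : Set (X × Y)} (hB : MeasurableSet B) (n : ℕ) :
    ∃ A : Fin n → Y, μ {x | ∀ j, (x, A j) ∈ B} ≤ ∫⁻ x, P {a | (x, a) ∈ B} ^ n ∂μ := by
  have hS : MeasurableSet {z : (Fin n → Y) × X | ∀ j, (z.2, z.1 j) ∈ B} := by
    have : {z : (Fin n → Y) × X | ∀ j, (z.2, z.1 j) ∈ B}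
        = ⋂ j, (fun z : (Fin n → Y) × X => (z.2, z.1 j)) ⁻¹' B := by ext; simp
    rw [this]
    exact MeasurableSet.iInter fun j => (by fun_prop : Measurable _) hB
  obtain ⟨A, hA⟩ := exists_le_lintegral (μ := Measure.pi fun _ : Fin n => P)
    (f := fun A => μ {x | ∀ j, (x, A j) ∈ B}) (measurable_measure_prodMk_left hS).aemeasurable
  refine ⟨A, hA.trans (le_of_eq ?_)⟩
  have h1 := Measure.prod_apply (μ := Measure.pi fun _ : Fin n => P) (ν := μ) hS
  have h2 := Measure.prod_apply_symm (μ := Measure.pi fun _ : Fin n => P) (ν := μ) hS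
  refine (h1.symm.trans h2).trans (lintegral_congr fun x => ?_)
  have : (fun A : Fin n → Y => (A, x)) ⁻¹' {z : (Fin n → Y) × X | ∀ j, (z.2, z.1 j) ∈ B}
      = Set.pi Set.univ fun _ => {a | (x, a) ∈ B} := by ext; simp
  rw [this, Measure.pi_pi]
  simp

lemma exp_neg_mul_le_of_mem_Icc {c q : ℝ} (h0 : 0 ≤ q) (h1 : q ≤ 1) :
    rexp (-(c * q)) ≤ 1 - q + rexp (-c) := by
  have h := convexOn_exp.2 (Set.mem_univ (0:ℝ)) (Set.mem_univ (-c)) (sub_nonneg.2 h1) h0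
    (by ring)
  simp only [smul_eq_mul, mul_zero, zero_add, Real.exp_zero, mul_one] at h
  calc rexp (-(c * q)) = rexp (q * -c) := by ring_nf
    _ ≤ _ := h
    _ ≤ _ := by
      have := Real.exp_pos (-c)
      nlinarith

/-- Random coding: if `w x ·` is a probability density with respect to `P` that is at most `Γ`
off `B`, then some `n` points leave uncovered at most the `w`-mass of `B` plus `exp (-n/Γ)`. -/
theorem exists_tuple_measure_uncovered_le_of_density {X Y : Type*} [MeasurableSpace X]
    [MeasurableSpace Y] (μ : Measure X) (P : Measure Y) [IsProbabilityMeasure μ]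
    [IsProbabilityMeasure P] {B : Set (X × Y)} (hB : MeasurableSet B)
    {w : X → Y → ENNReal} (hw : Measurable (Function.uncurry w))
    (hw1 : ∀ x, ∫⁻ a, w x a ∂P = 1) {Γ : ℝ} (hΓ : 0 < Γ)
    (hwΓ : ∀ x a, (x, a) ∉ B → w x a ≤ ENNReal.ofReal Γ) (n : ℕ) :
    ∃ A : Fin n → Y, μ {x | ∀ j, (x, A j) ∈ B} ≤
      (∫⁻ x, ∫⁻ a in {a | (x, a) ∈ B}, w x a ∂P ∂μ) + ENNReal.ofReal (rexp (-(n / Γ))) := by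
  obtain ⟨A, hA⟩ := exists_tuple_measure_uncovered_le μ P hB n
  refine ⟨A, hA.trans ?_⟩
  have hconst : ENNReal.ofReal (rexp (-(n / Γ)))
      = ∫⁻ _ : X, ENNReal.ofReal (rexp (-(n / Γ))) ∂μ := by simp
  rw [hconst, ← lintegral_add_right _ measurable_const]
  refine lintegral_mono fun x => ?_
  have hBx : MeasurableSet {a | (x, a) ∈ B} := (by fun_prop : Measurable fun a : Y => (x, a)) hB
  have hwx : Measurable (w x) := hw.of_uncurry_left
  set b := {a | (x, a) ∈ B} with hb
  set r := ∫⁻ a in b, w x a ∂P with hr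
  have hsum : r + ∫⁻ a in bᶜ, w x a ∂P = 1 := by rw [hr, lintegral_add_compl _ hBx, hw1]
  have hr1 : r ≤ 1 := hsum ▸ le_self_add
  have hq : ∫⁻ a in bᶜ, w x a ∂P ≤ ENNReal.ofReal Γ * P bᶜ := by
    calc ∫⁻ a in bᶜ, w x a ∂P ≤ ∫⁻ _ in bᶜ, ENNReal.ofReal Γ ∂P :=
          setLIntegral_mono measurable_const fun a ha => hwΓ x a ha
      _ = _ := by simp
  lift r to ℝ≥0 using ne_top_of_le_ne_top ENNReal.one_ne_top hr1 with r'
  have hpc : P.real bᶜ = 1 - P.real b := probReal_compl_eq_one_sub hBx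
  have hq' : 1 - (r':ℝ) ≤ Γ * (1 - P.real b) := by
    have h1 : (1:ENNReal) ≤ r' + ENNReal.ofReal Γ * P bᶜ := by
      rw [← hsum]; gcongr
    have h2 := ENNReal.toReal_mono (by finiteness) h1
    rw [ENNReal.toReal_add (by finiteness) (by finiteness), ENNReal.toReal_mul,
      ENNReal.toReal_ofReal hΓ.le] at h2
    have h3 : (P bᶜ).toReal = 1 - P.real b := hpc
    rw [h3] at h2
    simp at h2
    linarith
  have hr' : (r':ℝ) ≤ 1 := by exact_mod_cast hr1
  have hreal : P.real b ^ n ≤ r' + rexp (-(n / Γ)) := by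
    have h1 : P.real b ≤ rexp (-((1 - r') / Γ)) := by
      have := Real.one_sub_le_exp_neg (1 - P.real b)
      rw [sub_sub_cancel] at this
      refine this.trans (Real.exp_le_exp.2 (neg_le_neg ?_))
      rw [div_le_iff₀ hΓ]; linarith
    calc P.real b ^ n ≤ rexp (-((1 - r') / Γ)) ^ n := by gcongr
      _ = rexp (-(n / Γ * (1 - r'))) := by rw [← Real.exp_nat_mul]; congr 1; ring
      _ ≤ 1 - (1 - r') + rexp (-(n / Γ)) :=
          exp_neg_mul_le_of_mem_Icc (by linarith) (by simp)
      _ = _ := by ring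
  calc P b ^ n = ENNReal.ofReal (P.real b ^ n) := by
        rw [ENNReal.ofReal_pow (by positivity), ofReal_measureReal]
    _ ≤ ENNReal.ofReal (r' + rexp (-(n / Γ))) := ENNReal.ofReal_le_ofReal hreal
    _ = r' + ENNReal.ofReal (rexp (-(n / Γ))) := by
        rw [ENNReal.ofReal_add (by positivity) (by positivity), ENNReal.ofReal_coe_nnreal]

lemma lintegral_gaussianReal {m : ℝ} {v : ℝ≥0} (hv : v ≠ 0) {f : ℝ → ENNReal} (hf : Measurable f) :
    ∫⁻ x, f x ∂(gaussianReal m v) = ∫⁻ x, ENNReal.ofReal (gaussianPDFReal m v x) * f x := by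
  rw [gaussianReal_of_var_ne_zero _ hv,
    lintegral_withDensity_eq_lintegral_mul _ (measurable_gaussianPDF _ _) hf]
  rfl

lemma lintegral_ofReal_gaussianPDFReal {m : ℝ} {v : ℝ≥0} (hv : v ≠ 0) :
    ∫⁻ x, ENNReal.ofReal (gaussianPDFReal m v x) = 1 :=
  lintegral_gaussianPDFReal_eq_one m hv

lemma gaussianPDFReal_mul_exp_sq {v : ℝ≥0} (hv : v ≠ 0) (m x : ℝ) {t : ℝ} (ht : t < 1 / 2) :
    gaussianPDFReal m v x * rexp (t * ((x - m) ^ 2 / v))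
      = (√(1 - 2 * t))⁻¹ * gaussianPDFReal m (v / (1 - 2 * t).toNNReal) x := by
  have hv' : (0:ℝ) < v := by positivity
  have h0 : 0 < 1 - 2 * t := by linarith
  simp only [gaussianPDFReal]
  rw [mul_assoc, ← Real.exp_add, NNReal.coe_div, Real.coe_toNNReal _ h0.le,
    show 2 * π * ((v:ℝ) / (1 - 2 * t)) = (2 * π * v) / (1 - 2 * t) by ring,
    Real.sqrt_div (by positivity)]
  have : -(x - m) ^ 2 / (2 * (v:ℝ)) + t * ((x - m) ^ 2 / v)
      = -(x - m) ^ 2 / (2 * ((v:ℝ) / (1 - 2 * t))) := by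
    field_simp; ring
  rw [this]
  have h1 : √(2 * π * v) ≠ 0 := by positivity
  have h2 : √(1 - 2 * t) ≠ 0 := by positivity
  field_simp

/-- Chi-square exponential moment bound, for both tails. -/
lemma lintegral_exp_sq_gaussianReal_le {v : ℝ≥0} (hv : v ≠ 0) (m : ℝ) {t : ℝ} (ht : |t| ≤ 1 / 4) :
    ∫⁻ x, ENNReal.ofReal (rexp (t * ((x - m) ^ 2 / v - 1))) ∂(gaussianReal m v)
      ≤ ENNReal.ofReal (rexp (4 * t ^ 2)) := by
  have ht' := abs_le.1 ht
  have h0 : 0 < 1 - 2 * t := by linarith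
  rw [lintegral_gaussianReal hv (by fun_prop)]
  have : ∀ x, ENNReal.ofReal (gaussianPDFReal m v x) *
      ENNReal.ofReal (rexp (t * ((x - m) ^ 2 / v - 1)))
      = ENNReal.ofReal ((√(1 - 2 * t))⁻¹ * rexp (-t)) *
        ENNReal.ofReal (gaussianPDFReal m (v / (1 - 2 * t).toNNReal) x) := fun x => by
    rw [← ENNReal.ofReal_mul (gaussianPDFReal_nonneg _ _ _), ← ENNReal.ofReal_mul (by positivity)]
    congr 1
    rw [mul_right_comm, ← gaussianPDFReal_mul_exp_sq hv m x (by linarith), mul_assoc,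
      ← Real.exp_add]
    congr 2; ring
  simp_rw [this]
  rw [lintegral_const_mul _ (by fun_prop), lintegral_ofReal_gaussianPDFReal, mul_one]
  · refine ENNReal.ofReal_le_ofReal ?_
    have hlog := abs_le.1 (Real.abs_log_sub_add_sum_range_le (x := 2 * t)
      (by rw [abs_mul]; norm_num; linarith) 1)
    have hb : |2 * t| ^ (1 + 1) / (1 - |2 * t|) ≤ 8 * t ^ 2 := by
      rw [div_le_iff₀ (by rw [abs_mul]; norm_num; linarith)]
      have : |2 * t| = 2 * |t| := by rw [abs_mul]; norm_num
      rw [this, ← sq_abs t, show 1 + 1 = 2 from rfl]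
      nlinarith [mul_nonneg (sq_nonneg |t|) (sub_nonneg.2 ht)]
    have hl := hlog.1
    simp at hl
    have hl2 : -Real.log (1 - 2 * t) / 2 ≤ t + 4 * t ^ 2 := by
      norm_num at hb hl ⊢; linarith
    rw [Real.sqrt_eq_rpow, Real.rpow_def_of_pos h0, ← Real.exp_neg, ← Real.exp_add]
    exact Real.exp_le_exp.2 (by linarith)
  · simp [hv]; linarith

/-- The density of the backward test channel at variance `v` and distortion level `θ`. -/
noncomputable def channelDensity (v θ : ℝ≥0) (x a : ℝ) : ENNReal :=
  if θ < v then ENNReal.ofReal (√(v / θ) * rexp (-((x - a) ^ 2 / (2 * θ)) + x ^ 2 / (2 * v))) else 1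

lemma Measurable.channelDensity {Ω : Type*} [MeasurableSpace Ω] (v θ : ℝ≥0) {f g : Ω → ℝ}
    (hf : Measurable f) (hg : Measurable g) :
    Measurable fun ω => channelDensity v θ (f ω) (g ω) := by
  unfold _root_.channelDensity
  split_ifs <;> fun_prop

lemma lintegral_channelDensity_mul {v θ : ℝ≥0} (hθ : θ ≠ 0) (h : θ < v) (a : ℝ)
    {f : ℝ → ENNReal} (hf : Measurable f) :
    ∫⁻ x, channelDensity v θ x a * f x ∂(gaussianReal 0 v) = ∫⁻ x, f x ∂(gaussianReal a θ) := by
  have hv : v ≠ 0 := (pos_of_gt h).ne'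
  have hv' : (0:ℝ) < v := by positivity
  have hθ' : (0:ℝ) < θ := by positivity
  have hm : Measurable fun x => channelDensity v θ x a := Measurable.channelDensity v θ (by fun_prop) (by fun_prop)
  rw [lintegral_gaussianReal hv (f := fun x => channelDensity v θ x a * f x) (hm.mul hf), lintegral_gaussianReal hθ hf]
  refine lintegral_congr fun x => ?_
  rw [← mul_assoc, channelDensity, if_pos h, ← ENNReal.ofReal_mul (gaussianPDFReal_nonneg _ _ _),
    mul_left_comm, gaussianPDFReal_mul_exp_tilt hv hθ, ← mul_assoc, ← Real.sqrt_mul (by positivity)]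
  congr 2
  rw [div_mul_div_cancel₀ hθ'.ne', div_self hv'.ne']
  simp

lemma lintegral_channelDensity_eq_one {v θ : ℝ≥0} (hθ : θ ≠ 0) (x : ℝ) :
    ∫⁻ a, channelDensity v θ x a ∂(gaussianReal 0 (v - θ)) = 1 := by
  unfold channelDensity
  split_ifs with h
  · have hv : v ≠ 0 := (pos_of_gt h).ne'
    have hv' : (0:ℝ) < v := by positivity
    have hθ' : (0:ℝ) < θ := by positivity
    have hd : v - θ ≠ 0 := (tsub_pos_of_lt h).ne'
    have hd' : (0:ℝ) < v - θ := by have : (θ:ℝ) < v := h; linarith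
    rw [lintegral_gaussianReal hd (by fun_prop),
      ← lintegral_ofReal_gaussianPDFReal (m := (1 - θ / v) * x) (v := θ * (v - θ) / v)
        (by simp [hθ, hd, hv])]
    refine lintegral_congr fun a => ?_
    rw [← ENNReal.ofReal_mul (gaussianPDFReal_nonneg _ _ _)]
    congr 1
    simp only [gaussianPDFReal]
    rw [NNReal.coe_div, NNReal.coe_mul, NNReal.coe_sub h.le, mul_mul_mul_comm, ← Real.exp_add,
      Real.sqrt_div hv'.le,
      show 2 * π * ((θ:ℝ) * (v - θ) / v) = (2 * π * (v - θ)) * θ / v by ring,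
      Real.sqrt_div (by positivity), Real.sqrt_mul (by positivity) (θ:ℝ)]
    have h1 : √(θ:ℝ) ≠ 0 := by positivity
    have h2 : √(v:ℝ) ≠ 0 := by positivity
    have h3 : √(2 * π * (v - θ)) ≠ 0 := by positivity
    congr 1
    · field_simp
    · congr 1
      field_simp
      ring
  · simp

lemma lintegral_pi_prod {ι : Type*} [Fintype ι] {E : ι → Type*} [∀ i, MeasurableSpace (E i)]
    (μ : ∀ i, Measure (E i)) [∀ i, IsProbabilityMeasure (μ i)] {f : ∀ i, E i → ENNReal}
    (hf : ∀ i, Measurable (f i)) :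
    ∫⁻ x, ∏ i, f i (x i) ∂(Measure.pi μ) = ∏ i, ∫⁻ y, f i y ∂(μ i) := by
  rw [lintegral_prod_eq_prod_lintegral_of_indepFun (μ := Measure.pi μ) Finset.univ
    (fun i (x : ∀ i, E i) => f i (x i))
    (iIndepFun_pi fun i => (hf i).aemeasurable) fun i => (hf i).comp (measurable_pi_apply i)]
  refine Finset.prod_congr rfl fun i _ => ?_
  exact (measurePreserving_eval μ i).lintegral_comp (hf i)

lemma lintegral_channelDensity_mul_exp_le {v θ : ℝ≥0} (hθ : θ ≠ 0) (a : ℝ) {t : ℝ}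
    (ht : |t| ≤ 1 / 4) :
    ∫⁻ x, channelDensity v θ x a *
        ENNReal.ofReal (rexp (if θ < v then t * ((x - a) ^ 2 / θ - 1) else 0)) ∂(gaussianReal 0 v)
      ≤ ENNReal.ofReal (rexp (if θ < v then 4 * t ^ 2 else 0)) := by
  by_cases h : θ < v
  · simp only [h, if_true]
    rw [lintegral_channelDensity_mul hθ h a (by fun_prop)]
    exact lintegral_exp_sq_gaussianReal_le hθ a ht
  · simp [h, channelDensity]

lemma lintegral_exp_ite_gaussianReal_le {v θ : ℝ≥0} {t : ℝ} (ht : |t| ≤ 1 / 4) :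
    ∫⁻ x, ENNReal.ofReal (rexp (if θ < v then t * (x ^ 2 / v - 1) else 0)) ∂(gaussianReal 0 v)
      ≤ ENNReal.ofReal (rexp (if θ < v then 4 * t ^ 2 else 0)) := by
  by_cases h : θ < v
  · simpa [h] using lintegral_exp_sq_gaussianReal_le (pos_of_gt h).ne' 0 ht
  · simp [h]

section Coding

variable {ι : Type*} [Fintype ι]

lemma ofReal_exp_sum (f : ι → ℝ) :
    ENNReal.ofReal (rexp (∑ k, f k)) = ∏ k, ENNReal.ofReal (rexp (f k)) := by
  rw [Real.exp_sum, ENNReal.ofReal_prod_of_nonneg fun _ _ => (Real.exp_pos _).le]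

lemma sum_ite_const_eq (v : ι → ℝ≥0) (θ : ℝ≥0) (c : ℝ) :
    ∑ k, (if θ < v k then c else 0) = c * (Finset.univ.filter fun k => θ < v k).card := by
  rw [← Finset.sum_filter, Finset.sum_const, nsmul_eq_mul, mul_comm]

lemma measurable_prod_channelDensity (v : ι → ℝ≥0) (θ : ℝ≥0) :
    Measurable (Function.uncurry fun x a : ι → ℝ => ∏ k, channelDensity (v k) θ (x k) (a k)) := by
  rw [Function.uncurry_def]
  refine Finset.measurable_fun_prod _ fun k _ => ?_
  exact Measurable.channelDensity (v k) θ (by fun_prop) (by fun_prop)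

lemma lintegral_prod_channelDensity (v : ι → ℝ≥0) {θ : ℝ≥0} (hθ : θ ≠ 0) (x : ι → ℝ) :
    ∫⁻ a : ι → ℝ, ∏ k, channelDensity (v k) θ (x k) (a k) ∂(diagGaussian fun k => v k - θ) = 1 := by
  rw [diagGaussian, lintegral_pi_prod _ (f := fun k y => channelDensity (v k) θ (x k) y)
    fun k => Measurable.channelDensity (v k) θ (by fun_prop) (by fun_prop)]
  simp [lintegral_channelDensity_eq_one hθ]

lemma lintegral_noise_tail_le (v : ι → ℝ≥0) {θ : ℝ≥0} (hθ : θ ≠ 0) {t : ℝ} (ht : |t| ≤ 1 / 4) :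
    ∫⁻ x, ∫⁻ a, (∏ k, channelDensity (v k) θ (x k) (a k)) * ENNReal.ofReal
        (rexp (∑ k, if θ < v k then t * ((x k - a k) ^ 2 / θ - 1) else 0))
        ∂(diagGaussian fun k => v k - θ) ∂(diagGaussian v)
      ≤ ENNReal.ofReal
        (rexp (4 * t ^ 2 * (Finset.univ.filter fun k => θ < v k).card)) := by
  have hmeas : ∀ k a, Measurable fun x : ℝ => channelDensity (v k) θ x a *
      ENNReal.ofReal (rexp (if θ < v k then t * ((x - a) ^ 2 / θ - 1) else 0)) := fun k a => by
    refine (Measurable.channelDensity (v k) θ (by fun_prop) (by fun_prop)).mul ?_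
    split_ifs <;> fun_prop
  simp_rw [ofReal_exp_sum, ← Finset.prod_mul_distrib]
  rw [lintegral_lintegral_swap]
  · calc _ ≤ ∫⁻ _ : ι → ℝ, ENNReal.ofReal
          (rexp (4 * t ^ 2 * (Finset.univ.filter fun k => θ < v k).card))
          ∂(diagGaussian fun k => v k - θ) := by
          refine lintegral_mono fun a => ?_
          rw [diagGaussian, lintegral_pi_prod _ (f := fun k x => channelDensity (v k) θ x (a k) *
              ENNReal.ofReal (rexp (if θ < v k then t * ((x - a k) ^ 2 / θ - 1) else 0)))
            fun k => hmeas k (a k)]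
          rw [← sum_ite_const_eq, ofReal_exp_sum]
          exact Finset.prod_le_prod' fun k _ => lintegral_channelDensity_mul_exp_le hθ (a k) ht
      _ = _ := by simp
  · rw [Function.uncurry_def]
    refine (Finset.measurable_fun_prod _ fun k _ => ?_).aemeasurable
    refine (Measurable.channelDensity (v k) θ (by fun_prop) (by fun_prop)).mul ?_
    split_ifs <;> fun_prop

lemma lintegral_source_tail_le (v : ι → ℝ≥0) {θ : ℝ≥0} (hθ : θ ≠ 0) {t : ℝ} (ht : |t| ≤ 1 / 4) :
    ∫⁻ x, ∫⁻ a, (∏ k, channelDensity (v k) θ (x k) (a k)) * ENNReal.ofReal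
        (rexp (∑ k, if θ < v k then t * ((x k) ^ 2 / v k - 1) else 0))
        ∂(diagGaussian fun k => v k - θ) ∂(diagGaussian v)
      ≤ ENNReal.ofReal
        (rexp (4 * t ^ 2 * (Finset.univ.filter fun k => θ < v k).card)) := by
  have hmeas : ∀ k, Measurable fun x : ℝ =>
      ENNReal.ofReal (rexp (if θ < v k then t * (x ^ 2 / v k - 1) else 0)) := fun k => by
    split_ifs <;> fun_prop
  calc _ = ∫⁻ x : ι → ℝ, ∏ k, ENNReal.ofReal
        (rexp (if θ < v k then t * ((x k) ^ 2 / v k - 1) else 0)) ∂(diagGaussian v) := by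
        refine lintegral_congr fun x => ?_
        rw [lintegral_mul_const _ (measurable_prod_channelDensity v θ).of_uncurry_left,
          lintegral_prod_channelDensity v hθ, one_mul, ofReal_exp_sum]
    _ ≤ _ := by
        rw [diagGaussian, lintegral_pi_prod _ hmeas, ← sum_ite_const_eq, ofReal_exp_sum]
        exact Finset.prod_le_prod' fun k _ => lintegral_exp_ite_gaussianReal_le ht

end Coding

lemma channelDensity_eq_exp {v θ : ℝ≥0} (hθ : θ ≠ 0) (x a : ℝ) :
    channelDensity v θ x a = ENNReal.ofReal (rexp (1 / 2 * max 0 (Real.log (v / θ)) +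
      ((if θ < v then 1 / 2 * (x ^ 2 / v - 1) else 0)
        - if θ < v then 1 / 2 * ((x - a) ^ 2 / θ - 1) else 0))) := by
  have hθ' : (0:ℝ) < θ := by positivity
  unfold channelDensity
  split_ifs with h
  · have hv : v ≠ 0 := (pos_of_gt h).ne'
    have hv' : (0:ℝ) < v := by positivity
    congr 1
    rw [max_eq_right (Real.log_nonneg (by rw [one_le_div hθ']; exact_mod_cast h.le)),
      Real.sqrt_eq_rpow, Real.rpow_def_of_pos (by positivity), ← Real.exp_add]
    congr 1
    field_simp
    ring
  · rw [max_eq_left (Real.log_nonpos (by positivity)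
        (by rw [div_le_one hθ']; exact_mod_cast not_lt.1 h))]
    simp

lemma lintegral_const_mul_add_add {X : Type*} [MeasurableSpace X] (μ : Measure X) (c : ENNReal)
    {f g h : X → ENNReal} (hf : Measurable f) (hg : Measurable g) (hh : Measurable h) :
    ∫⁻ x, c * (f x + g x + h x) ∂μ = c * ((∫⁻ x, f x ∂μ) + (∫⁻ x, g x ∂μ) + ∫⁻ x, h x ∂μ) := by
  rw [lintegral_const_mul c (f := fun x => f x + g x + h x) (by fun_prop),
    lintegral_add_left (f := fun x => f x + g x) (by fun_prop), lintegral_add_left hf]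

/-- Random coding at water level `θ`: some `n` points approximate, within squared distance
`(1 + δ) θ s` on the `s` active coordinates, all but an exponentially small mass. -/
theorem diagGaussian_exists_code {ι : Type*} [Fintype ι] (v : ι → ℝ≥0) {θ : ℝ≥0} (hθ : θ ≠ 0)
    {δ : ℝ} (hδ : 0 < δ) (hδ1 : δ ≤ 1) (n : ℕ) {s : ℝ}
    (hs : s = (Finset.univ.filter fun k => θ < v k).card) :
    ∃ A : Fin n → ι → ℝ,
      diagGaussian v {x | ∀ j, (1 + δ) * θ * s < ∑ k, if θ < v k then (x k - A j k) ^ 2 else 0}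
        ≤ ENNReal.ofReal (3 * rexp (-(δ ^ 2 * s / 16))
          + rexp (-(n * rexp (-(waterRate v θ + δ * s))))) := by
  have hθ' : (0:ℝ) < θ := by positivity
  set Φ : ℝ → (ι → ℝ) → (ι → ℝ) → ℝ := fun t x a =>
    ∑ k, if θ < v k then t * ((x k - a k) ^ 2 / θ - 1) else 0 with hΦ
  set Ψ : ℝ → (ι → ℝ) → ℝ := fun t x =>
    ∑ k, if θ < v k then t * ((x k) ^ 2 / v k - 1) else 0 with hΨ
  have hΦl : ∀ t x a, Φ t x a = t * Φ 1 x a := fun t x a => by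
    simp only [hΦ, Finset.mul_sum, mul_ite, mul_zero, one_mul]
  have hΨl : ∀ t x, Ψ t x = t * Ψ 1 x := fun t x => by
    simp only [hΨ, Finset.mul_sum, mul_ite, mul_zero, one_mul]
  have hΦm : ∀ t, Measurable fun z : (ι → ℝ) × (ι → ℝ) => Φ t z.1 z.2 := fun t =>
    Finset.measurable_fun_sum _ fun k _ => by split_ifs <;> fun_prop
  have hΨm : ∀ t, Measurable fun x : ι → ℝ => Ψ t x := fun t =>
    Finset.measurable_fun_sum _ fun k _ => by split_ifs <;> fun_prop
  set B : Set ((ι → ℝ) × (ι → ℝ)) :=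
    {z | δ * s < Φ 1 z.1 z.2} ∪ {z | Φ 1 z.1 z.2 < -(δ * s)} ∪ {z | δ * s < Ψ 1 z.1} with hBdef
  have hB : MeasurableSet B :=
    ((measurableSet_lt measurable_const (hΦm 1)).union
      (measurableSet_lt (hΦm 1) measurable_const)).union
      (measurableSet_lt measurable_const ((hΨm 1).comp measurable_fst))
  set w : (ι → ℝ) → (ι → ℝ) → ENNReal := fun x a => ∏ k, channelDensity (v k) θ (x k) (a k) with hw
  have hwm : Measurable (Function.uncurry w) := measurable_prod_channelDensity v θ
  have hwe : ∀ x a, w x a = ENNReal.ofReal (rexp (waterRate v θ + (Ψ (1/2) x - Φ (1/2) x a))) := by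
    intro x a
    simp only [hw, channelDensity_eq_exp hθ]
    rw [← ofReal_exp_sum, Finset.sum_add_distrib, Finset.sum_sub_distrib, ← Finset.mul_sum]
    rfl
  have hwΓ : ∀ x a, (x, a) ∉ B → w x a ≤ ENNReal.ofReal (rexp (waterRate v θ + δ * s)) := by
    intro x a h
    simp only [hBdef, Set.mem_union, Set.mem_ofPred_eq, not_or, not_lt] at h
    rw [hwe]
    refine ENNReal.ofReal_le_ofReal (Real.exp_le_exp.2 ?_)
    rw [hΦl, hΨl]
    linarith [h.1.1, h.1.2, h.2]
  obtain ⟨A, hA⟩ := exists_tuple_measure_uncovered_le_of_density (diagGaussian v)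
    (diagGaussian fun k => v k - θ) hB hwm (lintegral_prod_channelDensity v hθ) (Real.exp_pos _)
    hwΓ n
  refine ⟨A, (measure_mono ?_).trans (hA.trans ?_)⟩
  · intro x hx j
    refine Or.inl (Or.inl ?_)
    have h1 := hx j
    have h2 : ∑ k, (if θ < v k then (x k - A j k) ^ 2 else 0) = θ * (Φ 1 x (A j) + s) := by
      rw [hs, ← one_mul (Nat.cast _), ← sum_ite_const_eq, hΦ, ← Finset.sum_add_distrib,
        Finset.mul_sum]
      refine Finset.sum_congr rfl fun k _ => ?_
      split_ifs
      · field_simp; ring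
      · simp
    rw [h2] at h1
    show δ * s < Φ 1 x (A j)
    have : (θ:ℝ) * ((1 + δ) * s) < θ * (Φ 1 x (A j) + s) := by linarith
    have := lt_of_mul_lt_mul_left this hθ'.le
    linarith
  · rw [ENNReal.ofReal_add (by positivity) (by positivity)]
    refine add_le_add ?_ (le_of_eq ?_)
    · set t := δ / 8 with ht
      set c : ENNReal := ENNReal.ofReal (rexp (-(t * (δ * s)))) with hc
      have ht1 : |t| ≤ 1 / 4 := by rw [abs_of_pos (by positivity)]; linarith
      have ht2 : |-t| ≤ 1 / 4 := by rwa [abs_neg]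
      set e : ℝ → (ι → ℝ) → (ι → ℝ) → ENNReal := fun τ x a =>
        w x a * ENNReal.ofReal (rexp (Φ τ x a)) with he
      set f : (ι → ℝ) → (ι → ℝ) → ENNReal := fun x a =>
        w x a * ENNReal.ofReal (rexp (Ψ t x)) with hf
      have hem : ∀ τ, Measurable (Function.uncurry (e τ)) := fun τ =>
        hwm.mul (hΦm τ).exp.ennreal_ofReal
      have hfm : Measurable (Function.uncurry f) :=
        hwm.mul ((hΨm t).comp measurable_fst).exp.ennreal_ofReal
      have hbound : ∀ x, ∫⁻ a in {a | (x, a) ∈ B}, w x a ∂(diagGaussian fun k => v k - θ)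
          ≤ c * ((∫⁻ a, e t x a ∂(diagGaussian fun k => v k - θ))
            + (∫⁻ a, e (-t) x a ∂(diagGaussian fun k => v k - θ))
            + ∫⁻ a, f x a ∂(diagGaussian fun k => v k - θ)) := by
        intro x
        rw [← lintegral_const_mul_add_add _ c (hem t).of_uncurry_left (hem (-t)).of_uncurry_left
          hfm.of_uncurry_left]
        have hBx : MeasurableSet {a | (x, a) ∈ B} :=
          (by fun_prop : Measurable fun a : ι → ℝ => (x, a)) hB
        rw [← lintegral_indicator hBx]
        refine lintegral_mono fun a => ?_
        by_cases h : (x, a) ∈ B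
        · rw [Set.indicator_of_mem (show a ∈ {a | (x, a) ∈ B} from h)]
          have key : ∀ y : ℝ, t * (δ * s) ≤ y → w x a ≤ c * (w x a * ENNReal.ofReal (rexp y)) := by
            intro y hy
            rw [mul_left_comm, hc, ← ENNReal.ofReal_mul (Real.exp_pos _).le, ← Real.exp_add]
            refine le_mul_of_one_le_right (zero_le) ?_
            rw [ENNReal.one_le_ofReal]
            exact Real.one_le_exp (by linarith)
          have ht0 : 0 < t := by positivity
          rw [mul_add, mul_add]
          rcases h with (h | h) | h
          · refine (key (Φ t x a) ?_).trans ?_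
            · rw [hΦl]; exact (mul_le_mul_of_nonneg_left (le_of_lt h) ht0.le)
            · exact le_add_right le_self_add
          · refine (key (Φ (-t) x a) ?_).trans ?_
            · rw [hΦl]
              have h' : Φ 1 x a < -(δ * s) := h
              nlinarith
            · exact le_add_right le_add_self
          · refine (key (Ψ t x) ?_).trans ?_
            · rw [hΨl]; exact (mul_le_mul_of_nonneg_left (le_of_lt h) ht0.le)
            · exact le_add_self
        · rw [Set.indicator_of_notMem (show a ∉ {a | (x, a) ∈ B} from h)]
          exact zero_le
      refine (lintegral_mono hbound).trans ?_
      rw [lintegral_const_mul_add_add _ c (hem t).lintegral_prod_right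
        (hem (-t)).lintegral_prod_right hfm.lintegral_prod_right]
      have h1 := lintegral_noise_tail_le v hθ ht1
      have h2 := lintegral_noise_tail_le v hθ ht2
      have h3 := lintegral_source_tail_le v hθ ht1
      rw [← hs] at h1 h2 h3
      rw [neg_sq] at h2
      calc _ ≤ c * (ENNReal.ofReal (rexp (4 * t ^ 2 * s)) + ENNReal.ofReal (rexp (4 * t ^ 2 * s))
            + ENNReal.ofReal (rexp (4 * t ^ 2 * s))) := by gcongr
        _ = ENNReal.ofReal (3 * rexp (-(δ ^ 2 * s / 16))) := by
            rw [← ENNReal.ofReal_add (by positivity) (by positivity),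
              ← ENNReal.ofReal_add (by positivity) (by positivity), hc,
              ← ENNReal.ofReal_mul (by positivity)]
            congr 1
            have : rexp (-(δ ^ 2 * s / 16)) = rexp (-(t * (δ * s))) * rexp (4 * t ^ 2 * s) := by
              rw [← Real.exp_add, ht]; congr 1; ring
            rw [this]; ring
    · congr 2
      rw [Real.exp_neg (waterRate v θ + δ * s), div_eq_mul_inv]

/-- The fourth moment of the standard Gaussian law. -/
noncomputable def gaussianFourthMoment : ℝ := ∫ x, x ^ 4 ∂(gaussianReal 0 1)

lemma integrable_pow_four_gaussianReal (v : ℝ≥0) :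
    Integrable (fun x : ℝ => x ^ 4) (gaussianReal 0 v) := by
  have h : MemLp (fun x : ℝ => x) 4 (gaussianReal 0 v) := memLp_id_gaussianReal' 4 (by simp)
  have := h.integrable_norm_pow (p := 4) (by norm_num)
  refine this.congr (ae_of_all _ fun x => ?_)
  simp only [Real.norm_eq_abs]
  exact (show Even 4 by decide).pow_abs x

lemma integral_pow_four_gaussianReal (v : ℝ≥0) :
    ∫ x, x ^ 4 ∂(gaussianReal 0 v) = gaussianFourthMoment * (v:ℝ) ^ 2 := by
  have h : gaussianReal 0 v = (gaussianReal 0 1).map (√(v:ℝ) * ·) := by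
    rw [gaussianReal_map_const_mul]
    congr 1
    · simp
    · ext; simp
  rw [h, integral_map (by fun_prop) (by fun_prop), gaussianFourthMoment, ← integral_mul_const]
  refine integral_congr_ae (ae_of_all _ fun x => ?_)
  simp only [mul_pow]
  rw [show √(v:ℝ) ^ 4 = (√(v:ℝ) ^ 2) ^ 2 by ring, Real.sq_sqrt v.coe_nonneg, mul_comm]

lemma setIntegral_sq_le {X : Type*} [MeasurableSpace X] (μ : Measure X) [IsFiniteMeasure μ]
    {f : X → ℝ} (hf : Measurable f) (hf4 : Integrable (fun x => f x ^ 4) μ) {U : Set X}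
    (hU : MeasurableSet U) :
    ∫ x in U, f x ^ 2 ∂μ ≤ √(∫ x, f x ^ 4 ∂μ) * √(μ.real U) := by
  have hpq : Real.HolderConjugate 2 2 := Real.HolderConjugate.two_two
  have h1 : MemLp (fun x => f x ^ 2) (ENNReal.ofReal 2) μ := by
    rw [show ENNReal.ofReal 2 = 2 by simp]
    rw [memLp_two_iff_integrable_sq (by fun_prop)]
    exact hf4.congr (ae_of_all _ fun x => by simp only; ring)
  have h2 : MemLp (U.indicator fun _ => (1:ℝ)) (ENNReal.ofReal 2) μ :=
    (memLp_const (1:ℝ)).indicator hU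
  have h := integral_mul_le_Lp_mul_Lq_of_nonneg hpq (ae_of_all μ fun x => sq_nonneg (f x))
    (ae_of_all μ fun x => Set.indicator_nonneg (fun _ _ => zero_le_one) x) h1 h2
  have e1 : ∫ x, f x ^ 2 * U.indicator (fun _ => (1:ℝ)) x ∂μ = ∫ x in U, f x ^ 2 ∂μ := by
    rw [← integral_indicator hU]
    refine integral_congr_ae (ae_of_all _ fun x => ?_)
    by_cases hx : x ∈ U <;> simp [hx]
  have e2 : ∫ x, (f x ^ 2) ^ (2:ℝ) ∂μ = ∫ x, f x ^ 4 ∂μ :=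
    integral_congr_ae (ae_of_all _ fun x => by
      simp only [Real.rpow_ofNat]; ring)
  have e3 : ∫ x, (U.indicator (fun _ => (1:ℝ)) x) ^ (2:ℝ) ∂μ = μ.real U := by
    rw [← integral_indicator_one hU]
    refine integral_congr_ae (ae_of_all _ fun x => ?_)
    by_cases hx : x ∈ U <;> simp [hx]
  rw [e1, e2, e3] at h
  rwa [Real.sqrt_eq_rpow, Real.sqrt_eq_rpow]

/-- A codebook of at most `n + 1` points whose mean squared error is close to the water-filling
distortion at level `θ`, provided `n` is slightly larger than `exp (waterRate v θ)`. -/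
theorem diagGaussian_quantization_upper {ι : Type*} [Fintype ι] (v : ι → ℝ≥0) {θ : ℝ≥0}
    (hθ : θ ≠ 0) {δ : ℝ} (hδ : 0 < δ) (hδ1 : δ ≤ 1) (n : ℕ) {s : ℝ}
    (hs : s = (Finset.univ.filter fun k => θ < v k).card) :
    ∃ α : Finset (ι → ℝ), α.Nonempty ∧ α.card ≤ n + 1 ∧
      ∫ x, sInf ((fun a : ι → ℝ => ∑ k, (x k - a k) ^ 2) '' (α : Set (ι → ℝ))) ∂(diagGaussian v)
        ≤ waterDist v θ + δ * θ * s + √gaussianFourthMoment * (∑ k, (v k : ℝ)) *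
          √(3 * rexp (-(δ ^ 2 * s / 16)) + rexp (-(n * rexp (-(waterRate v θ + δ * s))))) := by
  classical
  obtain ⟨A, hA⟩ := diagGaussian_exists_code v hθ hδ hδ1 n hs
  set ε := 3 * rexp (-(δ ^ 2 * s / 16)) + rexp (-(n * rexp (-(waterRate v θ + δ * s)))) with hε
  set μ := diagGaussian v with hμ
  set U : Set (ι → ℝ) :=
    {x | ∀ j, (1 + δ) * θ * s < ∑ k, if θ < v k then (x k - A j k) ^ 2 else 0} with hU
  have hUm : MeasurableSet U := by
    have : U = ⋂ j, {x | (1 + δ) * θ * s < ∑ k, if θ < v k then (x k - A j k) ^ 2 else 0} := by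
      ext; simp [hU]
    rw [this]
    refine MeasurableSet.iInter fun j => measurableSet_lt measurable_const ?_
    exact Finset.measurable_fun_sum _ fun k _ => by split_ifs <;> fun_prop
  set A' : Fin n → ι → ℝ := fun j k => if θ < v k then A j k else 0 with hA'
  set α : Finset (ι → ℝ) := insert 0 (Finset.univ.image A') with hα
  have hαne : α.Nonempty := Finset.insert_nonempty _ _
  refine ⟨α, hαne, ?_, ?_⟩
  · refine (Finset.card_insert_le _ _).trans ?_
    gcongr
    simpa using Finset.card_image_le (s := (Finset.univ : Finset (Fin n))) (f := A')
  have hsqk : ∀ k, Integrable (fun x : ι → ℝ => (x k) ^ 2) μ := fun k => by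
    simpa using integrable_comp_eval_diagGaussian v k (integrable_sq_sub_gaussianReal (v k) 0)
  set F : (ι → ℝ) → ℝ := fun x => (1 + δ) * θ * s + ∑ k, (if θ < v k then 0 else (x k) ^ 2)
    + ∑ k, U.indicator (fun x => (x k) ^ 2) x with hF
  have hs0 : 0 ≤ s := by rw [hs]; positivity
  have hle : ∀ x, sInf ((fun a : ι → ℝ => ∑ k, (x k - a k) ^ 2) '' (α : Set (ι → ℝ))) ≤ F x := by
    intro x
    by_cases hx : x ∈ U
    · have h0 : (0 : ι → ℝ) ∈ α := Finset.mem_insert_self _ _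
      refine (Finset.sInf_image_le _ h0).trans ?_
      simp only [hF, Set.indicator_of_mem hx, Pi.zero_apply, sub_zero]
      refine le_add_of_nonneg_left (add_nonneg (by positivity) (Finset.sum_nonneg fun k _ => ?_))
      split_ifs <;> positivity
    · have hx' := hx
      simp only [hU, Set.mem_ofPred_eq, not_forall, not_lt] at hx'
      obtain ⟨j, hj⟩ := hx'
      have h0 : A' j ∈ α := Finset.mem_insert_of_mem (Finset.mem_image_of_mem _ (Finset.mem_univ j))
      refine (Finset.sInf_image_le _ h0).trans ?_
      have : ∑ k, (x k - A' j k) ^ 2 = ∑ k, (if θ < v k then (x k - A j k) ^ 2 else 0)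
          + ∑ k, (if θ < v k then 0 else (x k) ^ 2) := by
        rw [← Finset.sum_add_distrib]
        refine Finset.sum_congr rfl fun k _ => ?_
        simp only [hA']
        split_ifs <;> simp
      simp only [hF, Set.indicator_of_notMem hx, Finset.sum_const_zero, add_zero]
      linarith
  have hi2 : ∀ k, Integrable (fun x : ι → ℝ => if θ < v k then 0 else (x k) ^ 2) μ := fun k => by
    split_ifs
    · exact integrable_zero _ _ _
    · exact hsqk k
  have hi3 : ∀ k, Integrable (fun x => U.indicator (fun x : ι → ℝ => (x k) ^ 2) x) μ := fun k =>
    (hsqk k).indicator hUm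
  have hI1 : Integrable (fun x : ι → ℝ => (1 + δ) * θ * s + ∑ k, (if θ < v k then 0 else (x k) ^ 2)) μ :=
    (integrable_const _).add (integrable_finsetSum _ fun k _ => hi2 k)
  have hI2 : Integrable (fun x : ι → ℝ => ∑ k, U.indicator (fun x => (x k) ^ 2) x) μ :=
    integrable_finsetSum _ fun k _ => hi3 k
  have hFi : Integrable F μ := hI1.add hI2
  have hmono := integral_mono_of_nonneg (μ := μ) (ae_of_all _ fun x => Real.sInf_nonneg (by
    rintro _ ⟨a, -, rfl⟩; exact Finset.sum_nonneg fun _ _ => sq_nonneg _)) hFi (ae_of_all _ hle)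
  refine hmono.trans ?_
  have hEF : ∫ x, F x ∂μ = (1 + δ) * θ * s + ∑ k, (if θ < v k then 0 else (v k : ℝ))
      + ∑ k, ∫ x in U, (x k) ^ 2 ∂μ := by
    rw [hF, integral_add hI1 hI2, integral_add (integrable_const _)
      (integrable_finsetSum _ fun k _ => hi2 k), integral_finsetSum _ fun k _ => hi2 k,
      integral_finsetSum _ fun k _ => hi3 k]
    congr 1
    · congr 1
      · simp
      · refine Finset.sum_congr rfl fun k _ => ?_
        split_ifs
        · simp
        · rw [integral_comp_eval_diagGaussian v k (f := fun y => y ^ 2) (by fun_prop),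
            integral_sq_gaussianReal]
    · exact Finset.sum_congr rfl fun k _ => integral_indicator hUm
  have hD : waterDist v θ = θ * s + ∑ k, (if θ < v k then 0 else (v k : ℝ)) := by
    rw [hs, ← sum_ite_const_eq, ← Finset.sum_add_distrib, waterDist]
    refine Finset.sum_congr rfl fun k _ => ?_
    split_ifs with h
    · rw [min_eq_right (by exact_mod_cast h.le), add_zero]
    · rw [min_eq_left (by exact_mod_cast not_lt.1 h), zero_add]
  have hμU : μ.real U ≤ ε := by
    have := ENNReal.toReal_mono ENNReal.ofReal_ne_top hA
    rwa [ENNReal.toReal_ofReal (by positivity)] at this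
  have hk : ∀ k, ∫ x in U, (x k) ^ 2 ∂μ ≤ √gaussianFourthMoment * v k * √ε := fun k => by
    have h4 := integrable_comp_eval_diagGaussian v k (integrable_pow_four_gaussianReal (v k))
    refine (setIntegral_sq_le μ (measurable_pi_apply k) h4 hUm).trans ?_
    rw [integral_comp_eval_diagGaussian v k (f := fun y => y ^ 4) (by fun_prop),
      integral_pow_four_gaussianReal, Real.sqrt_mul' _ (by positivity), Real.sqrt_sq (v k).coe_nonneg]
    gcongr
  have hsum : ∑ k, ∫ x in U, (x k) ^ 2 ∂μ ≤ √gaussianFourthMoment * (∑ k, (v k : ℝ)) * √ε := by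
    rw [Finset.mul_sum, Finset.sum_mul]
    exact Finset.sum_le_sum fun k _ => hk k
  rw [hEF, hD]
  linarith

/-- The number of variances exceeding the level `u`. -/
noncomputable def countAbove {ι : Type*} [Fintype ι] (v : ι → ℝ≥0) (u : ℝ) : ℕ :=
  (Finset.univ.filter fun k => u < v k).card

/-- The Lagrangian value of reverse water-filling at level `θ`. -/
noncomputable def waterSum {ι : Type*} [Fintype ι] (v : ι → ℝ≥0) (θ : ℝ) : ℝ :=
  waterDist v θ + 2 * θ * waterRate v θ

lemma integrableOn_min_one_div {θ : ℝ} (hθ : 0 < θ) (l : ℝ) :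
    IntegrableOn (fun u : ℝ => min 1 (θ / u)) (Set.Ioc 0 l) := by
  refine Measure.integrableOn_of_bounded (M := 1) (by simp) (by fun_prop) ?_
  refine (ae_restrict_iff' measurableSet_Ioc).2 (ae_of_all _ fun u hu => ?_)
  have : 0 < u := hu.1
  rw [Real.norm_of_nonneg (by positivity)]
  exact min_le_left _ _

lemma integral_min_one_div {θ : ℝ} (hθ : 0 < θ) {l : ℝ} (hl : 0 ≤ l) :
    ∫ u in Set.Ioc 0 l, min 1 (θ / u) = min l θ + θ * max 0 (Real.log (l / θ)) := by
  rcases le_or_gt l θ with h | h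
  · have h1 : ∫ u in Set.Ioc 0 l, min 1 (θ / u) = ∫ _ in Set.Ioc 0 l, (1:ℝ) := by
      refine setIntegral_congr_fun measurableSet_Ioc fun u hu => ?_
      have : 0 < u := hu.1
      rw [min_eq_left]
      rw [le_div_iff₀ this]; linarith [hu.2]
    rw [h1, min_eq_left h, max_eq_left (Real.log_nonpos (by positivity) (by rwa [div_le_one hθ]))]
    simp [hl]
  · have hsplit : Set.Ioc 0 l = Set.Ioc 0 θ ∪ Set.Ioc θ l :=
      (Set.Ioc_union_Ioc_eq_Ioc hθ.le h.le).symm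
    have hi := integrableOn_min_one_div hθ l
    rw [hsplit, setIntegral_union (Set.Ioc_disjoint_Ioc_of_le le_rfl) measurableSet_Ioc
      (integrableOn_min_one_div hθ θ) (hi.mono_set (Set.Ioc_subset_Ioc_left hθ.le))]
    have h1 : ∫ u in Set.Ioc 0 θ, min 1 (θ / u) = ∫ _ in Set.Ioc 0 θ, (1:ℝ) := by
      refine setIntegral_congr_fun measurableSet_Ioc fun u hu => ?_
      have : 0 < u := hu.1
      rw [min_eq_left]
      rw [le_div_iff₀ this]; linarith [hu.2]
    have h2 : ∫ u in Set.Ioc θ l, min 1 (θ / u) = ∫ u in Set.Ioc θ l, θ * u⁻¹ := by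
      refine setIntegral_congr_fun measurableSet_Ioc fun u hu => ?_
      have : 0 < u := hθ.trans hu.1
      rw [min_eq_right, div_eq_mul_inv]
      rw [div_le_one this]; exact hu.1.le
    have h3 : ∫ u in Set.Ioc θ l, u⁻¹ = Real.log (l / θ) := by
      rw [← intervalIntegral.integral_of_le h.le, integral_inv_of_pos hθ (hθ.trans h)]
    rw [h1, h2, integral_const_mul, h3, min_eq_right h.le,
      max_eq_right (Real.log_nonneg (by rw [one_le_div hθ]; exact h.le))]
    simp [hθ.le]

lemma waterSum_eq_integral {ι : Type*} [Fintype ι] (v : ι → ℝ≥0) {θ : ℝ} (hθ : 0 < θ) :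
    IntegrableOn (fun u : ℝ => countAbove v u * min 1 (θ / u)) (Set.Ioi 0) ∧
    waterSum v θ = ∫ u in Set.Ioi (0:ℝ), countAbove v u * min 1 (θ / u) := by
  have hae : ∀ᵐ u : ℝ ∂(volume.restrict (Set.Ioi (0:ℝ))), (countAbove v u : ℝ) * min 1 (θ / u) =
      ∑ k, (Set.Ioc 0 (v k : ℝ)).indicator (fun u => min 1 (θ / u)) u := by
    have hne : ∀ᵐ u : ℝ ∂(volume.restrict (Set.Ioi (0:ℝ))), ∀ k, u ≠ v k := by
      rw [ae_all_iff]
      exact fun k => ae_restrict_of_ae (Measure.ae_ne volume (v k : ℝ))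
    filter_upwards [hne, ae_restrict_mem measurableSet_Ioi] with u hu hu0
    rw [countAbove, Finset.card_filter, Nat.cast_sum, Finset.sum_mul]
    refine Finset.sum_congr rfl fun k _ => ?_
    by_cases h : u < v k
    · rw [Set.indicator_of_mem (show u ∈ Set.Ioc 0 (v k : ℝ) from ⟨hu0, h.le⟩)]; simp [h]
    · rw [Set.indicator_of_notMem (fun h' => h (lt_of_le_of_ne h'.2 (hu k)))]; simp [h]
  have hik : ∀ k, Integrable ((Set.Ioc 0 (v k : ℝ)).indicator fun u => min 1 (θ / u))
      (volume.restrict (Set.Ioi (0:ℝ))) := fun k =>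
    ((integrable_indicator_iff measurableSet_Ioc).2
      (integrableOn_min_one_div hθ (v k))).mono_measure Measure.restrict_le_self
  refine ⟨(integrable_finsetSum _ fun k _ => hik k).congr
    (hae.mono fun u hu => hu.symm), ?_⟩
  rw [integral_congr_ae hae, integral_finsetSum _ fun k _ => hik k, waterSum, waterDist, waterRate,
    show 2 * θ * (1 / 2 * ∑ k, max 0 (Real.log (v k / θ)))
      = θ * ∑ k, max 0 (Real.log (v k / θ)) by ring, Finset.mul_sum, ← Finset.sum_add_distrib]
  refine Finset.sum_congr rfl fun k _ => ?_
  rw [setIntegral_indicator measurableSet_Ioc, ← integral_min_one_div hθ (v k).coe_nonneg]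
  congr 2
  ext u; simp

lemma integral_rpow_mul_min_one_div {θ γ : ℝ} (hθ : 0 < θ) (h0 : 0 < γ) (h1 : γ < 1) :
    IntegrableOn (fun u : ℝ => u ^ (-γ) * min 1 (θ / u)) (Set.Ioi 0) ∧
    ∫ u in Set.Ioi (0:ℝ), u ^ (-γ) * min 1 (θ / u) = (1 / (1 - γ) + 1 / γ) * θ ^ (1 - γ) := by
  have e1 : Set.EqOn (fun u : ℝ => u ^ (-γ) * min 1 (θ / u)) (fun u => u ^ (-γ)) (Set.Ioc 0 θ) := by
    intro u hu
    have : 0 < u := hu.1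
    simp only
    rw [min_eq_left, mul_one]
    rw [le_div_iff₀ this]; linarith [hu.2]
  have e2 : Set.EqOn (fun u : ℝ => u ^ (-γ) * min 1 (θ / u)) (fun u => θ * u ^ (-γ - 1))
      (Set.Ioi θ) := by
    intro u hu
    have hu' : 0 < u := hθ.trans hu
    simp only
    rw [min_eq_right (by rw [div_le_one hu']; exact (le_of_lt hu)), Real.rpow_sub_one hu'.ne']
    ring
  have i1 : IntegrableOn (fun u : ℝ => u ^ (-γ)) (Set.Ioc 0 θ) := by
    rw [← intervalIntegrable_iff_integrableOn_Ioc_of_le hθ.le]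
    exact intervalIntegral.intervalIntegrable_rpow' (by linarith)
  have i2 : IntegrableOn (fun u : ℝ => θ * u ^ (-γ - 1)) (Set.Ioi θ) :=
    (integrableOn_Ioi_rpow_of_lt (by linarith) hθ).const_mul θ
  have i1' := i1.congr_fun e1.symm measurableSet_Ioc
  have i2' := i2.congr_fun e2.symm measurableSet_Ioi
  have hsplit : Set.Ioi (0:ℝ) = Set.Ioc 0 θ ∪ Set.Ioi θ := (Set.Ioc_union_Ioi_eq_Ioi hθ.le).symm
  rw [hsplit]
  refine ⟨i1'.union i2', ?_⟩
  rw [setIntegral_union (Set.Ioc_disjoint_Ioi le_rfl) measurableSet_Ioi i1' i2',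
    setIntegral_congr_fun measurableSet_Ioc e1, setIntegral_congr_fun measurableSet_Ioi e2,
    integral_const_mul, integral_Ioi_rpow_of_lt (by linarith) hθ,
    ← intervalIntegral.integral_of_le hθ.le, integral_rpow (Or.inl (by linarith)),
    Real.zero_rpow (by linarith)]
  have h3 : θ ^ (1 - γ) = θ * θ ^ (-γ) := by
    rw [sub_eq_add_neg, Real.rpow_add hθ, Real.rpow_one]
  have h4 : -γ + 1 = 1 - γ := by ring
  have h5 : -γ - 1 + 1 = -γ := by ring
  rw [h4, h5, h3]
  have : 1 - γ ≠ 0 := by linarith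
  field_simp
  ring

/-- Counting functions control water-filling values. -/
lemma waterSum_le_of_countAbove_le {ι κ : Type*} [Fintype ι] [Fintype κ] (v : ι → ℝ≥0)
    (w : κ → ℝ≥0) {θ γ C : ℝ} (hθ : 0 < θ) (h0 : 0 < γ) (h1 : γ < 1)
    (h : ∀ u > 0, (countAbove v u : ℝ) ≤ countAbove w u + C * u ^ (-γ)) :
    waterSum v θ ≤ waterSum w θ + C * ((1 / (1 - γ) + 1 / γ) * θ ^ (1 - γ)) := by
  obtain ⟨iv, ev⟩ := waterSum_eq_integral v hθ
  obtain ⟨iw, ew⟩ := waterSum_eq_integral w hθ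
  obtain ⟨ir, er⟩ := integral_rpow_mul_min_one_div hθ h0 h1
  rw [ev, ew, ← er, ← integral_const_mul, ← integral_add iw (ir.const_mul C)]
  refine setIntegral_mono_on iv (iw.add (ir.const_mul C)) measurableSet_Ioi fun u hu => ?_
  have hu' : (0:ℝ) < u := hu
  have := mul_le_mul_of_nonneg_right (h u hu') (by positivity : 0 ≤ min 1 (θ / u))
  linarith

lemma waterSum_smul {ι : Type*} [Fintype ι] (v : ι → ℝ≥0) {θ : ℝ} (c : ℝ≥0) (hc : c ≠ 0) :
    waterSum (fun k => c * v k) (c * θ) = c * waterSum v θ := by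
  have hc' : (0:ℝ) < c := by positivity
  simp only [waterSum, waterDist, waterRate, NNReal.coe_mul]
  rw [mul_add]
  congr 1
  · rw [Finset.mul_sum]
    exact Finset.sum_congr rfl fun k _ => (mul_min_of_nonneg _ _ hc'.le).symm
  · have : ∀ k, (c:ℝ) * v k / (c * θ) = v k / θ := fun k => mul_div_mul_left _ _ hc'.ne'
    simp_rw [this]
    ring

lemma continuousOn_waterRate {ι : Type*} [Fintype ι] (v : ι → ℝ≥0) :
    ContinuousOn (waterRate v) (Set.Ioi 0) := by
  refine continuousOn_const.mul (continuousOn_finsetSum _ fun k _ => ContinuousOn.sup continuousOn_const ?_)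
  by_cases hk : (v k : ℝ) = 0
  · simp [hk, continuousOn_const]
  · refine ContinuousOn.log (continuousOn_const.div continuousOn_id fun u hu => (ne_of_gt hu)) ?_
    exact fun u hu => div_ne_zero hk (ne_of_gt hu)

lemma le_waterRate {ι : Type*} [Fintype ι] (v : ι → ℝ≥0) {θ : ℝ} (hθ : 0 < θ) :
    Real.log 2 / 2 * countAbove v (2 * θ) ≤ waterRate v θ := by
  have : Real.log 2 * countAbove v (2 * θ) ≤ ∑ k, max 0 (Real.log (v k / θ)) := by
    rw [countAbove, Finset.card_filter, Nat.cast_sum, Finset.mul_sum]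
    refine Finset.sum_le_sum fun k _ => ?_
    split_ifs with h
    · refine le_max_of_le_right ?_
      simp only [Nat.cast_one, mul_one]
      exact Real.log_le_log (by norm_num) (by rw [le_div_iff₀ hθ]; exact h.le)
    · simp
  rw [waterRate]; linarith

lemma mul_countAbove_le_waterDist {ι : Type*} [Fintype ι] (v : ι → ℝ≥0) {θ : ℝ} (hθ : 0 < θ) :
    θ * countAbove v θ ≤ waterDist v θ := by
  rw [countAbove, Finset.card_filter, Nat.cast_sum, Finset.mul_sum, waterDist]
  refine Finset.sum_le_sum fun k _ => ?_
  split_ifs with h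
  · simp [h.le]
  · simp [hθ.le]

lemma waterDist_nonneg {ι : Type*} [Fintype ι] (v : ι → ℝ≥0) {θ : ℝ} (hθ : 0 ≤ θ) :
    0 ≤ waterDist v θ :=
  Finset.sum_nonneg fun k _ => le_min (v k).coe_nonneg hθ

/-- The smallest level for which `exists_water_level` needs a lower bound on the counting
function. -/
noncomputable def levelBound (β c L : ℝ) : ℝ := (c * Real.log 2 / (2 * L)) ^ (1 / β) / 2

lemma levelBound_pos {β c L : ℝ} (hc : 0 < c) (hL : 0 < L) : 0 < levelBound β c L := by
  have := Real.log_pos one_lt_two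
  unfold levelBound; positivity

lemma two_mul_levelBound_rpow {β c L : ℝ} (hβ : 0 < β) (hc : 0 < c) (hL : 0 < L) :
    (2 * levelBound β c L) ^ (-β) = 2 * L / (c * Real.log 2) := by
  have := Real.log_pos one_lt_two
  have h : 2 * levelBound β c L = (c * Real.log 2 / (2 * L)) ^ (1 / β) := by
    unfold levelBound; ring
  rw [h, ← Real.rpow_mul (by positivity), show 1 / β * -β = -1 by field_simp, Real.rpow_neg_one,
    inv_div]

lemma waterRate_eq_zero {ι : Type*} [Fintype ι] (v : ι → ℝ≥0) {θ : ℝ} (hθ : 0 < θ)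
    (h : ∀ k, (v k : ℝ) ≤ θ) : waterRate v θ = 0 := by
  rw [waterRate, Finset.sum_eq_zero, mul_zero]
  exact fun k _ => max_eq_left (Real.log_nonpos (div_nonneg (v k).coe_nonneg hθ.le)
    (by rw [div_le_one hθ]; exact h k))

/-- Two-sided power bounds on the counting function locate the water level of a given rate. -/
lemma exists_water_level {ι : Type*} [Fintype ι] (v : ι → ℝ≥0) {β C c us ε L : ℝ}
    (h0 : 0 < β) (h1 : β < 1) (hc : 0 < c) (hε : 0 < ε) (hε2 : ε ≤ 1 / 2) (hL : 0 < L)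
    (hus : 2 * levelBound β c L ≤ us)
    (hC : ∀ u > 0, (countAbove v u : ℝ) ≤ C * u ^ (-β))
    (hc' : ∀ u ≥ levelBound β c L, u ≤ us → c * u ^ (-β) ≤ countAbove v u) :
    ∃ θ ≥ levelBound β c L, waterRate v θ = (1 - ε) * L ∧
      θ ^ β ≤ C * (1 / (1 - β) + 1 / β) / L := by
  set θ₀ := levelBound β c L with hθ₀
  have hθ₀p : 0 < θ₀ := levelBound_pos hc hL
  have hl2 := Real.log_pos one_lt_two
  set θ₁ := θ₀ + ∑ k, (v k : ℝ) with hθ₁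
  have hS : 0 ≤ ∑ k, (v k : ℝ) := Finset.sum_nonneg fun k _ => (v k).coe_nonneg
  have hR0 : L ≤ waterRate v θ₀ := by
    refine le_trans ?_ (le_waterRate v hθ₀p)
    have := hc' (2 * θ₀) (by linarith) hus
    rw [hθ₀, two_mul_levelBound_rpow h0 hc hL] at this
    calc L = Real.log 2 / 2 * (c * (2 * L / (c * Real.log 2))) := by field_simp
      _ ≤ _ := mul_le_mul_of_nonneg_left this (by positivity)
  have hR1 : waterRate v θ₁ = 0 := waterRate_eq_zero v (by linarith) fun k => by
    have := Finset.single_le_sum (f := fun k => (v k : ℝ)) (fun k _ => (v k).coe_nonneg)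
      (Finset.mem_univ k)
    linarith
  have hcont : ContinuousOn (waterRate v) (Set.Icc θ₀ θ₁) :=
    (continuousOn_waterRate v).mono fun u hu => hθ₀p.trans_le hu.1
  have hmem : (1 - ε) * L ∈ Set.Icc (waterRate v θ₁) (waterRate v θ₀) := by
    rw [hR1]; constructor
    · exact mul_nonneg (by linarith) hL.le
    · nlinarith
  obtain ⟨θ, hθ, hθR⟩ := intermediate_value_Icc' (by linarith) hcont hmem
  refine ⟨θ, hθ.1, hθR, ?_⟩
  have hθp : 0 < θ := hθ₀p.trans_le hθ.1
  have key := waterSum_le_of_countAbove_le v (fun _ : Fin 0 => (0:ℝ≥0)) hθp h0 h1 (C := C)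
    (by simpa [countAbove] using hC)
  have hz : waterSum (fun _ : Fin 0 => (0:ℝ≥0)) θ = 0 := by simp [waterSum, waterDist, waterRate]
  rw [hz, waterSum, hθR] at key
  have hD := waterDist_nonneg v hθp.le
  have e : θ ^ (1 - β) * θ ^ β = θ := by rw [← Real.rpow_add hθp]; simp
  have hp : 0 < θ ^ (1 - β) := by positivity
  rw [le_div_iff₀ hL]
  have : θ * L ≤ C * ((1 / (1 - β) + 1 / β) * θ ^ (1 - β)) := by
    nlinarith [mul_pos hθp hL]
  refine le_of_mul_le_mul_left ?_ hp
  calc θ ^ (1 - β) * (θ ^ β * L) = θ * L := by rw [← mul_assoc, e]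
    _ ≤ _ := this
    _ = _ := by ring

/-- Existence of good codes at a water level with many active coordinates. -/
lemma exists_code_le {ι : Type*} [Fintype ι] (v : ι → ℝ≥0) {θ ε τ δ C₁ c₁ L T : ℝ} {n : ℕ}
    (hθ : 0 < θ) (hn : 2 ≤ n) (hL : L = Real.log n) (hδ : 0 < δ) (hδ1 : δ ≤ 1)
    (hδτ : δ ≤ τ / 2) (hδε : δ * C₁ ≤ ε / 2) 
    (hR : waterRate v θ = (1 - ε) * L) (hT : ∑ k, (v k : ℝ) ≤ T)
    (hs1 : c₁ * L ≤ countAbove v θ) (hs2 : (countAbove v θ : ℝ) ≤ C₁ * L)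
    (herr : √gaussianFourthMoment * T * (2 * exp (-(min (δ ^ 2 * c₁ / 16) (ε / 4) / 2 * L)))
      ≤ τ / 2 * θ * (c₁ * L)) :
    ∃ α : Finset (ι → ℝ), α.Nonempty ∧ α.card ≤ n ∧
      ∫ x, sInf ((fun a => ∑ k, (x k - a k) ^ 2) '' (α : Set (ι → ℝ))) ∂(diagGaussian v)
        ≤ (1 + τ) * waterDist v θ := by
  have hn0 : (0:ℝ) < n := by positivity
  have hLp : 0 < L := by rw [hL]; exact Real.log_pos (by exact_mod_cast hn)
  set θ' : ℝ≥0 := ⟨θ, hθ.le⟩ with hθ'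
  have hco : (θ' : ℝ) = θ := rfl
  set s : ℝ := (countAbove v θ : ℝ) with hs
  obtain ⟨α, hα, hcard, hle⟩ := diagGaussian_quantization_upper v (θ := θ')
    (by intro h; rw [h] at hco; simp at hco; linarith) hδ hδ1 (n - 1) (s := s)
    (by rw [hs, countAbove]; norm_cast)
  refine ⟨α, hα, by omega, hle.trans ?_⟩
  rw [hco]
  set a := min (δ ^ 2 * c₁ / 16) (ε / 4) with ha
  have hb1 : exp (-(δ ^ 2 * s / 16)) ≤ exp (-(a * L)) := by
    refine exp_le_exp.2 (neg_le_neg ?_)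
    have := mul_le_mul_of_nonneg_right (min_le_left (δ ^ 2 * c₁ / 16) (ε / 4)) hLp.le
    nlinarith [mul_le_mul_of_nonneg_left hs1 (sq_nonneg δ)]
  have hb2 : exp (-(((n - 1 : ℕ) : ℝ) * exp (-(waterRate v θ + δ * s)))) ≤ exp (-(a * L)) := by
    refine exp_le_exp.2 (neg_le_neg ?_)
    have e1 : exp (-((1 - ε / 2) * L)) ≤ exp (-(waterRate v θ + δ * s)) := by
      refine exp_le_exp.2 (neg_le_neg ?_)
      rw [hR]
      nlinarith [mul_le_mul_of_nonneg_left hs2 hδ.le]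
    have e2 : exp L / 2 ≤ ((n - 1 : ℕ) : ℝ) := by
      rw [hL, exp_log hn0, Nat.cast_sub (by omega)]
      have : (2:ℝ) ≤ n := by exact_mod_cast hn
      push_cast; linarith
    have e3 : exp L / 2 * exp (-((1 - ε / 2) * L)) = exp (ε / 2 * L) / 2 := by
      rw [div_mul_eq_mul_div, ← exp_add]; ring_nf
    have e4 := add_one_le_exp (ε / 2 * L)
    calc a * L ≤ ε / 4 * L := mul_le_mul_of_nonneg_right (min_le_right _ _) hLp.le
      _ ≤ exp (ε / 2 * L) / 2 := by linarith
      _ ≤ _ := by rw [← e3]; exact mul_le_mul e2 e1 (exp_pos _).le (by positivity)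
  have hsqrt : √(3 * exp (-(δ ^ 2 * s / 16)) + exp (-(((n - 1 : ℕ) : ℝ) *
      exp (-(waterRate v θ + δ * s))))) ≤ 2 * exp (-(a / 2 * L)) := by
    rw [Real.sqrt_le_left (by positivity), mul_pow, ← exp_nat_mul]
    have : ((2:ℕ):ℝ) * -(a / 2 * L) = -(a * L) := by push_cast; ring
    rw [this]; linarith
  have hD := mul_countAbove_le_waterDist v hθ
  rw [← hs] at hD
  have hS : 0 ≤ ∑ k, (v k : ℝ) := Finset.sum_nonneg fun k _ => (v k).coe_nonneg
  have h3 : √gaussianFourthMoment * (∑ k, (v k : ℝ)) * √(3 * exp (-(δ ^ 2 * s / 16)) +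
      exp (-(((n - 1 : ℕ) : ℝ) * exp (-(waterRate v θ + δ * s))))) ≤ τ / 2 * θ * (c₁ * L) := by
    refine le_trans ?_ herr
    refine mul_le_mul ?_ hsqrt (by positivity)
      (mul_nonneg (Real.sqrt_nonneg _) (hS.trans hT))
    exact mul_le_mul_of_nonneg_left hT (Real.sqrt_nonneg _)
  have hs0 : 0 ≤ s := Nat.cast_nonneg _
  have hτ : 0 < τ := by linarith
  have h4 : τ / 2 * θ * (c₁ * L) ≤ τ / 2 * θ * s := mul_le_mul_of_nonneg_left hs1 (by positivity)
  have h5 : δ * (θ * s) ≤ τ / 2 * (θ * s) := mul_le_mul_of_nonneg_right hδτ (by positivity)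
  have h6 : τ * (θ * s) ≤ τ * waterDist v θ := mul_le_mul_of_nonneg_left hD hτ.le
  linarith

lemma countAbove_div {ι : Type*} [Fintype ι] (w : ι → ℝ≥0) {a : ℝ≥0} (ha : a ≠ 0) (u : ℝ) :
    countAbove (fun k => a⁻¹ * w k) u = countAbove w (a * u) := by
  have ha' : (0:ℝ) < a := by positivity
  unfold countAbove
  congr 2
  ext k
  push_cast
  rw [← div_eq_inv_mul, lt_div_iff₀ ha', mul_comm]

/-- Lower bound for the quantization error of `w` by the water-filling distortion of `v`. -/
lemma waterDist_le_of_countAbove_le {ι κ : Type*} [Fintype ι] [Fintype κ] (v : ι → ℝ≥0)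
    (w : κ → ℝ≥0) {θ ε τ η β γ D c₁ c L : ℝ} {n : ℕ} (hθ : 0 < θ) (hL : L = Real.log n)
    (hη1 : η < 1) (hγ : 0 < γ) (hγ1 : γ < 1) 
    (hR : waterRate v θ = (1 - ε) * L) (hτ : 0 ≤ τ) (hL0 : 0 ≤ L)
    (h : ∀ u > 0, (countAbove v u : ℝ) ≤ countAbove w ((1 - η) * u) + D * u ^ (-γ))
    (hc : c * θ ^ (-β) ≤ countAbove v θ) (hc1 : c₁ * L ≤ countAbove v θ)
    (hε : 2 * ε ≤ τ * c₁)
    (hD : D * (1 / (1 - γ) + 1 / γ) * θ ^ (β - γ) ≤ τ * c)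
    (α : Finset (κ → ℝ)) (hα : α.Nonempty) (hcard : α.card ≤ n) :
    (1 - η) * ((1 - 2 * τ) * waterDist v θ) ≤
      ∫ x, sInf ((fun a => ∑ k, (x k - a k) ^ 2) '' (α : Set (κ → ℝ))) ∂(diagGaussian w) := by
  set a : ℝ≥0 := ⟨1 - η, by linarith⟩ with ha
  have hco : (a : ℝ) = 1 - η := rfl
  have hap : 0 < 1 - η := by linarith
  have ha0 : a ≠ 0 := by intro h; rw [h] at hco; simp at hco; linarith
  refine le_trans ?_ (diagGaussian_quantization_lower w (mul_pos hap hθ) hα)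
  have hlog : Real.log α.card ≤ L := by
    rw [hL]; exact Real.log_le_log (by exact_mod_cast hα.card_pos) (by exact_mod_cast hcard)
  have hw : waterSum w ((1 - η) * θ) = (1 - η) * waterSum (fun k => a⁻¹ * w k) θ := by
    rw [← hco, ← waterSum_smul _ a ha0]
    congr 1; ext k; rw [mul_inv_cancel_left₀ ha0]
  have hv := waterSum_le_of_countAbove_le v (fun k => a⁻¹ * w k) hθ hγ hγ1 (C := D) (fun u hu => by
    rw [countAbove_div w ha0, hco]; exact h u hu)
  have hdist := mul_countAbove_le_waterDist v hθ
  have e : θ ^ (1 - γ) = θ ^ (β - γ) * (θ * θ ^ (-β)) := by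
    rw [show 1 - γ = (β - γ) + (1 + -β) by ring, Real.rpow_add hθ, Real.rpow_add hθ, Real.rpow_one]
  have i1 : D * ((1 / (1 - γ) + 1 / γ) * θ ^ (1 - γ)) ≤ τ * waterDist v θ := by
    calc _ = D * (1 / (1 - γ) + 1 / γ) * θ ^ (β - γ) * (θ * θ ^ (-β)) := by rw [e]; ring
      _ ≤ τ * c * (θ * θ ^ (-β)) := mul_le_mul_of_nonneg_right hD (by positivity)
      _ = τ * (θ * (c * θ ^ (-β))) := by ring
      _ ≤ τ * (θ * countAbove v θ) := by gcongr
      _ ≤ _ := by gcongr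
  have i2 : 2 * θ * (ε * L) ≤ τ * waterDist v θ := by
    calc 2 * θ * (ε * L) = 2 * ε * (θ * L) := by ring
      _ ≤ τ * c₁ * (θ * L) := mul_le_mul_of_nonneg_right hε (by positivity)
      _ = τ * (θ * (c₁ * L)) := by ring
      _ ≤ τ * (θ * countAbove v θ) := by gcongr
      _ ≤ _ := by gcongr
  have h1 : waterDist w ((1 - η) * θ) + 2 * ((1 - η) * θ) * (waterRate w ((1 - η) * θ) -
      Real.log α.card) ≥ (1 - η) * (waterSum (fun k => a⁻¹ * w k) θ - 2 * θ * L) := by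
    have : 2 * ((1 - η) * θ) * Real.log α.card ≤ 2 * ((1 - η) * θ) * L := by gcongr
    rw [mul_sub (1 - η), ← hw, waterSum]
    linarith
  refine le_trans ?_ h1
  refine mul_le_mul_of_nonneg_left ?_ hap.le
  rw [waterSum, hR] at hv
  linarith

lemma tendsto_const_div_rpow_atTop (a : ℝ) {q : ℝ} (hq : 0 < q) :
    Tendsto (fun L : ℝ => (a / L) ^ q) atTop (nhds 0) := by
  have h := (tendsto_const_nhds (x := a)).div_atTop (tendsto_id (α := ℝ) (x := atTop))
  have := h.rpow_const (p := q) (Or.inr hq.le)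
  rwa [Real.zero_rpow hq.ne'] at this

lemma one_add_le_of_le_one_div {τ : ℝ} (h0 : 0 ≤ τ) (h1 : τ ≤ 1 / 16) :
    1 + τ ≤ (1 + 16 * τ) * ((1 - τ) * (1 - 2 * τ)) := by
  have : 0 ≤ τ * (12 - 46 * τ + 32 * τ ^ 2) := mul_nonneg h0 (by linarith [sq_nonneg τ])
  linarith

/-- Codes of size `n` for a Gaussian vector with variances `v` do asymptotically no worse than
codes for `w`, if the counting function of `v` exceeds that of `w` by a term of lower order. -/
theorem water_comparison {β γ C c us T D δ : ℝ} (hγ : 0 < γ) (hγβ : γ < β) (hβ : β < 1)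
    (hC : 0 < C) (hc : 0 < c) (hus : 0 < us) (hδ : 0 < δ) (hδ1 : δ ≤ 1) :
    ∃ n₀ : ℕ, ∀ n ≥ n₀, ∃ u₀ > 0, ∀ (ι κ : Type) [Fintype ι] [Fintype κ]
      (v : ι → ℝ≥0) (w : κ → ℝ≥0),
      (∀ u > 0, (countAbove v u : ℝ) ≤ countAbove w ((1 - δ / 16) * u) + D * u ^ (-γ)) →
      (∀ u > 0, (countAbove v u : ℝ) ≤ C * u ^ (-β)) →
      (∀ u ≥ u₀, u ≤ us → c * u ^ (-β) ≤ countAbove v u) →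
      (∑ k, (v k : ℝ) ≤ T) →
      ∃ α : Finset (ι → ℝ), α.Nonempty ∧ α.card ≤ n ∧
        ∀ α' : Finset (κ → ℝ), α'.Nonempty → α'.card ≤ n →
          ∫ x, sInf ((fun a => ∑ k, (x k - a k) ^ 2) '' (α : Set (ι → ℝ))) ∂(diagGaussian v) ≤
          (1 + δ) *
            ∫ x, sInf ((fun a => ∑ k, (x k - a k) ^ 2) '' (α' : Set (κ → ℝ))) ∂(diagGaussian w) := by
  have hβ0 : 0 < β := hγ.trans hγβ
  have hl2 := Real.log_pos one_lt_two
  set τ := δ / 16 with hτ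
  have hτ0 : 0 < τ := by positivity
  set K := C * (1 / (1 - β) + 1 / β) with hK
  have hK0 : 0 < K := by
    have : 0 < 1 - β := by linarith
    positivity
  set c₁ := c / K with hc₁
  have hc₁0 : 0 < c₁ := by positivity
  set ε := min (1 / 2) (τ * c₁ / 2) with hε
  have hε0 : 0 < ε := by positivity
  set C₁ := C * (2 ^ β * (2 / (c * Real.log 2))) with hC₁
  have hC₁0 : 0 < C₁ := by positivity
  set d := min (τ / 2) (min (ε / (2 * C₁)) 1) with hd
  have hd0 : 0 < d := by positivity
  set a := min (d ^ 2 * c₁ / 16) (ε / 4) with ha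
  have ha0 : 0 < a := by positivity
  have hlim : Tendsto (fun n : ℕ => Real.log n) atTop atTop :=
    Real.tendsto_log_atTop.comp tendsto_natCast_atTop_atTop
  have ev1 : ∀ᶠ L : ℝ in atTop, 2 * levelBound β c L ≤ us := by
    have h := tendsto_const_div_rpow_atTop (c * Real.log 2 / 2) (q := 1 / β) (by positivity)
    filter_upwards [h.eventually_le_const hus, eventually_gt_atTop 0] with L hL hL0
    rw [div_div] at hL
    rw [levelBound]; linarith
  have ev2 : ∀ᶠ L : ℝ in atTop, (K / L) ^ (1 / β) ≤ us :=
    (tendsto_const_div_rpow_atTop K (q := 1 / β) (by positivity)).eventually_le_const hus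
  have ev3 : ∀ᶠ L : ℝ in atTop, |D * (1 / (1 - γ) + 1 / γ)| * (K / L) ^ ((β - γ) / β) ≤ τ * c := by
    have h := (tendsto_const_div_rpow_atTop K (q := (β - γ) / β)
      (div_pos (by linarith) hβ0)).const_mul |D * (1 / (1 - γ) + 1 / γ)|
    rw [mul_zero] at h
    exact h.eventually_le_const (by positivity)
  have ev4 : ∀ᶠ L : ℝ in atTop, √gaussianFourthMoment * T * (2 * exp (-(a / 2 * L)))
      ≤ τ / 2 * levelBound β c L * (c₁ * L) := by
    have h := (tendsto_rpow_mul_exp_neg_mul_atTop_nhds_zero (1 / β - 1) (a / 2)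
      (by positivity)).const_mul (√gaussianFourthMoment * T * 2)
    rw [mul_zero] at h
    have hpos : 0 < τ / 2 * ((c * Real.log 2 / 2) ^ (1 / β) / 2) * c₁ := by positivity
    filter_upwards [h.eventually_le_const hpos, eventually_gt_atTop 0] with L hL hL0
    have e1 : levelBound β c L = (c * Real.log 2 / 2) ^ (1 / β) / 2 * L ^ (-(1 / β)) := by
      rw [levelBound, ← div_div, Real.div_rpow (by positivity) hL0.le, Real.rpow_neg hL0.le]
      ring
    have e2 : L ^ (-(1 / β)) * L = (L ^ (1 / β - 1))⁻¹ := by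
      rw [← Real.rpow_neg hL0.le, neg_sub, sub_eq_add_neg, add_comm, Real.rpow_add hL0,
        Real.rpow_one]
    have e3 : 0 < L ^ (1 / β - 1) := by positivity
    calc √gaussianFourthMoment * T * (2 * exp (-(a / 2 * L)))
        = √gaussianFourthMoment * T * 2 * (L ^ (1 / β - 1) * exp (-(a / 2) * L))
          * (L ^ (1 / β - 1))⁻¹ := by field_simp
      _ ≤ τ / 2 * ((c * Real.log 2 / 2) ^ (1 / β) / 2) * c₁ * (L ^ (1 / β - 1))⁻¹ := by gcongr
      _ = _ := by rw [← e2, e1]; ring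
  obtain ⟨n₀, hn₀⟩ := eventually_atTop.1 (hlim.eventually (ev1.and (ev2.and (ev3.and ev4))))
  refine ⟨max n₀ 2, fun n hn => ?_⟩
  obtain ⟨h1, h2, h3, h4⟩ := hn₀ n (le_trans (le_max_left _ _) hn)
  have hn2 : 2 ≤ n := le_trans (le_max_right _ _) hn
  set L := Real.log n with hL
  have hLp : 0 < L := Real.log_pos (by exact_mod_cast hn2)
  refine ⟨levelBound β c L, levelBound_pos hc hLp, fun ι κ _ _ v w H1 H2 H3 H4 => ?_⟩
  obtain ⟨θ, hθ, hR, hθβ⟩ := exists_water_level v hβ0 hβ hc hε0 (min_le_left _ _) hLp h1 H2 H3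
  rw [← hK] at hθβ
  have hθ0 : 0 < θ := (levelBound_pos hc hLp).trans_le hθ
  have hθq : ∀ q, 0 ≤ q → θ ^ q ≤ (K / L) ^ (q / β) := fun q hq => by
    have := Real.rpow_le_rpow (by positivity) hθβ (div_nonneg hq hβ0.le)
    rwa [← Real.rpow_mul hθ0.le, mul_div_cancel₀ _ hβ0.ne'] at this
  have hθus : θ ≤ us := by
    have := hθq 1 zero_le_one
    rw [Real.rpow_one] at this
    exact this.trans h2
  have hs := H3 θ hθ hθus
  have hθneg : L / K ≤ θ ^ (-β) := by
    rw [Real.rpow_neg hθ0.le, ← inv_div]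
    exact inv_anti₀ (by positivity) hθβ
  have hs1 : c₁ * L ≤ countAbove v θ := by
    refine le_trans ?_ hs
    calc c₁ * L = c * (L / K) := by rw [hc₁]; ring
      _ ≤ _ := by gcongr
  have hs2 : (countAbove v θ : ℝ) ≤ C₁ * L := by
    refine (H2 θ hθ0).trans ?_
    have e1 : (levelBound β c L) ^ (-β) = 2 ^ β * (2 / (c * Real.log 2)) * L := by
      have := two_mul_levelBound_rpow hβ0 hc hLp
      rw [Real.mul_rpow zero_le_two (levelBound_pos hc hLp).le, Real.rpow_neg zero_le_two] at this
      have h2 : (0:ℝ) < 2 ^ β := by positivity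
      field_simp at this ⊢
      linarith
    have e2 : θ ^ (-β) ≤ (levelBound β c L) ^ (-β) :=
      Real.rpow_le_rpow_of_nonpos (levelBound_pos hc hLp) hθ (by linarith)
    calc C * θ ^ (-β) ≤ C * (levelBound β c L) ^ (-β) := by gcongr
      _ = _ := by rw [e1, hC₁]; ring
  obtain ⟨α, hα, hcard, hle⟩ := exists_code_le v hθ0 hn2 hL hd0
    ((min_le_right _ _).trans (min_le_right _ _)) (min_le_left _ _) (C₁ := C₁) (c₁ := c₁) (by
      have : d ≤ ε / (2 * C₁) := (min_le_right _ _).trans (min_le_left _ _)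
      rw [le_div_iff₀ (by positivity)] at this
      linarith) hR H4 hs1 hs2 (h4.trans (by gcongr))
  refine ⟨α, hα, hcard, fun α' hα' hcard' => ?_⟩
  have hlow := waterDist_le_of_countAbove_le v w (β := β) (c := c) (c₁ := c₁) (τ := τ) hθ0 hL
    (by linarith) hγ (hγβ.trans hβ) hR hτ0.le hLp.le H1 hs hs1
    (by have : ε ≤ τ * c₁ / 2 := min_le_right _ _
        linarith)
    (by refine le_trans ?_ h3
        exact mul_le_mul (le_abs_self _) (hθq _ (by linarith)) (by positivity) (abs_nonneg _))
    α' hα' hcard'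
  have hD := waterDist_nonneg v hθ0.le
  have hτ1 : τ ≤ 1 / 16 := by linarith
  have hδτ : δ = 16 * τ := by rw [hτ]; ring
  refine hle.trans (le_trans ?_ (mul_le_mul_of_nonneg_left hlow (by linarith)))
  rw [hδτ]
  have := one_add_le_of_le_one_div hτ0.le hτ1
  calc (1 + τ) * waterDist v θ ≤ (1 + 16 * τ) * ((1 - τ) * (1 - 2 * τ)) * waterDist v θ := by gcongr
    _ = _ := by ring

section Counting

variable {V : Type*} [NormedAddCommGroup V] [InnerProductSpace ℝ V]
  {ι : Type*} [Fintype ι]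

lemma inner_eq_zero_of_mem_span_subset {ι : Type*} {e : ι → V} (he : Orthonormal ℝ e) {p : ι → Prop} {f : V}
    (hf : f ∈ Submodule.span ℝ (Set.range fun k : {k // p k} => e k)) {j : ι} (hj : ¬ p j) :
    ⟪e j, f⟫ = 0 := by
  induction hf using Submodule.span_induction with
  | mem x hx =>
    obtain ⟨k, rfl⟩ := hx
    exact he.2 fun h => hj (h ▸ k.2)
  | zero => simp
  | add x y _ _ hx hy => rw [inner_add_right, hx, hy, add_zero]
  | smul a x _ hx => rw [inner_smul_right, hx, mul_zero]

lemma finrank_span_subset {e : ι → V} (he : Orthonormal ℝ e) (p : ι → Prop) [DecidablePred p] :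
    Module.finrank ℝ (Submodule.span ℝ (Set.range fun k : {k // p k} => e k)) =
      (Finset.univ.filter p).card := by
  rw [show (fun k : {k // p k} => e k) = e ∘ Subtype.val from rfl,
    finrank_span_eq_card (he.comp _ Subtype.val_injective).linearIndependent, Fintype.card_subtype]

/-- The spectral subspace above the level `u`. -/
lemma exists_submodule_lt (e : OrthonormalBasis ι ℝ V) (v : ι → ℝ≥0) {Q : V → ℝ}
    (hQ : ∀ f, Q f = ∑ k, v k * ⟪e k, f⟫ ^ 2) (u : ℝ) :
    ∃ E : Submodule ℝ V, Module.finrank ℝ E = countAbove v u ∧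
      ∀ f ∈ E, f ≠ 0 → u * ‖f‖ ^ 2 < Q f := by
  refine ⟨_, finrank_span_subset e.orthonormal fun k => u < v k, fun f hf hf0 => ?_⟩
  have h0 := fun j (hj : ¬ u < v j) => inner_eq_zero_of_mem_span_subset e.orthonormal hf hj
  rw [hQ, ← e.sum_sq_inner_right, Finset.mul_sum]
  obtain ⟨k, hk⟩ : ∃ k, ⟪e k, f⟫ ≠ 0 := by
    by_contra! h
    exact hf0 (by rw [← e.sum_repr' f]; simp [h])
  refine Finset.sum_lt_sum (fun j _ => ?_) ⟨k, Finset.mem_univ _, ?_⟩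
  · by_cases hj : u < v j
    · gcongr
    · simp [h0 j hj]
  · have : u < v k := by by_contra h; exact hk (h0 k h)
    gcongr

/-- The spectral subspace below the level `u`. -/
lemma exists_submodule_le (e : OrthonormalBasis ι ℝ V) (v : ι → ℝ≥0) {Q : V → ℝ}
    (hQ : ∀ f, Q f = ∑ k, v k * ⟪e k, f⟫ ^ 2) (u : ℝ) :
    ∃ N : Submodule ℝ V, countAbove v u + Module.finrank ℝ N = Module.finrank ℝ V ∧
      ∀ f ∈ N, Q f ≤ u * ‖f‖ ^ 2 := by
  refine ⟨Submodule.span ℝ (Set.range fun k : {k // ¬ u < v k} => e k), ?_, fun f hf => ?_⟩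
  · rw [finrank_span_subset e.orthonormal, countAbove, Finset.card_filter_add_card_filter_not,
      Module.finrank_eq_card_basis e.toBasis, Finset.card_univ]
  · rw [hQ, ← e.sum_sq_inner_right, Finset.mul_sum]
    refine Finset.sum_le_sum fun j _ => ?_
    by_cases hj : u < v j
    · simp [inner_eq_zero_of_mem_span_subset e.orthonormal hf (not_not.2 hj)]
    · have : (v j : ℝ) ≤ u := not_lt.1 hj
      gcongr

lemma finrank_add_finrank_le_add_inf [FiniteDimensional ℝ V] (E N : Submodule ℝ V) :
    Module.finrank ℝ E + Module.finrank ℝ N ≤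
      Module.finrank ℝ V + Module.finrank ℝ (E ⊓ N : Submodule ℝ V) := by
  rw [← Submodule.finrank_sup_add_finrank_inf_eq]
  exact Nat.add_le_add_right (Submodule.finrank_le _) _

lemma finrank_le_countAbove (e : OrthonormalBasis ι ℝ V) (v : ι → ℝ≥0) {Q : V → ℝ}
    (hQ : ∀ f, Q f = ∑ k, v k * ⟪e k, f⟫ ^ 2) {u : ℝ} {E : Submodule ℝ V}
    (hE : ∀ f ∈ E, f ≠ 0 → u * ‖f‖ ^ 2 < Q f) :
    Module.finrank ℝ E ≤ countAbove v u := by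
  have := e.toBasis.finiteDimensional_of_finite
  obtain ⟨N, hN, hN'⟩ := exists_submodule_le e v hQ u
  have h := finrank_add_finrank_le_add_inf E N
  have hbot : E ⊓ N = ⊥ := by
    rw [Submodule.eq_bot_iff]
    intro f hf
    by_contra hf0
    exact absurd (hE f hf.1 hf0) (not_lt.2 (hN' f hf.2))
  rw [hbot, finrank_bot] at h
  omega

/-- Comparison of counting functions of two quadratic forms through their difference. -/
lemma countAbove_le_add_finrank {κ : Type*} [Fintype κ] (e : OrthonormalBasis ι ℝ V)
    (e' : OrthonormalBasis κ ℝ V) (v : ι → ℝ≥0) (w : κ → ℝ≥0) {Q R : V → ℝ}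
    (hQ : ∀ f, Q f = ∑ k, v k * ⟪e k, f⟫ ^ 2) (hR : ∀ f, R f = ∑ k, w k * ⟪e' k, f⟫ ^ 2)
    (u u' : ℝ) :
    ∃ E : Submodule ℝ V, countAbove v u ≤ countAbove w u' + Module.finrank ℝ E ∧
      ∀ f ∈ E, f ≠ 0 → (u - u') * ‖f‖ ^ 2 < Q f - R f := by
  have := e.toBasis.finiteDimensional_of_finite
  obtain ⟨E, hE, hE'⟩ := exists_submodule_lt e v hQ u
  obtain ⟨N, hN, hN'⟩ := exists_submodule_le e' w hR u'
  refine ⟨E ⊓ N, ?_, fun f hf hf0 => ?_⟩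
  · have := finrank_add_finrank_le_add_inf E N
    omega
  · linarith [hE' f hf.1 hf0, hN' f hf.2]

/-- Simultaneous diagonalisation of a nonnegative symmetric bilinear form and the inner product. -/
lemma exists_orthonormalBasis_diagonal [FiniteDimensional ℝ V] (B : V →ₗ[ℝ] V →ₗ[ℝ] ℝ)
    (hsymm : ∀ f g, B f g = B g f) (hpos : ∀ f, 0 ≤ B f f) :
    ∃ (e : OrthonormalBasis (Fin (Module.finrank ℝ V)) ℝ V) (v : Fin (Module.finrank ℝ V) → ℝ≥0),
      ∀ j k, B (e j) (e k) = if j = k then (v j : ℝ) else 0 := by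
  set b := stdOrthonormalBasis ℝ V
  set S : V →ₗ[ℝ] V := ∑ k, (B.flip (b k)).smulRight (b k) with hS
  have hin : ∀ f g, ⟪S f, g⟫ = B f g := fun f g => by
    simp only [hS, LinearMap.sum_apply, LinearMap.smulRight_apply, LinearMap.flip_apply, sum_inner,
      inner_smul_left]
    conv_rhs => rw [← b.sum_repr' g]
    simp [mul_comm]
  have hsym : S.IsSymmetric := fun f g => by
    rw [hin, real_inner_comm, hin, hsymm]
  set e := hsym.eigenvectorBasis rfl
  have hB : ∀ j k, B (e j) (e k) = if j = k then hsym.eigenvalues rfl j else 0 := fun j k => by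
    rw [← hin, hsym.apply_eigenvectorBasis, inner_smul_left,
      orthonormal_iff_ite.1 e.orthonormal]
    simp
  refine ⟨e, fun k => ⟨hsym.eigenvalues rfl k, ?_⟩, hB⟩
  have := hB k k
  rw [if_pos rfl] at this
  exact this ▸ hpos _

end Counting

section GaussianVector

variable {H : Type*} [NormedAddCommGroup H] [InnerProductSpace ℝ H]
  {Ω : Type*} [MeasurableSpace Ω] {P : Measure Ω}

/-- A square integrable centered Gaussian random vector in a Hilbert space. -/
structure IsCenteredGaussian (P : Measure Ω) (A : Ω → H) : Prop where
  aestronglyMeasurable : AEStronglyMeasurable A P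
  integrable_norm_sq : Integrable (fun ω => ‖A ω‖ ^ 2) P
  map_inner : ∀ f : H, ∃ v : ℝ≥0, Measure.map (fun ω => ⟪f, A ω⟫) P = gaussianReal 0 v

variable {A : Ω → H}

namespace IsCenteredGaussian

lemma memLp (hA : IsCenteredGaussian P A) : MemLp A 2 P :=
  (memLp_two_iff_integrable_sq_norm hA.aestronglyMeasurable).2 hA.integrable_norm_sq

lemma memLp_inner (hA : IsCenteredGaussian P A) (f : H) : MemLp (fun ω => ⟪f, A ω⟫) 2 P :=
  hA.memLp.const_inner f

lemma integrable_inner_mul_inner (hA : IsCenteredGaussian P A) (f g : H) :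
    Integrable (fun ω => ⟪f, A ω⟫ * ⟪g, A ω⟫) P :=
  (hA.memLp_inner f).integrable_mul (hA.memLp_inner g)

lemma map_inner_eq (hA : IsCenteredGaussian P A) (f : H) {v : ℝ≥0}
    (hv : ∫ ω, ⟪f, A ω⟫ ^ 2 ∂P = v) : Measure.map (fun ω => ⟪f, A ω⟫) P = gaussianReal 0 v := by
  obtain ⟨w, hw⟩ := hA.map_inner f
  have h := integral_sq_gaussianReal w
  rw [← hw, integral_map (hA.memLp_inner f).aestronglyMeasurable.aemeasurable
    (by fun_prop), hv] at h
  rw [hw, NNReal.coe_injective h]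

lemma const_smul (hA : IsCenteredGaussian P A) (c : ℝ) :
    IsCenteredGaussian P (fun ω => c • A ω) where
  aestronglyMeasurable := hA.aestronglyMeasurable.const_smul c
  integrable_norm_sq := by
    simp_rw [norm_smul, mul_pow]
    exact hA.integrable_norm_sq.const_mul _
  map_inner f := by
    obtain ⟨v, hv⟩ := hA.map_inner (c • f)
    refine ⟨v, ?_⟩
    rw [← hv]
    simp_rw [inner_smul_right, inner_smul_left]
    rfl

/-- The covariance form of a centered Gaussian vector. -/
noncomputable def covForm (hA : IsCenteredGaussian P A) : H →ₗ[ℝ] H →ₗ[ℝ] ℝ :=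
  LinearMap.mk₂ ℝ (fun f g => ∫ ω, ⟪f, A ω⟫ * ⟪g, A ω⟫ ∂P)
    (fun f f' g => by
      rw [← integral_add (hA.integrable_inner_mul_inner f g) (hA.integrable_inner_mul_inner f' g)]
      simp_rw [inner_add_left, add_mul])
    (fun c f g => by
      rw [smul_eq_mul, ← integral_const_mul]
      simp_rw [inner_smul_left, conj_trivial, mul_assoc])
    (fun f g g' => by
      rw [← integral_add (hA.integrable_inner_mul_inner f g) (hA.integrable_inner_mul_inner f g')]
      simp_rw [inner_add_left, mul_add])
    (fun c f g => by
      rw [smul_eq_mul, ← integral_const_mul]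
      simp_rw [inner_smul_left, conj_trivial, mul_left_comm])

lemma covForm_apply (hA : IsCenteredGaussian P A) (f g : H) :
    hA.covForm f g = ∫ ω, ⟪f, A ω⟫ * ⟪g, A ω⟫ ∂P := rfl

lemma covForm_self (hA : IsCenteredGaussian P A) (f : H) :
    hA.covForm f f = ∫ ω, ⟪f, A ω⟫ ^ 2 ∂P := by simp_rw [covForm_apply, sq]

/-- In suitable coordinates, a finite-dimensional projection of a Gaussian vector has independent
components. -/
lemma exists_diagGaussian [IsProbabilityMeasure P] (hA : IsCenteredGaussian P A)
    (V : Submodule ℝ H) [FiniteDimensional ℝ V] :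
    ∃ (e : OrthonormalBasis (Fin (Module.finrank ℝ V)) ℝ V) (v : Fin (Module.finrank ℝ V) → ℝ≥0),
      (∀ f : V, ∫ ω, ⟪(f : H), A ω⟫ ^ 2 ∂P = ∑ k, v k * ⟪e k, f⟫ ^ 2) ∧
      Measure.map (fun ω k => ⟪(e k : H), A ω⟫) P = diagGaussian v := by
  obtain ⟨e, v, hev⟩ := exists_orthonormalBasis_diagonal
    ((hA.covForm.compl₁₂ V.subtype V.subtype))
    (fun f g => by simp [covForm_apply, mul_comm])
    (fun f => by
      rw [LinearMap.compl₁₂_apply, covForm_self]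
      exact integral_nonneg fun _ => sq_nonneg _)
  have hQ : ∀ t : Fin (Module.finrank ℝ V) → ℝ,
      ∫ ω, ⟪((∑ k, t k • e k : V) : H), A ω⟫ ^ 2 ∂P = ∑ k, v k * t k ^ 2 := fun t => by
    rw [← hA.covForm_self]
    change hA.covForm.compl₁₂ V.subtype V.subtype (∑ k, t k • e k) (∑ k, t k • e k) = _
    simp only [map_sum, map_smul, LinearMap.sum_apply, LinearMap.smul_apply, hev, smul_eq_mul]
    refine Finset.sum_congr rfl fun j _ => ?_
    simp [sq]; ring
  refine ⟨e, v, fun f => ?_, ?_⟩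
  · rw [← hQ fun k => ⟪e k, f⟫, e.sum_repr' f]
  · have hm : AEMeasurable (fun ω k => ⟪(e k : H), A ω⟫) P :=
      aemeasurable_pi_lambda _ fun k => (hA.memLp_inner _).aestronglyMeasurable.aemeasurable
    have := Measure.isProbabilityMeasure_map hm
    rw [diagGaussian, ← charFun_eq_pi_iff]
    intro t
    have h1 := hA.map_inner_eq ((∑ k, t k • e k : V) : H) 
      (v := ∑ k, v k * Real.toNNReal (t k ^ 2))
      (by rw [hQ]; push_cast; simp [Real.coe_toNNReal _ (sq_nonneg _)])
    have h2 : charFun (Measure.map (fun ω => ⟪((∑ k, t k • e k : V) : H), A ω⟫) P) 1 =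
        ∏ i, charFun (gaussianReal 0 (v i)) (t i) := by
      rw [h1]
      simp_rw [charFun_gaussianReal]
      rw [← Complex.exp_sum]
      congr 1
      simp [Real.coe_toNNReal _ (sq_nonneg _), Finset.sum_div]
    rw [← h2, charFun_apply, charFun_apply, AEMeasurable.map_map_of_aemeasurable (by fun_prop) hm,
      integral_map ((WithLp.measurable_toLp 2 _).comp_aemeasurable hm) (by fun_prop),
      integral_map (hA.memLp_inner _).aestronglyMeasurable.aemeasurable (by fun_prop)]
    congr 1
    ext ω
    congr 3
    simp [PiLp.inner_apply, sum_inner, inner_smul_left]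

lemma sum_le_integral_norm_sq [IsProbabilityMeasure P] (hA : IsCenteredGaussian P A)
    {V : Submodule ℝ H} {ι : Type*} [Fintype ι] (e : OrthonormalBasis ι ℝ V) (v : ι → ℝ≥0)
    (hQ : ∀ f : V, ∫ ω, ⟪(f : H), A ω⟫ ^ 2 ∂P = ∑ k, v k * ⟪e k, f⟫ ^ 2) :
    ∑ k, (v k : ℝ) ≤ ∫ ω, ‖A ω‖ ^ 2 ∂P := by
  classical
  have he : Orthonormal ℝ fun k => (e k : H) := e.orthonormal.comp_linearIsometry V.subtypeₗᵢ
  have h1 : ∀ k, (v k : ℝ) = ∫ ω, ⟪(e k : H), A ω⟫ ^ 2 ∂P := fun k => by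
    rw [hQ, Finset.sum_eq_single k]
    · simp
    · intro j _ hj
      rw [e.orthonormal.2 hj]; simp
    · simp
  simp_rw [h1]
  rw [← integral_finsetSum _ fun k _ => (hA.memLp_inner _).integrable_sq]
  refine integral_mono (integrable_finsetSum _ fun k _ => (hA.memLp_inner _).integrable_sq)
    hA.integrable_norm_sq fun ω => ?_
  have := he.sum_inner_products_le (x := A ω) (s := Finset.univ)
  simpa using this

end IsCenteredGaussian

end GaussianVector

lemma Finset.aemeasurable_sInf_image {Ω β : Type*} [MeasurableSpace Ω] {P : Measure Ω}
    {α : Finset β} (hα : α.Nonempty) {f : β → Ω → ℝ} (hf : ∀ a ∈ α, AEMeasurable (f a) P) :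
    AEMeasurable (fun x => sInf ((fun a => f a x) '' (α : Set β))) P := by
  have : AEMeasurable (α.inf' hα f) P :=
    Finset.inf'_induction hα f (p := fun g => AEMeasurable g P)
      (fun _ h₁ _ h₂ => AEMeasurable.inf h₁ h₂) hf
  convert! this using 1
  funext x
  rw [Finset.sInf_image_eq_inf' hα, Finset.inf'_apply]

lemma Finset.sInf_image_nonneg {β : Type*} (α : Finset β) {f : β → ℝ} (hf : ∀ a, 0 ≤ f a) :
    0 ≤ sInf (f '' (α : Set β)) :=
  Real.sInf_nonneg (by rintro _ ⟨a, _, rfl⟩; exact hf a)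

section Transfer

variable {H : Type*} [NormedAddCommGroup H] [InnerProductSpace ℝ H]
  {Ω : Type*} [MeasurableSpace Ω] {P : Measure Ω} {A B : Ω → H}

lemma norm_sub_starProjection_le {V : Submodule ℝ H} [V.HasOrthogonalProjection] (x : H) {y : H}
    (hy : y ∈ V) : ‖x - V.starProjection x‖ ≤ ‖x - y‖ := by
  rw [Submodule.starProjection_minimal]
  exact ciInf_le (f := fun y : V => ‖x - y‖) ⟨0, by rintro _ ⟨a, rfl⟩; positivity⟩ ⟨y, hy⟩

/-- The mean squared error of the codebook `α`. -/
noncomputable def distortion {H : Type*} [NormedAddCommGroup H] (P : Measure Ω) (A : Ω → H)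
    (α : Finset H) : ℝ :=
  ∫ ω, sInf ((fun a => ‖A ω - a‖ ^ 2) '' (α : Set H)) ∂P

lemma distortion_nonneg {H : Type*} [NormedAddCommGroup H] {A : Ω → H} (α : Finset H) : 0 ≤ distortion P A α :=
  integral_nonneg fun _ => α.sInf_image_nonneg fun _ => sq_nonneg _

namespace IsCenteredGaussian

variable [IsProbabilityMeasure P]

lemma integrable_sInf (hA : IsCenteredGaussian P A) {α : Finset H} (hα : α.Nonempty) :
    Integrable (fun ω => sInf ((fun a => ‖A ω - a‖ ^ 2) '' (α : Set H))) P := by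
  obtain ⟨a, ha⟩ := hα
  have hm : MemLp (fun ω => A ω - a) 2 P := hA.memLp.sub (memLp_const a)
  have hi := (memLp_two_iff_integrable_sq_norm hm.1).1 hm
  refine hi.mono' (Finset.aemeasurable_sInf_image ⟨a, ha⟩ fun b _ => ?_).aestronglyMeasurable
    (ae_of_all _ fun ω => ?_)
  · exact ((hA.aestronglyMeasurable.sub aestronglyMeasurable_const).norm.pow 2).aemeasurable
  · rw [Real.norm_of_nonneg (α.sInf_image_nonneg fun _ => sq_nonneg _)]
    exact Finset.sInf_image_le _ ha

/-- Projecting to a finite-dimensional subspace does not increase the error. -/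
lemma exists_code_projection (hB : IsCenteredGaussian P B) {V : Submodule ℝ H} {ι : Type*}
    [Fintype ι] (e : OrthonormalBasis ι ℝ V) {w : ι → ℝ≥0}
    (hw : Measure.map (fun ω k => ⟪(e k : H), B ω⟫) P = diagGaussian w)
    {α : Finset H} (hα : α.Nonempty) :
    ∃ α' : Finset (ι → ℝ), α'.Nonempty ∧ α'.card ≤ α.card ∧
      ∫ x, sInf ((fun a => ∑ k, (x k - a k) ^ 2) '' (α' : Set (ι → ℝ))) ∂(diagGaussian w) ≤
        distortion P B α := by
  classical
  have he : Orthonormal ℝ fun k => (e k : H) := e.orthonormal.comp_linearIsometry V.subtypeₗᵢ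
  have hne : (α.image fun a k => ⟪(e k : H), a⟫).Nonempty := hα.image _
  refine ⟨α.image fun a k => ⟪(e k : H), a⟫, hne, Finset.card_image_le, ?_⟩
  rw [← hw, integral_map
    (aemeasurable_pi_lambda _ fun k => (hB.memLp_inner _).aestronglyMeasurable.aemeasurable)
    (Finset.measurable_sInf_image hne fun a _ => by fun_prop).aestronglyMeasurable]
  refine integral_mono_of_nonneg (ae_of_all _ fun ω => Finset.sInf_image_nonneg _
    fun a => Finset.sum_nonneg fun k _ => sq_nonneg _) (hB.integrable_sInf hα)
    (ae_of_all _ fun ω => ?_)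
  obtain ⟨a, ha, heq⟩ := Finset.sInf_image_mem hα (fun a => ‖B ω - a‖ ^ 2)
  simp only [heq]
  refine (Finset.sInf_image_le _ (Finset.mem_image_of_mem _ ha)).trans ?_
  have := he.sum_inner_products_le (x := B ω - a) (s := Finset.univ)
  simpa [inner_sub_right] using this

/-- A code for a finite-dimensional projection is a code for the whole vector. -/
lemma exists_code_extension (hA : IsCenteredGaussian P A) {V : Submodule ℝ H}
    [V.HasOrthogonalProjection] {ι : Type*}
    [Fintype ι] (e : OrthonormalBasis ι ℝ V) {v : ι → ℝ≥0}
    (hv : Measure.map (fun ω k => ⟪(e k : H), A ω⟫) P = diagGaussian v)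
    {α : Finset (ι → ℝ)} (hα : α.Nonempty) :
    ∃ α' : Finset H, α'.Nonempty ∧ α'.card ≤ α.card ∧
      distortion P A α' ≤ ∫ x, sInf ((fun a => ∑ k, (x k - a k) ^ 2) '' (α : Set (ι → ℝ)))
        ∂(diagGaussian v) + ∫ ω, ‖A ω - V.starProjection (A ω)‖ ^ 2 ∂P := by
  classical
  set g : (ι → ℝ) → V := fun a => ∑ k, a k • e k with hg
  have hne : (α.image fun a => (g a : H)).Nonempty := hα.image _
  refine ⟨α.image fun a => (g a : H), hne, Finset.card_image_le, ?_⟩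
  have hm : AEMeasurable (fun ω k => ⟪(e k : H), A ω⟫) P :=
    aemeasurable_pi_lambda _ fun k => (hA.memLp_inner _).aestronglyMeasurable.aemeasurable
  have hms : Measurable fun x : ι → ℝ =>
      sInf ((fun a => ∑ k, (x k - a k) ^ 2) '' (α : Set (ι → ℝ))) :=
    Finset.measurable_sInf_image hα fun a _ => by fun_prop
  rw [← hv, integral_map hm hms.aestronglyMeasurable]
  have hi1 : Integrable (fun ω => sInf ((fun a => ∑ k, (⟪(e k : H), A ω⟫ - a k) ^ 2) ''
      (α : Set (ι → ℝ)))) P := by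
    obtain ⟨a, ha⟩ := hα
    have hi : Integrable (fun ω => ∑ k, (⟪(e k : H), A ω⟫ - a k) ^ 2) P :=
      integrable_finsetSum _ fun k _ => ((hA.memLp_inner _).sub (memLp_const _)).integrable_sq
    refine hi.mono' (hms.comp_aemeasurable hm).aestronglyMeasurable (ae_of_all _ fun ω => ?_)
    rw [Real.norm_of_nonneg (α.sInf_image_nonneg fun _ => Finset.sum_nonneg fun _ _ => sq_nonneg _)]
    exact Finset.sInf_image_le _ ha
  have hi2 : Integrable (fun ω => ‖A ω - V.starProjection (A ω)‖ ^ 2) P := by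
    have : MemLp (fun ω => A ω - V.starProjection (A ω)) 2 P :=
      hA.memLp.sub (V.starProjection.comp_memLp' hA.memLp)
    exact (memLp_two_iff_integrable_sq_norm this.1).1 this
  rw [← integral_add hi1 hi2]
  refine integral_mono (hA.integrable_sInf hne) (hi1.add hi2) fun ω => ?_
  obtain ⟨a, ha, heq⟩ := Finset.sInf_image_mem hα
    (fun a : ι → ℝ => ∑ k, (⟪(e k : H), A ω⟫ - a k) ^ 2)
  simp only [heq]
  refine (Finset.sInf_image_le _ (Finset.mem_image_of_mem _ ha)).trans (le_of_eq ?_)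
  have hin : ∀ k, ⟪e k, V.orthogonalProjectionOnto (A ω) - g a⟫ = ⟪(e k : H), A ω⟫ - a k := fun k => by
    rw [inner_sub_right]
    congr 1
    · exact V.inner_orthogonalProjectionOnto_eq_of_mem_left (e k) (A ω)
    · simp [hg, inner_sum, inner_smul_right, orthonormal_iff_ite.1 e.orthonormal]
  have h1 : ∑ k, (⟪(e k : H), A ω⟫ - a k) ^ 2 = ‖V.starProjection (A ω) - g a‖ ^ 2 := by
    simp_rw [← hin]
    rw [e.sum_sq_inner_right]
    rfl
  have h2 : ⟪V.starProjection (A ω) - g a, A ω - V.starProjection (A ω)⟫ = 0 :=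
    Submodule.inner_right_of_mem_orthogonal
      (V.sub_mem (Submodule.starProjection_apply_mem _ _) (g a).2)
      (Submodule.sub_starProjection_mem_orthogonal _)
  rw [h1, show A ω - (g a : H) = (V.starProjection (A ω) - g a) + (A ω - V.starProjection (A ω)) by
    abel, sq, norm_add_sq_eq_norm_sq_add_norm_sq_of_inner_eq_zero _ _ h2]
  ring

lemma exists_finiteDimensional_integral_le [TopologicalSpace.SeparableSpace H]
    (hA : IsCenteredGaussian P A) (U : Submodule ℝ H) [FiniteDimensional ℝ U] {ε : ℝ} (hε : 0 < ε) :
    ∃ V : Submodule ℝ H, ∃ _ : FiniteDimensional ℝ V, U ≤ V ∧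
      ∫ ω, ‖A ω - V.starProjection (A ω)‖ ^ 2 ∂P ≤ ε := by
  classical
  set V : ℕ → Submodule ℝ H := fun K =>
    U ⊔ Submodule.span ℝ ((Finset.range K).image (TopologicalSpace.denseSeq H) : Finset H) with hV
  have hfin : ∀ K, FiniteDimensional ℝ (V K) := fun K => inferInstance
  have hlim : Tendsto (fun K => ∫ ω, ‖A ω - (V K).starProjection (A ω)‖ ^ 2 ∂P) atTop
      (nhds (∫ ω, 0 ∂P)) := by
    refine tendsto_integral_of_dominated_convergence (fun ω => ‖A ω‖ ^ 2) (fun K => ?_)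
      hA.integrable_norm_sq (fun K => ae_of_all _ fun ω => ?_) (ae_of_all _ fun ω => ?_)
    · exact (hA.aestronglyMeasurable.sub ((V K).starProjection.continuous.comp_aestronglyMeasurable
        hA.aestronglyMeasurable)).norm.pow 2
    · rw [Real.norm_of_nonneg (sq_nonneg _)]
      have := norm_sub_starProjection_le (A ω) (V K).zero_mem
      rw [sub_zero] at this
      gcongr
    · have h1 : Tendsto (fun K => ‖A ω - (V K).starProjection (A ω)‖) atTop (nhds 0) := by
        rw [Metric.tendsto_atTop]
        intro ε hε
        obtain ⟨k, hk⟩ := (TopologicalSpace.denseRange_denseSeq H).exists_dist_lt (A ω) hε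
        refine ⟨k + 1, fun K hK => ?_⟩
        rw [dist_zero_right, norm_norm]
        refine lt_of_le_of_lt (norm_sub_starProjection_le (A ω) ?_) (dist_eq_norm (A ω) _ ▸ hk)
        refine Submodule.mem_sup_right (Submodule.subset_span ?_)
        simp only [Finset.coe_image, Set.mem_image, Finset.coe_range, Set.mem_Iio]
        exact ⟨k, by omega, rfl⟩
      simpa using h1.pow 2
  simp only [integral_zero] at hlim
  obtain ⟨K, hK⟩ := (hlim.eventually_le_const hε).exists
  exact ⟨V K, hfin K, le_sup_left, hK⟩

/-- Codes for `A` are asymptotically no worse than codes for `B` when the covariance form of `A`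
exceeds that of `B` by a form with a smaller counting function. -/
theorem exists_distortion_le [TopologicalSpace.SeparableSpace H]
    (hA : IsCenteredGaussian P A) (hB : IsCenteredGaussian P B)
    {β γ C c D δ : ℝ} (hγ : 0 < γ) (hγβ : γ < β) (hβ : β < 1)
    (hC : 0 < C) (hc : 0 < c) (hδ : 0 < δ) (hδ1 : δ ≤ 1)
    (hdiff : ∀ u > 0, ∀ E : Submodule ℝ H, FiniteDimensional ℝ E →
      (∀ f ∈ E, f ≠ 0 → δ / 16 * u * ‖f‖ ^ 2 <
        (∫ ω, ⟪f, A ω⟫ ^ 2 ∂P) - ∫ ω, ⟪f, B ω⟫ ^ 2 ∂P) → (Module.finrank ℝ E : ℝ) ≤ D * u ^ (-γ))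
    (hup : ∀ u > 0, ∀ E : Submodule ℝ H, FiniteDimensional ℝ E →
      (∀ f ∈ E, f ≠ 0 → u * ‖f‖ ^ 2 < ∫ ω, ⟪f, A ω⟫ ^ 2 ∂P) →
        (Module.finrank ℝ E : ℝ) ≤ C * u ^ (-β))
    (hlow : ∀ r : ℕ, 0 < r → ∃ F : Submodule ℝ H, FiniteDimensional ℝ F ∧ r ≤ Module.finrank ℝ F ∧
      ∀ f ∈ F, f ≠ 0 → c * (r : ℝ) ^ (-(1 / β)) * ‖f‖ ^ 2 < ∫ ω, ⟪f, A ω⟫ ^ 2 ∂P) :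
    ∃ n₀ : ℕ, ∀ n ≥ n₀, ∀ α' : Finset H, α'.Nonempty → α'.card ≤ n → ∀ ε > 0,
      ∃ α : Finset H, α.Nonempty ∧ α.card ≤ n ∧
        distortion P A α ≤ (1 + δ) * distortion P B α' + ε := by
  have hβ0 : 0 < β := hγ.trans hγβ
  obtain ⟨n₀, hn₀⟩ := water_comparison (T := ∫ ω, ‖A ω‖ ^ 2 ∂P) (D := D) hγ hγβ hβ hC
    (c := c ^ β / 2) (us := c) (by positivity) hc hδ hδ1
  refine ⟨n₀, fun n hn α' hα' hcard ε hε => ?_⟩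
  obtain ⟨u₀, hu₀, hcomp⟩ := hn₀ n hn
  choose! F hFfin hFrank hF using hlow
  set N := ⌊(c / u₀) ^ β⌋₊ with hN
  set U : Submodule ℝ H := (Finset.Icc 1 N).sup F with hU
  have hUfin : FiniteDimensional ℝ U := by
    have : ∀ r : Finset.Icc 1 N, FiniteDimensional ℝ (F r) := fun r =>
      hFfin r (Finset.mem_Icc.1 r.2).1
    rw [hU, ← Finset.sup_attach]
    infer_instance
  obtain ⟨V, hVfin, hUV, htail⟩ := hA.exists_finiteDimensional_integral_le U hε
  obtain ⟨e, v, hv, hvlaw⟩ := hA.exists_diagGaussian V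
  obtain ⟨e', w, hw, hwlaw⟩ := hB.exists_diagGaussian V
  obtain ⟨α₁, hα₁, hcard₁, hle₁⟩ := hcomp _ _ v w
    (fun u hu => by
      obtain ⟨E, hE, hE'⟩ := countAbove_le_add_finrank e e' v w hv hw u ((1 - δ / 16) * u)
      have := hdiff u hu (E.map V.subtype) inferInstance (by
        rintro _ ⟨f, hf, rfl⟩ hf0
        have := hE' f hf (by rintro rfl; simp at hf0)
        rw [show u - (1 - δ / 16) * u = δ / 16 * u by ring] at this
        exact this)
      rw [Submodule.finrank_map_subtype_eq] at this
      have hE'' : (countAbove v u : ℝ) ≤ countAbove w ((1 - δ / 16) * u) + Module.finrank ℝ E := by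
        exact_mod_cast hE
      linarith)
    (fun u hu => by
      obtain ⟨E, hE, hE'⟩ := exists_submodule_lt e v hv u
      have := hup u hu (E.map V.subtype) inferInstance (by
        rintro _ ⟨f, hf, rfl⟩ hf0
        exact hE' f hf (by rintro rfl; simp at hf0))
      rwa [Submodule.finrank_map_subtype_eq, hE] at this)
    (fun u hu huc => by
      have hu0 : 0 < u := hu₀.trans_le hu
      set r := ⌊(c / u) ^ β⌋₊ with hr
      have h1 : 1 ≤ (c / u) ^ β := Real.one_le_rpow (by rwa [one_le_div hu0]) hβ0.le
      have hr1 : 1 ≤ r := Nat.le_floor (by simpa using h1)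
      have hrle : (r : ℝ) ≤ (c / u) ^ β := Nat.floor_le (by positivity)
      have hrN : r ≤ N := Nat.floor_mono (by gcongr)
      have hFV : F r ≤ V := (Finset.le_sup (Finset.mem_Icc.2 ⟨hr1, hrN⟩)).trans hUV
      have hr0 : (0:ℝ) < r := by exact_mod_cast hr1
      have hu' : u ≤ c * (r : ℝ) ^ (-(1 / β)) := by
        have : (r : ℝ) ^ (1 / β) ≤ c / u := by
          have := Real.rpow_le_rpow hr0.le hrle (by positivity : 0 ≤ 1 / β)
          rwa [← Real.rpow_mul (by positivity), mul_one_div_cancel hβ0.ne', Real.rpow_one] at this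
        rw [le_div_iff₀ hu0] at this
        rw [Real.rpow_neg hr0.le, ← div_eq_mul_inv, le_div_iff₀ (by positivity)]
        linarith
      have h2 := finrank_le_countAbove e v hv (u := u) (E := (F r).comap V.subtype) (by
        intro f hf hf0
        refine lt_of_le_of_lt ?_ (hF r hr1 f hf (by simpa using hf0))
        rw [Submodule.coe_norm]
        gcongr)
      rw [(Submodule.comapSubtypeEquivOfLe hFV).finrank_eq] at h2
      have h3 : (r : ℝ) ≤ countAbove v u := by exact_mod_cast (hFrank r hr1).trans h2
      refine le_trans ?_ h3
      have h4 := Nat.lt_floor_add_one ((c / u) ^ β)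
      rw [← hr] at h4
      have h5 : (1:ℝ) ≤ r := by exact_mod_cast hr1
      have h6 : c ^ β / 2 * u ^ (-β) = (c / u) ^ β / 2 := by
        rw [Real.div_rpow hc.le hu0.le, Real.rpow_neg hu0.le]; ring
      rw [h6]; linarith)
    (hA.sum_le_integral_norm_sq e v hv)
  obtain ⟨α₂, hα₂, hcard₂, hle₂⟩ := hB.exists_code_projection e' hwlaw hα'
  obtain ⟨α, hα, hcard₃, hle₃⟩ := hA.exists_code_extension e hvlaw hα₁
  refine ⟨α, hα, hcard₃.trans hcard₁, hle₃.trans ?_⟩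
  have := hle₁ α₂ hα₂ (hcard₂.trans hcard)
  have := mul_le_mul_of_nonneg_left hle₂ (by linarith : 0 ≤ 1 + δ)
  linarith

end IsCenteredGaussian

end Transfer

section HilbertSchmidt

variable {S R : Type*} [MeasurableSpace S] [MeasurableSpace R] {μ : Measure S} {ν : Measure R}
  {a : S → R → ℝ}

/-- A measurable square integrable kernel. -/
structure IsHSKernel (μ : Measure S) (ν : Measure R) (a : S → R → ℝ) : Prop where
  measurable : Measurable (Function.uncurry a)
  memLp : MemLp (Function.uncurry a) 2 (μ.prod ν)

lemma memLp_two_mul_prod {f : S → ℝ} {h : R → ℝ} (hf : MemLp f 2 μ) (hh : MemLp h 2 ν) :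
    MemLp (fun p : S × R => f p.1 * h p.2) 2 (μ.prod ν) := by
  have hm : AEStronglyMeasurable (fun p : S × R => f p.1 * h p.2) (μ.prod ν) :=
    hf.aestronglyMeasurable.comp_fst.mul hh.aestronglyMeasurable.comp_snd
  rw [memLp_two_iff_integrable_sq hm]
  simpa only [mul_pow] using hf.integrable_sq.mul_prod hh.integrable_sq

lemma inner_Lp_two (f g : Lp ℝ 2 μ) : ⟪f, g⟫ = ∫ t, f t * g t ∂μ := by
  rw [L2.inner_def]
  exact integral_congr_ae (ae_of_all _ fun t => by simp [mul_comm])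

lemma norm_sq_Lp_two (f : Lp ℝ 2 μ) : ‖f‖ ^ 2 = ∫ t, f t ^ 2 ∂μ := by
  rw [← real_inner_self_eq_norm_sq, inner_Lp_two]
  simp_rw [sq]

namespace IsHSKernel

lemma integrable_sq (ha : IsHSKernel μ ν a) :
    Integrable (fun p : S × R => a p.1 p.2 ^ 2) (μ.prod ν) :=
  ha.memLp.integrable_sq

lemma integrable_mul_mul (ha : IsHSKernel μ ν a) {f : S → ℝ} {h : R → ℝ} (hf : MemLp f 2 μ)
    (hh : MemLp h 2 ν) : Integrable (fun p : S × R => f p.1 * h p.2 * a p.1 p.2) (μ.prod ν) :=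
  (memLp_two_mul_prod hf hh).integrable_mul ha.memLp

/-- Bessel's inequality for the sections of a kernel. -/
lemma sum_sq_integral_le {ι : Type*} [Fintype ι] {e : ι → Lp ℝ 2 μ} (he : Orthonormal ℝ e)
    {b : S → ℝ} (hb : MemLp b 2 μ) :
    ∑ j, (∫ t, e j t * b t ∂μ) ^ 2 ≤ ∫ t, b t ^ 2 ∂μ := by
  have h := he.sum_inner_products_le (hb.toLp b) (s := Finset.univ)
  have h1 : ∀ j, ⟪e j, hb.toLp b⟫ = ∫ t, e j t * b t ∂μ := fun j => by
    rw [inner_Lp_two]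
    refine integral_congr_ae ?_
    filter_upwards [hb.coeFn_toLp] with t ht
    rw [ht]
  have h2 : ‖hb.toLp b‖ ^ 2 = ∫ t, b t ^ 2 ∂μ := by
    rw [norm_sq_Lp_two]
    refine integral_congr_ae ?_
    filter_upwards [hb.coeFn_toLp] with t ht
    rw [ht]
  simpa only [h1, h2, Real.norm_eq_abs, sq_abs] using h

lemma sq_integral_le (f : Lp ℝ 2 μ) {b : S → ℝ} (hb : MemLp b 2 μ) :
    (∫ t, f t * b t ∂μ) ^ 2 ≤ ‖f‖ ^ 2 * ∫ t, b t ^ 2 ∂μ := by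
  have h1 : ⟪f, hb.toLp b⟫ = ∫ t, f t * b t ∂μ := by
    rw [inner_Lp_two]
    refine integral_congr_ae ?_
    filter_upwards [hb.coeFn_toLp] with t ht
    rw [ht]
  have h2 : ‖hb.toLp b‖ ^ 2 = ∫ t, b t ^ 2 ∂μ := by
    rw [norm_sq_Lp_two]
    refine integral_congr_ae ?_
    filter_upwards [hb.coeFn_toLp] with t ht
    rw [ht]
  rw [← h1, ← h2, ← mul_pow, sq_le_sq, abs_of_nonneg (by positivity : 0 ≤ ‖f‖ * ‖hb.toLp b‖)]
  exact abs_real_inner_le_norm _ _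

variable [SFinite μ] [SFinite ν]

lemma swap (ha : IsHSKernel μ ν a) : IsHSKernel ν μ (fun r t => a t r) where
  measurable := ha.measurable.comp measurable_swap
  memLp := by
    have := ha.memLp.comp_measurePreserving (Measure.measurePreserving_swap (μ := ν) (ν := μ))
    exact this

lemma ae_memLp_left (ha : IsHSKernel μ ν a) : ∀ᵐ r ∂ν, MemLp (fun t => a t r) 2 μ := by
  filter_upwards [ha.integrable_sq.prod_left_ae] with r hr
  have hm : Measurable fun t => a t r := ha.measurable.comp measurable_prodMk_right
  exact (memLp_two_iff_integrable_sq hm.aestronglyMeasurable).2 hr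

lemma ae_memLp_right (ha : IsHSKernel μ ν a) : ∀ᵐ t ∂μ, MemLp (a t) 2 ν :=
  ha.swap.ae_memLp_left

lemma integral_swap (ha : IsHSKernel μ ν a) {f : S → ℝ} {h : R → ℝ} (hf : MemLp f 2 μ)
    (hh : MemLp h 2 ν) :
    ∫ r, h r * ∫ t, f t * a t r ∂μ ∂ν = ∫ t, f t * ∫ r, h r * a t r ∂ν ∂μ := by
  have h1 := integral_integral_swap (f := fun t r => f t * h r * a t r)
    (ha.integrable_mul_mul hf hh)
  simp_rw [← integral_const_mul]
  have e1 : ∀ r t, h r * (f t * a t r) = f t * h r * a t r := fun r t => by ring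
  have e2 : ∀ r t, f t * (h r * a t r) = f t * h r * a t r := fun r t => by ring
  simp_rw [e1, e2]
  exact h1.symm

lemma aestronglyMeasurable_integral (ha : IsHSKernel μ ν a) {f : S → ℝ}
    (hf : AEStronglyMeasurable f μ) :
    AEStronglyMeasurable (fun r => ∫ t, f t * a t r ∂μ) ν := by
  have h : AEStronglyMeasurable (fun p : R × S => f p.2 * a p.2 p.1) (ν.prod μ) :=
    hf.comp_snd.mul ha.swap.memLp.aestronglyMeasurable
  exact h.integral_prod_right'

lemma integrable_integral_sq (ha : IsHSKernel μ ν a) :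
    Integrable (fun r => ∫ t, a t r ^ 2 ∂μ) ν := ha.integrable_sq.integral_prod_right

lemma memLp_integral (ha : IsHSKernel μ ν a) (f : Lp ℝ 2 μ) :
    MemLp (fun r => ∫ t, f t * a t r ∂μ) 2 ν := by
  have hm := ha.aestronglyMeasurable_integral (Lp.aestronglyMeasurable f)
  rw [memLp_two_iff_integrable_sq hm]
  refine (ha.integrable_integral_sq.const_mul (‖f‖ ^ 2)).mono' (hm.pow 2) ?_
  filter_upwards [ha.ae_memLp_left] with r hr
  rw [Real.norm_of_nonneg (sq_nonneg _)]
  exact sq_integral_le f hr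

/-- The Hilbert–Schmidt operator with a given kernel. -/
noncomputable def op (ha : IsHSKernel μ ν a) : Lp ℝ 2 μ →ₗ[ℝ] Lp ℝ 2 ν where
  toFun f := (ha.memLp_integral f).toLp _
  map_add' f g := by
    rw [← MemLp.toLp_add]
    refine (MemLp.toLp_eq_toLp_iff _ _).2 ?_
    filter_upwards [ha.ae_memLp_left] with r hr
    rw [Pi.add_apply, ← integral_add (f := fun t => f t * a t r) (g := fun t => g t * a t r)
      ((Lp.memLp f).integrable_mul hr) ((Lp.memLp g).integrable_mul hr)]
    refine integral_congr_ae ?_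
    filter_upwards [Lp.coeFn_add f g] with t ht
    rw [ht, Pi.add_apply, add_mul]
  map_smul' c f := by
    rw [RingHom.id_apply, ← MemLp.toLp_const_smul]
    refine (MemLp.toLp_eq_toLp_iff _ _).2 (ae_of_all _ fun r => ?_)
    rw [Pi.smul_apply, smul_eq_mul, ← integral_const_mul]
    refine integral_congr_ae ?_
    filter_upwards [Lp.coeFn_smul c f] with t ht
    rw [ht, Pi.smul_apply, smul_eq_mul, mul_assoc]

lemma coeFn_op (ha : IsHSKernel μ ν a) (f : Lp ℝ 2 μ) :
    ha.op f =ᵐ[ν] fun r => ∫ t, f t * a t r ∂μ :=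
  (ha.memLp_integral f).coeFn_toLp

lemma norm_op_sq (ha : IsHSKernel μ ν a) (f : Lp ℝ 2 μ) :
    ‖ha.op f‖ ^ 2 = ∫ r, (∫ t, f t * a t r ∂μ) ^ 2 ∂ν := by
  rw [norm_sq_Lp_two]
  refine integral_congr_ae ?_
  filter_upwards [ha.coeFn_op f] with r hr
  rw [hr]

/-- The quadratic form of the covariance kernel `∫ a s r * a t r dr`. -/
lemma integral_kernel_eq (ha : IsHSKernel μ ν a) (f : Lp ℝ 2 μ) :
    ∫ s, ∫ t, f s * (∫ r, a s r * a t r ∂ν) * f t ∂μ ∂μ = ‖ha.op f‖ ^ 2 := by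
  have h1 := ha.integral_swap (Lp.memLp f) (ha.memLp_integral f)
  simp_rw [← sq] at h1
  rw [ha.norm_op_sq, h1]
  refine integral_congr_ae ?_
  filter_upwards [ha.ae_memLp_right] with s hs
  have h2 := ha.integral_swap (Lp.memLp f) hs
  have h3 : ∫ r, (∫ t, f t * a t r ∂μ) * a s r ∂ν = ∫ t, f t * ∫ r, a s r * a t r ∂ν ∂μ := by
    rw [← h2]; simp_rw [mul_comm]
  rw [h3, ← integral_const_mul]
  congr 1; ext t; ring

lemma sum_norm_op_sq_le (ha : IsHSKernel μ ν a) {ι : Type*} [Fintype ι] {e : ι → Lp ℝ 2 μ}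
    (he : Orthonormal ℝ e) :
    ∑ j, ‖ha.op (e j)‖ ^ 2 ≤ ∫ r, ∫ t, a t r ^ 2 ∂μ ∂ν := by
  simp_rw [ha.norm_op_sq]
  rw [← integral_finsetSum _ fun j _ => (ha.memLp_integral (e j)).integrable_sq]
  refine integral_mono_ae (integrable_finsetSum _ fun j _ =>
    (ha.memLp_integral (e j)).integrable_sq) ha.integrable_integral_sq ?_
  filter_upwards [ha.ae_memLp_left] with r hr
  exact sum_sq_integral_le he hr

/-- If the quadratic form of a kernel exceeds `u` on the part of `E` orthogonal to `m` vectors, then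
the dimension of `E` is controlled by `m` and the Hilbert–Schmidt norm. -/
lemma finrank_le (ha : IsHSKernel μ ν a) {E : Submodule ℝ (Lp ℝ 2 μ)} [FiniteDimensional ℝ E]
    {m : ℕ} (φ : Fin m → Lp ℝ 2 μ) {u : ℝ} (hu : 0 < u)
    (hE : ∀ f ∈ E, (∀ i, ⟪φ i, f⟫ = 0) → u * ‖f‖ ^ 2 ≤ ‖ha.op f‖ ^ 2) :
    (Module.finrank ℝ E : ℝ) ≤ m + (∫ r, ∫ t, a t r ^ 2 ∂μ ∂ν) / u := by
  let L : E →ₗ[ℝ] (Fin m → ℝ) := LinearMap.pi fun i => (innerₗ _ (φ i)).comp E.subtype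
  have hrk := L.finrank_range_add_finrank_ker
  have hr : Module.finrank ℝ (LinearMap.range L) ≤ m := by
    simpa using Submodule.finrank_le (LinearMap.range L)
  let b := stdOrthonormalBasis ℝ (LinearMap.ker L)
  have hon : Orthonormal ℝ fun j => ((b j : E) : Lp ℝ 2 μ) :=
    (b.orthonormal.comp_linearIsometry (LinearMap.ker L).subtypeₗᵢ).comp_linearIsometry E.subtypeₗᵢ
  have hsum := ha.sum_norm_op_sq_le hon
  have hlow : ∀ j, u ≤ ‖ha.op ((b j : E) : Lp ℝ 2 μ)‖ ^ 2 := fun j => by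
    have h := hE (b j : E) (b j : E).2 fun i => by
      have := (b j).2
      rw [LinearMap.mem_ker] at this
      exact congrFun this i
    rwa [hon.1 j, one_pow, mul_one] at h
  have hd : (Module.finrank ℝ (LinearMap.ker L) : ℝ) * u ≤ ∫ r, ∫ t, a t r ^ 2 ∂μ ∂ν := by
    refine le_trans ?_ hsum
    have := Finset.sum_le_sum fun j (_ : j ∈ Finset.univ) => hlow j
    simpa using this
  have : (Module.finrank ℝ E : ℝ) ≤ m + Module.finrank ℝ (LinearMap.ker L) := by
    rw [← hrk]; push_cast; gcongr
  refine this.trans ?_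
  gcongr
  rwa [le_div_iff₀ hu]

end IsHSKernel

end HilbertSchmidt

section Mesh

instance : IsFiniteMeasure μ01 := by unfold μ01; infer_instance

lemma ae_mem_Ioc_μ01 : ∀ᵐ t ∂μ01, t ∈ Set.Ioc (0:ℝ) 1 := by
  unfold μ01
  rw [← restrict_Ioc_eq_restrict_Icc]
  exact ae_restrict_mem measurableSet_Ioc

lemma intervalIntegral_eq_μ01 (g : ℝ → ℝ) : ∫ t in (0:ℝ)..1, g t = ∫ t, g t ∂μ01 := by
  unfold μ01
  rw [intervalIntegral.integral_of_le zero_le_one, restrict_Ioc_eq_restrict_Icc]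

lemma measurableSet_cell (m i : ℕ) : MeasurableSet {t : ℝ | ⌈(m:ℝ) * t⌉₊ = i} :=
  (Nat.measurable_ceil.comp (measurable_const_mul (m:ℝ))) (measurableSet_singleton i)

/-- The indicator function of a cell of the uniform mesh with `m` cells. -/
noncomputable def meshIndicator (m : ℕ) (i : Fin (m + 1)) : Lp ℝ 2 μ01 :=
  indicatorConstLp 2 (measurableSet_cell m i) (measure_ne_top _ _) (1:ℝ)

lemma integral_mul_step_eq_zero {m : ℕ} {f : Lp ℝ 2 μ01} (hf : ∀ i, ⟪meshIndicator m i, f⟫ = 0)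
    (g : ℕ → ℝ) : Integrable (fun t => f t * g ⌈(m:ℝ) * t⌉₊) μ01 ∧
      ∫ t, f t * g ⌈(m:ℝ) * t⌉₊ ∂μ01 = 0 := by
  have hfi : Integrable f μ01 := (Lp.memLp f).integrable (by norm_num)
  have hms := measurableSet_cell m
  have hsum : (fun t => f t * g ⌈(m:ℝ) * t⌉₊) =ᵐ[μ01]
      fun t => ∑ i : Fin (m+1), g i * ({t : ℝ | ⌈(m:ℝ) * t⌉₊ = (i:ℕ)}.indicator f t) := by
    filter_upwards [ae_mem_Ioc_μ01] with t ht
    have hle : ⌈(m:ℝ) * t⌉₊ ≤ m := by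
      rw [Nat.ceil_le]
      have : (0:ℝ) ≤ m := by positivity
      nlinarith [ht.2]
    rw [Finset.sum_eq_single (⟨⌈(m:ℝ) * t⌉₊, by omega⟩ : Fin (m+1))]
    · rw [Set.indicator_of_mem (by simp)]; ring
    · intro i _ hi
      rw [Set.indicator_of_notMem, mul_zero]
      intro h
      exact hi (Fin.ext h.symm)
    · simp
  have hInt : ∀ i : Fin (m+1),
      Integrable (fun t => g i * ({t : ℝ | ⌈(m:ℝ) * t⌉₊ = (i:ℕ)}.indicator f t)) μ01 := fun i =>
    (hfi.indicator (hms i)).const_mul _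
  refine ⟨(integrable_finsetSum _ fun i _ => hInt i).congr hsum.symm, ?_⟩
  rw [integral_congr_ae hsum, integral_finsetSum _ fun i _ => hInt i]
  refine Finset.sum_eq_zero fun i _ => ?_
  rw [integral_const_mul, integral_indicator (hms i)]
  have := hf i
  rw [meshIndicator, L2.inner_indicatorConstLp_one] at this
  rw [this, mul_zero]

variable {R : Type*} [MeasurableSpace R] {ν : Measure R} [SFinite ν] {a : ℝ → R → ℝ}

lemma IsHSKernel.op_sub_step (ha : IsHSKernel μ01 ν a) {m : ℕ}
    (hm : IsHSKernel μ01 ν fun t r => a t r - a (⌈(m:ℝ) * t⌉₊ / m) r)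
    {f : Lp ℝ 2 μ01} (hf : ∀ i, ⟪meshIndicator m i, f⟫ = 0) : hm.op f = ha.op f := by
  refine Lp.ext ?_
  filter_upwards [ha.coeFn_op f, hm.coeFn_op f, ha.ae_memLp_left] with r h1 h2 h3
  rw [h1, h2]
  obtain ⟨h4, h5⟩ := integral_mul_step_eq_zero hf fun i => a (i / m) r
  simp_rw [mul_sub]
  rw [integral_sub (f := fun t => f t * a t r) ((Lp.memLp f).integrable_mul h3) h4, h5, sub_zero]

lemma dim_bound_of_mesh {d T K q u : ℝ} (hd1 : d = 0 ∨ 1 ≤ d) (hT : 0 ≤ T) (hK : 0 ≤ K)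
    (hq : 0 < q) (hu : 0 < u)
    (h0 : d ≤ T / u) (hm : ∀ m : ℕ, 0 < m → d ≤ m + 1 + K * (m:ℝ) ^ (-q) / u) :
    d ≤ (1 + K + 2 * T ^ (1 / (q + 1))) * u ^ (-(1 / (q + 1))) := by
  rcases hd1 with rfl | hd1
  · positivity
  have huT : u ≤ T := by
    have := hd1.trans h0
    rwa [one_le_div hu] at this
  have hTpos : 0 < T := hu.trans_le huT
  set b := 1 / (q + 1) with hb
  have hbpos : 0 < b := by positivity
  have hy : 0 < u ^ (-b) := rpow_pos_of_pos hu _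
  have hceil : 0 < ⌈u ^ (-b)⌉₊ := Nat.ceil_pos.2 hy
  have h1 := hm _ hceil
  have h2 : u ^ (-b) ≤ (⌈u ^ (-b)⌉₊ : ℝ) := Nat.le_ceil _
  have h3 : (⌈u ^ (-b)⌉₊ : ℝ) ≤ u ^ (-b) + 1 := (Nat.ceil_lt_add_one hy.le).le
  have h4 : (⌈u ^ (-b)⌉₊ : ℝ) ^ (-q) / u ≤ u ^ (-b) := by
    have h5 : (⌈u ^ (-b)⌉₊ : ℝ) ^ (-q) ≤ (u ^ (-b)) ^ (-q) :=
      rpow_le_rpow_of_nonpos hy h2 (by linarith)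
    rw [← rpow_mul hu.le] at h5
    rw [div_le_iff₀ hu]
    refine h5.trans (le_of_eq ?_)
    nth_rewrite 3 [← rpow_one u]
    rw [← rpow_add hu]
    congr 1
    rw [hb]; field_simp; ring
  have h6 : 1 ≤ T ^ b * u ^ (-b) := by
    rw [rpow_neg hu.le, ← div_eq_mul_inv, one_le_div (rpow_pos_of_pos hu _)]
    exact rpow_le_rpow hu.le huT hbpos.le
  have h7 : K * (⌈u ^ (-b)⌉₊ : ℝ) ^ (-q) / u ≤ K * u ^ (-b) := by
    rw [mul_div_assoc]; exact mul_le_mul_of_nonneg_left h4 hK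
  linarith

/-- A modulus of continuity for a kernel controls the dimension of the spaces on which its quadratic
form is large. -/
lemma IsHSKernel.exists_finrank_le (ha : IsHSKernel μ01 ν a) {K q : ℝ} (hK : 0 ≤ K) (hq : 0 < q)
    (hmod : ∀ m : ℕ, 0 < m → IsHSKernel μ01 ν (fun t r => a t r - a (⌈(m:ℝ) * t⌉₊ / m) r) ∧
      ∫ r, ∫ t, (a t r - a (⌈(m:ℝ) * t⌉₊ / m) r) ^ 2 ∂μ01 ∂ν ≤ K * (m:ℝ) ^ (-q)) :
    ∃ D : ℝ, 0 < D ∧ ∀ u : ℝ, 0 < u → ∀ E : Submodule ℝ (Lp ℝ 2 μ01), FiniteDimensional ℝ E →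
      (∀ f ∈ E, f ≠ 0 → u * ‖f‖ ^ 2 < ‖ha.op f‖ ^ 2) →
      (Module.finrank ℝ E : ℝ) ≤ D * u ^ (-(1 / (q + 1))) := by
  have hT : 0 ≤ ∫ r, ∫ t, a t r ^ 2 ∂μ01 ∂ν :=
    integral_nonneg fun r => integral_nonneg fun t => sq_nonneg _
  refine ⟨1 + K + 2 * (∫ r, ∫ t, a t r ^ 2 ∂μ01 ∂ν) ^ (1 / (q + 1)), by positivity, ?_⟩
  intro u hu E _ hE
  have hE' : ∀ f ∈ E, u * ‖f‖ ^ 2 ≤ ‖ha.op f‖ ^ 2 := fun f hf => by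
    rcases eq_or_ne f 0 with rfl | h0
    · simp
    · exact (hE f hf h0).le
  refine dim_bound_of_mesh ?_ hT hK hq hu ?_ ?_
  · rcases Nat.eq_zero_or_pos (Module.finrank ℝ E) with h | h
    · exact Or.inl (by exact_mod_cast h)
    · exact Or.inr (by exact_mod_cast h)
  · have := ha.finrank_le (m := 0) Fin.elim0 hu fun f hf _ => hE' f hf
    simpa using this
  · intro m hm
    obtain ⟨h1, h2⟩ := hmod m hm
    have := h1.finrank_le (meshIndicator m) hu fun f hf hφ => by
      rw [ha.op_sub_step h1 hφ]; exact hE' f hf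
    push_cast at this
    refine this.trans ?_
    gcongr

end Mesh

section Constants

lemma abs_rpow_sub_rpow_le {x y α : ℝ} (hx : 0 < x) (hxy : x ≤ y) (hα : α ≤ 1) :
    |y ^ α - x ^ α| ≤ |α| * (y - x) * x ^ (α - 1) := by
  have h := (convex_Icc x y).norm_image_sub_le_of_norm_hasDerivWithin_le
    (f := fun z => z ^ α) (f' := fun z => α * z ^ (α - 1)) (C := |α| * x ^ (α - 1))
    (fun z hz => (hasDerivAt_rpow_const (Or.inl (hx.trans_le hz.1).ne')).hasDerivWithinAt)
    (fun z hz => by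
      rw [norm_mul, norm_eq_abs, norm_eq_abs, abs_of_nonneg (rpow_nonneg (hx.le.trans hz.1) _)]
      exact mul_le_mul_of_nonneg_left (rpow_le_rpow_of_nonpos hx hz.1 (by linarith))
        (abs_nonneg _))
    (Set.left_mem_Icc.2 hxy) (Set.right_mem_Icc.2 hxy)
  rw [norm_eq_abs, norm_eq_abs, abs_of_nonneg (sub_nonneg.2 hxy)] at h
  linarith

lemma integrableOn_beta {u v : ℝ} (hu : 0 < u) (hv : 0 < v) :
    IntegrableOn (fun x : ℝ => x ^ (u - 1) * (1 - x) ^ (v - 1)) (Set.Ioo 0 1) := by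
  have h := Complex.betaIntegral_convergent (u := u) (v := v) (by simpa) (by simpa)
  rw [intervalIntegrable_iff_integrableOn_Ioo_of_le zero_le_one] at h
  refine IntegrableOn.congr_fun h.re (fun x hx => ?_) measurableSet_Ioo
  rw [RCLike.re_to_complex, ← Complex.ofReal_one, ← Complex.ofReal_sub, ← Complex.ofReal_sub,
    ← Complex.ofReal_sub, ← Complex.ofReal_cpow hx.1.le,
    ← Complex.ofReal_cpow (sub_nonneg.2 hx.2.le), ← Complex.ofReal_mul, Complex.ofReal_re]

lemma integral_beta {u v : ℝ} (hu : 0 < u) (hv : 0 < v) :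
    ∫ x in Set.Ioo (0:ℝ) 1, x ^ (u - 1) * (1 - x) ^ (v - 1) = beta u v := by
  rw [beta_eq_betaIntegralReal u v hu hv, Complex.betaIntegral,
    intervalIntegral.integral_of_le zero_le_one, integral_Ioc_eq_integral_Ioo]
  have h := Complex.betaIntegral_convergent (u := u) (v := v) (by simpa) (by simpa)
  rw [intervalIntegrable_iff_integrableOn_Ioo_of_le zero_le_one] at h
  rw [← RCLike.re_to_complex, ← integral_re h]
  refine setIntegral_congr_fun measurableSet_Ioo fun x hx => ?_
  rw [RCLike.re_to_complex, ← Complex.ofReal_one, ← Complex.ofReal_sub, ← Complex.ofReal_sub,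
    ← Complex.ofReal_sub, ← Complex.ofReal_cpow hx.1.le,
    ← Complex.ofReal_cpow (sub_nonneg.2 hx.2.le), ← Complex.ofReal_mul, Complex.ofReal_re]

lemma image_div_one_add : (fun r : ℝ => r / (1 + r)) '' Set.Ioi 0 = Set.Ioo 0 1 := by
  ext x
  constructor
  · rintro ⟨r, hr, rfl⟩
    have hr : 0 < r := hr
    exact ⟨by positivity, (div_lt_one (by positivity)).2 (by linarith)⟩
  · rintro ⟨h0, h1⟩
    have : 0 < 1 - x := by linarith
    refine ⟨x / (1 - x), div_pos h0 this, ?_⟩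
    field_simp
    ring_nf

lemma beta_prime {u v : ℝ} (hu : 0 < u) (hv : 0 < v) :
    IntegrableOn (fun r : ℝ => r ^ (u - 1) * (1 + r) ^ (-(u + v))) (Set.Ioi 0) ∧
    ∫ r in Set.Ioi (0:ℝ), r ^ (u - 1) * (1 + r) ^ (-(u + v)) = beta u v := by
  have hd : ∀ r ∈ Set.Ioi (0:ℝ), HasDerivWithinAt (fun r : ℝ => r / (1 + r)) (1 / (1 + r) ^ 2)
      (Set.Ioi 0) r := fun r hr => by
    have hr : 0 < r := hr
    have := ((hasDerivAt_id r).div ((hasDerivAt_id r).const_add 1)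
      (by simp; positivity)).hasDerivWithinAt (s := Set.Ioi 0)
    convert! this using 1
    simp
  have hinj : Set.InjOn (fun r : ℝ => r / (1 + r)) (Set.Ioi 0) := fun x hx y hy h => by
    have hx : 0 < x := hx
    have hy : 0 < y := hy
    dsimp only at h
    rw [div_eq_div_iff (by positivity) (by positivity)] at h
    linarith
  have hcongr : ∀ r ∈ Set.Ioi (0:ℝ), |1 / (1 + r) ^ 2| •
      ((r / (1 + r)) ^ (u - 1) * (1 - r / (1 + r)) ^ (v - 1)) =
      r ^ (u - 1) * (1 + r) ^ (-(u + v)) := fun r hr => by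
    have hr : 0 < r := hr
    have h1 : 0 < 1 + r := by positivity
    have h2 : 1 - r / (1 + r) = (1 + r)⁻¹ := by field_simp; ring
    rw [abs_of_pos (by positivity), h2, div_rpow hr.le h1.le, inv_rpow h1.le, smul_eq_mul,
      div_eq_mul_inv (r ^ (u - 1)), ← rpow_neg h1.le, ← rpow_neg h1.le, one_div, ← rpow_natCast, ← rpow_neg h1.le]
    have : (1 + r) ^ (-(u + v)) = (1 + r) ^ (-((2:ℕ):ℝ)) * (1 + r) ^ (-(u-1)) *
        (1 + r) ^ (-(v-1)) := by
      rw [← rpow_add h1, ← rpow_add h1]; congr 1; push_cast; ring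
    rw [this]; ring
  constructor
  · have := (integrableOn_image_iff_integrableOn_abs_deriv_smul measurableSet_Ioi hd hinj
      fun x : ℝ => x ^ (u - 1) * (1 - x) ^ (v - 1)).1
      (by rw [image_div_one_add]; exact integrableOn_beta hu hv)
    exact this.congr_fun hcongr measurableSet_Ioi
  · have := integral_image_eq_integral_abs_deriv_smul measurableSet_Ioi hd hinj
      fun x : ℝ => x ^ (u - 1) * (1 - x) ^ (v - 1)
    rw [image_div_one_add, integral_beta hu hv] at this
    rw [this]
    exact (setIntegral_congr_fun measurableSet_Ioi hcongr).symm

lemma integrableOn_sq_rpow_sub {α : ℝ} (h1 : -1/2 < α) (h2 : α < 1/2) :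
    IntegrableOn (fun r : ℝ => ((1 + r) ^ α - r ^ α) ^ 2) (Set.Ioi 0) := by
  have hm : ∀ s : Set ℝ, AEStronglyMeasurable (fun r : ℝ => ((1 + r) ^ α - r ^ α) ^ 2)
      (volume.restrict s) := fun s => by
    have : Measurable fun r : ℝ => ((1 + r) ^ α - r ^ α) ^ 2 := by fun_prop
    exact this.aestronglyMeasurable
  rw [← Set.Ioc_union_Ioi_eq_Ioi (zero_le_one (α := ℝ)), integrableOn_union]
  constructor
  · have h3 : IntegrableOn (fun r : ℝ => 4 + 2 * r ^ (2 * α)) (Set.Ioc 0 1) := by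
      refine Integrable.add (integrable_const _) (Integrable.const_mul ?_ _)
      have := intervalIntegral.intervalIntegrable_rpow' (a := 0) (b := 1) (r := 2 * α)
        (by linarith)
      rwa [intervalIntegrable_iff_integrableOn_Ioc_of_le zero_le_one] at this
    refine h3.mono' (hm _) ?_
    filter_upwards [ae_restrict_mem measurableSet_Ioc] with r hr
    rw [norm_of_nonneg (sq_nonneg _)]
    have e1 : r ^ (2 * α) = (r ^ α) ^ 2 := by
      rw [mul_comm, rpow_mul hr.1.le]; norm_num
    have e2 : ((1 + r) ^ α) ^ 2 ≤ 2 := by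
      rw [← rpow_natCast, ← rpow_mul (by linarith [hr.1])]
      calc (1 + r) ^ (α * (2:ℕ)) ≤ (1 + r) ^ (1:ℝ) :=
            rpow_le_rpow_of_exponent_le (by linarith [hr.1]) (by push_cast; linarith)
        _ ≤ 2 := by rw [rpow_one]; linarith [hr.2]
    rw [e1]
    nlinarith [sq_nonneg ((1 + r) ^ α + r ^ α)]
  · refine ((integrableOn_Ioi_rpow_of_lt (a := 2 * α - 2) (by linarith)
      one_pos).const_mul (α ^ 2)).mono' (hm _) ?_
    filter_upwards [ae_restrict_mem measurableSet_Ioi] with r hr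
    have hr0 : 0 < r := one_pos.trans hr
    have h3 := abs_rpow_sub_rpow_le (α := α) hr0 (by linarith : r ≤ 1 + r) (by linarith)
    rw [norm_of_nonneg (sq_nonneg _), ← sq_abs]
    have h4 : r ^ (2 * α - 2) = (r ^ (α - 1)) ^ 2 := by
      rw [← rpow_natCast, ← rpow_mul hr0.le]; congr 1; push_cast; ring
    rw [h4, ← sq_abs α, ← mul_pow]
    refine pow_le_pow_left₀ (abs_nonneg _) ?_ 2
    simpa using h3

lemma tendsto_rpow_boundary {α : ℝ} (h2 : α < 1/2) :
    Tendsto (fun r : ℝ => (1 + r) ^ (2 * α + 1) + r ^ (2 * α + 1) - 2 * (r ^ (α + 1) * (1 + r) ^ α)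
      - r ^ (α + 1) * (1 + r) ^ (α - 1)) atTop (nhds 0) := by
  have hslope : ∀ p : ℝ, Tendsto (fun r : ℝ => ((1 + r⁻¹) ^ p - 1) / r⁻¹) atTop (nhds p) := by
    intro p
    have hd : HasDerivAt (fun y : ℝ => y ^ p) p 1 := by
      simpa using hasDerivAt_rpow_const (x := (1:ℝ)) (p := p) (Or.inl one_ne_zero)
    have h := hd.tendsto_slope_zero_right.comp tendsto_inv_atTop_nhdsGT_zero
    refine h.congr fun r => ?_
    simp [div_eq_inv_mul]
  have hpow : Tendsto (fun r : ℝ => (1 + r⁻¹) ^ (α - 1)) atTop (nhds 1) := by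
    have h : Tendsto (fun r : ℝ => 1 + r⁻¹) atTop (nhds 1) := by
      simpa using tendsto_inv_atTop_zero.const_add (1:ℝ)
    simpa using h.rpow_const (p := α - 1) (Or.inl one_ne_zero)
  have h0 : Tendsto (fun r : ℝ => r ^ (2 * α - 1)) atTop (nhds 0) := by
    have := tendsto_rpow_neg_atTop (y := 1 - 2 * α) (by linarith)
    simpa using this
  have h := h0.mul (((hslope α).pow 2).add (hpow.mul (hslope (α + 1))))
  rw [zero_mul] at h
  refine h.congr' ?_
  filter_upwards [eventually_gt_atTop 0] with r hr
  have hy : 0 < 1 + r⁻¹ := by positivity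
  have e0 : 1 + r = r * (1 + r⁻¹) := by field_simp; ring
  rw [e0]
  set y := 1 + r⁻¹ with hydef
  have hrinv : r⁻¹ = y - 1 := by rw [hydef]; ring
  simp_rw [mul_rpow hr.le hy.le]
  have a1 : r ^ (2 * α + 1) = r ^ (2 * α - 1) * r ^ 2 := by
    rw [← rpow_natCast, ← rpow_add hr]; congr 1; push_cast; ring
  have a2 : r ^ (α + 1) * (r ^ α * y ^ α) = r ^ (2 * α - 1) * r ^ 2 * y ^ α := by
    rw [← a1, ← mul_assoc, ← rpow_add hr]; congr 2; ring
  have a3 : r ^ (α + 1) * (r ^ (α - 1) * y ^ (α - 1)) = r ^ (2 * α - 1) * r * y ^ (α - 1) := by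
    nth_rewrite 4 [← rpow_one r]
    rw [← rpow_add hr, ← mul_assoc, ← rpow_add hr]; congr 2; ring
  have b1 : y ^ (2 * α + 1) = (y ^ (α - 1)) ^ 2 * y ^ 3 := by
    rw [← rpow_natCast, ← rpow_natCast, ← rpow_mul hy.le, ← rpow_add hy]; congr 1; push_cast; ring
  have b2 : y ^ α = y ^ (α - 1) * y := by
    nth_rewrite 3 [← rpow_one y]
    rw [← rpow_add hy]; congr 1; ring
  have b3 : y ^ (α + 1) = y ^ (α - 1) * y ^ 2 := by
    rw [← rpow_natCast, ← rpow_add hy]; congr 1; push_cast; ring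
  rw [a1, a2, a3, b1, b2, b3, div_inv_eq_mul, div_inv_eq_mul]
  have hry : r * y = r + 1 := by rw [hydef]; field_simp
  generalize r ^ (2 * α - 1) = R
  generalize y ^ (α - 1) = w
  linear_combination (-(R * w ^ 2 * y ^ 2 * r)) * hry

lemma integral_sq_rpow_sub {α : ℝ} (h1 : -1/2 < α) (h2 : α < 1/2) :
    ∫ r in Set.Ioi (0:ℝ), ((1 + r) ^ α - r ^ α) ^ 2 =
      ((1 - α) * beta (α + 1) (1 - 2 * α) - 1) / (2 * α + 1) := by
  obtain ⟨hJi, hJ⟩ := beta_prime (u := α + 1) (v := 1 - 2 * α) (by linarith) (by linarith)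
  have hI := integrableOn_sq_rpow_sub h1 h2
  have e1 : α + 1 - 1 = α := by ring
  have e2 : -(α + 1 + (1 - 2 * α)) = α - 2 := by ring
  rw [e1, e2] at hJi hJ
  have hpos : 0 < 2 * α + 1 := by linarith
  have key := integral_Ioi_of_hasDerivAt_of_tendsto (a := 0) (m := 0)
    (f := fun r : ℝ => (1 + r) ^ (2 * α + 1) + r ^ (2 * α + 1) - 2 * (r ^ (α + 1) * (1 + r) ^ α)
      - r ^ (α + 1) * (1 + r) ^ (α - 1))
    (f' := fun r => (2 * α + 1) * ((1 + r) ^ α - r ^ α) ^ 2 -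
      (1 - α) * (r ^ α * (1 + r) ^ (α - 2))) ?_ ?_ ?_ (tendsto_rpow_boundary h2)
  · rw [integral_sub (hI.const_mul _) (hJi.const_mul _), integral_const_mul, integral_const_mul,
      hJ] at key
    have hz : (0:ℝ) ^ (2 * α + 1) = 0 := zero_rpow hpos.ne'
    have hz' : (0:ℝ) ^ (α + 1) = 0 := zero_rpow (by linarith)
    simp only [add_zero, one_rpow, hz, hz', zero_mul, mul_zero, sub_zero] at key
    rw [eq_div_iff hpos.ne']
    linarith
  · have hc : ∀ p : ℝ, ContinuousAt (fun r : ℝ => (1 + r) ^ p) 0 := fun p =>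
      ContinuousAt.rpow_const (by fun_prop) (Or.inl (by norm_num))
    have hc' : ∀ p : ℝ, 0 ≤ p → ContinuousAt (fun r : ℝ => r ^ p) 0 := fun p hp =>
      ContinuousAt.rpow_const (by fun_prop) (Or.inr hp)
    exact ((((hc _).add (hc' _ hpos.le)).sub (((hc' _ (by linarith)).mul (hc _)).const_mul 2)).sub
      ((hc' _ (by linarith)).mul (hc _))).continuousWithinAt
  · intro r hr
    have hr : 0 < r := hr
    have hs : 0 < 1 + r := by linarith
    have hA : ∀ p : ℝ, HasDerivAt (fun r : ℝ => (1 + r) ^ p) (p * (1 + r) ^ (p - 1)) r := fun p => by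
      simpa using ((hasDerivAt_id r).const_add 1).rpow_const (p := p) (Or.inl hs.ne')
    have hB : ∀ p : ℝ, HasDerivAt (fun r : ℝ => r ^ p) (p * r ^ (p - 1)) r := fun p =>
      hasDerivAt_rpow_const (Or.inl hr.ne')
    have hd := (((hA (2 * α + 1)).add (hB (2 * α + 1))).sub
      (((hB (α + 1)).mul (hA α)).const_mul 2)).sub ((hB (α + 1)).mul (hA (α - 1)))
    refine hd.congr_deriv ?_
    have p0 : ∀ x : ℝ, 0 < x → x ^ (2 * α + 1 - 1) = (x ^ α) ^ 2 := fun x hx => by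
      rw [← rpow_natCast, ← rpow_mul hx.le]; congr 1; push_cast; ring
    have p1 : r ^ (α + 1) = r ^ α * r := by rw [rpow_add hr, rpow_one]
    have p2 : (1 + r) ^ α = (1 + r) ^ (α - 2) * (1 + r) ^ 2 := by
      rw [← rpow_natCast, ← rpow_add hs]; congr 1; push_cast; ring
    have p3 : (1 + r) ^ (α - 1) = (1 + r) ^ (α - 2) * (1 + r) := by
      nth_rewrite 3 [← rpow_one (1 + r)]
      rw [← rpow_add hs]; congr 1; ring
    have p4 : α - 1 - 1 = α - 2 := by ring
    rw [p0 _ hr, p0 _ hs, p4, e1, p1, p2, p3]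
    ring
  · exact (hI.const_mul _).sub (hJi.const_mul _)

/-- The variance at time one of the process with the moving average kernel of fractional Brownian
motion. -/
noncomputable def fbmConst (ρ : ℝ) : ℝ :=
  Real.Gamma (ρ + 1/2) ^ 2 / (Real.Gamma (2 * ρ + 1) * Real.sin (π * ρ))

lemma fbmConst_pos {ρ : ℝ} (h0 : 0 < ρ) (h1 : ρ < 1) : 0 < fbmConst ρ := by
  have h2 : 0 < Real.sin (π * ρ) :=
    sin_pos_of_pos_of_lt_pi (by positivity) (by nlinarith [pi_pos])
  have h3 := Real.Gamma_pos_of_pos (by linarith : 0 < ρ + 1/2)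
  have h4 := Real.Gamma_pos_of_pos (by linarith : 0 < 2 * ρ + 1)
  unfold fbmConst
  positivity

lemma fbmConst_eq {ρ : ℝ} (h0 : 0 < ρ) (h1 : ρ < 1) :
    1 / (2 * ρ) + ∫ r in Set.Ioi (0:ℝ), ((1 + r) ^ (ρ - 1/2) - r ^ (ρ - 1/2)) ^ 2 = fbmConst ρ := by
  rw [integral_sq_rpow_sub (by linarith) (by linarith), beta, fbmConst]
  have e1 : ρ - 1/2 + 1 = ρ + 1/2 := by ring
  have e2 : 1 - 2 * (ρ - 1/2) = 2 * (1 - ρ) := by ring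
  have e3 : ρ + 1/2 + 2 * (1 - ρ) = (1 - ρ + 1/2) + 1 := by ring
  have e4 : 2 * (ρ - 1/2) + 1 = 2 * ρ := by ring
  rw [e1, e2, e3, e4, Gamma_add_one (by linarith), Gamma_add_one (by linarith)]
  have hsin : 0 < Real.sin (π * ρ) :=
    sin_pos_of_pos_of_lt_pi (by positivity) (by nlinarith [pi_pos])
  have g1 := Real.Gamma_mul_Gamma_add_half (1 - ρ)
  have g2 := Real.Gamma_mul_Gamma_add_half ρ
  have g3 := Real.Gamma_mul_Gamma_one_sub ρ
  have hp : (2:ℝ) ^ (1 - 2 * (1 - ρ)) * 2 ^ (1 - 2 * ρ) = 1 := by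
    rw [← rpow_add two_pos]; ring_nf; simp
  have hpi : √π * √π = π := mul_self_sqrt pi_pos.le
  have hA := Real.Gamma_pos_of_pos h0
  have hB := Real.Gamma_pos_of_pos (by linarith : 0 < 1 - ρ)
  have hC := Real.Gamma_pos_of_pos (by linarith : 0 < ρ + 1/2)
  have hD := Real.Gamma_pos_of_pos (by linarith : 0 < 1 - ρ + 1/2)
  have hE := Real.Gamma_pos_of_pos (by linarith : 0 < 2 * ρ)
  have hF := Real.Gamma_pos_of_pos (by linarith : 0 < 2 * (1 - ρ))
  have e5 : 1 - (ρ - 1/2) = 1 - ρ + 1/2 := by ring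
  rw [e5]
  have hr : (0:ℝ) < 1 - ρ + 1/2 := by linarith
  generalize Real.Gamma ρ = A at *
  generalize Real.Gamma (1 - ρ) = B at *
  generalize Real.Gamma (ρ + 1/2) = C at *
  generalize Real.Gamma (1 - ρ + 1/2) = D at *
  generalize Real.Gamma (2 * ρ) = E at *
  generalize Real.Gamma (2 * (1 - ρ)) = F at *
  generalize (2:ℝ) ^ (1 - 2 * (1 - ρ)) = p at *
  generalize (2:ℝ) ^ (1 - 2 * ρ) = q at *
  generalize Real.sin (π * ρ) = σ at *
  rw [eq_div_iff hsin.ne'] at g3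
  have key : D * C = F * E * σ := by
    have h : (B * D) * (A * C) * σ = F * E * π * σ := by
      rw [g1, g2]
      calc F * p * √π * (E * q * √π) * σ
          = F * E * (p * q) * (√π * √π) * σ := by ring
        _ = _ := by rw [hp, hpi]; ring
    have h' : π * (D * C) = π * (F * E * σ) := by
      linear_combination h - D * C * g3
    exact mul_left_cancel₀ pi_ne_zero h'
  generalize 1 - ρ + 1/2 = x at *
  field_simp
  linear_combination -C * key

end Constants

section MovingAverage

/-- The truncated power function `x₊ ^ α`. -/
noncomputable def truncPow (α x : ℝ) : ℝ := if 0 < x then x ^ α else 0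

lemma truncPow_of_pos {α x : ℝ} (hx : 0 < x) : truncPow α x = x ^ α := if_pos hx

lemma truncPow_of_nonpos {α x : ℝ} (hx : x ≤ 0) : truncPow α x = 0 := if_neg hx.not_gt

lemma measurable_truncPow (α : ℝ) : Measurable (truncPow α) :=
  Measurable.ite measurableSet_Ioi (by fun_prop) measurable_const

lemma truncPow_mul {α h : ℝ} (hh : 0 < h) (x : ℝ) : truncPow α (h * x) = h ^ α * truncPow α x := by
  rcases lt_or_ge 0 x with hx | hx
  · rw [truncPow_of_pos hx, truncPow_of_pos (by positivity), mul_rpow hh.le hx.le]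
  · rw [truncPow_of_nonpos hx, truncPow_of_nonpos (mul_nonpos_of_nonneg_of_nonpos hh.le hx),
      mul_zero]

lemma integral_sq_truncPow_sub {ρ : ℝ} (h0 : 0 < ρ) (h1 : ρ < 1) :
    Integrable (fun r => (truncPow (ρ - 1/2) (1 + r) - truncPow (ρ - 1/2) r) ^ 2) ∧
    ∫ r, (truncPow (ρ - 1/2) (1 + r) - truncPow (ρ - 1/2) r) ^ 2 = fbmConst ρ := by
  have hI := integrableOn_sq_rpow_sub (α := ρ - 1/2) (by linarith) (by linarith)
  have hG' : IntervalIntegrable (fun r : ℝ => (1 + r) ^ (2 * ρ - 1)) volume (-1) 0 := by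
    have h := (intervalIntegral.intervalIntegrable_rpow' (a := 0) (b := 1) (r := 2 * ρ - 1)
      (by linarith)).comp_add_left 1
    simpa using h
  have hGv : ∫ r in (-1:ℝ)..0, (1 + r) ^ (2 * ρ - 1) = 1 / (2 * ρ) := by
    have h := intervalIntegral.integral_comp_add_left (a := -1) (b := 0)
      (fun x : ℝ => x ^ (2 * ρ - 1)) 1
    rw [h, integral_rpow (Or.inl (by linarith))]
    norm_num
    rw [zero_rpow (by linarith)]; simp
  have hG : IntegrableOn (fun r : ℝ => (1 + r) ^ (2 * ρ - 1)) (Set.Ioc (-1) 0) := by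
    rwa [intervalIntegrable_iff_integrableOn_Ioc_of_le (by norm_num)] at hG'
  rw [intervalIntegral.integral_of_le (by norm_num)] at hGv
  have hfun : (fun r => (truncPow (ρ - 1/2) (1 + r) - truncPow (ρ - 1/2) r) ^ 2) =
      fun r => (Set.Ioc (-1) 0).indicator (fun r : ℝ => (1 + r) ^ (2 * ρ - 1)) r +
        (Set.Ioi 0).indicator (fun r : ℝ => ((1 + r) ^ (ρ - 1/2) - r ^ (ρ - 1/2)) ^ 2) r := by
    ext r
    rcases lt_or_ge 0 r with hr | hr
    · rw [truncPow_of_pos hr, truncPow_of_pos (by linarith), Set.indicator_of_notMem (by simp [hr]),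
        Set.indicator_of_mem (by simpa using hr), zero_add]
    · rw [truncPow_of_nonpos hr, Set.indicator_of_notMem (s := Set.Ioi 0) (by simp [hr])]
      rcases lt_or_ge (-1) r with hr' | hr'
      · rw [Set.indicator_of_mem (by simp [hr, hr']), truncPow_of_pos (by linarith), sub_zero,
          add_zero, ← rpow_natCast, ← rpow_mul (by linarith)]
        congr 1; push_cast; ring
      · rw [truncPow_of_nonpos (by linarith), Set.indicator_of_notMem (by simp [hr'])]
        simp
  rw [hfun]
  have i1 := hG.integrable_indicator measurableSet_Ioc
  have i2 := hI.integrable_indicator measurableSet_Ioi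
  refine ⟨i1.add i2, ?_⟩
  rw [integral_add i1 i2, integral_indicator measurableSet_Ioc, integral_indicator measurableSet_Ioi,
    hGv, fbmConst_eq h0 h1]

lemma integral_sq_truncPow_sub_of_pos {ρ h : ℝ} (h0 : 0 < ρ) (h1 : ρ < 1) (hh : 0 < h) :
    Integrable (fun r => (truncPow (ρ - 1/2) (h + r) - truncPow (ρ - 1/2) r) ^ 2) ∧
    ∫ r, (truncPow (ρ - 1/2) (h + r) - truncPow (ρ - 1/2) r) ^ 2 = fbmConst ρ * h ^ (2 * ρ) := by
  obtain ⟨hi, hv⟩ := integral_sq_truncPow_sub h0 h1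
  have hfun : (fun r => (truncPow (ρ - 1/2) (h + r) - truncPow (ρ - 1/2) r) ^ 2) =
      fun r => h ^ (2 * ρ - 1) *
        (truncPow (ρ - 1/2) (1 + r / h) - truncPow (ρ - 1/2) (r / h)) ^ 2 := by
    ext r
    have e1 : h + r = h * (1 + r / h) := by field_simp
    have e2 : truncPow (ρ - 1/2) r = truncPow (ρ - 1/2) (h * (r / h)) := by
      congr 1; field_simp
    have e3 : h ^ (2 * ρ - 1) = (h ^ (ρ - 1/2)) ^ 2 := by
      rw [← rpow_natCast, ← rpow_mul hh.le]; congr 1; push_cast; ring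
    rw [e1, e2, truncPow_mul hh, truncPow_mul hh, e3]; ring
  rw [hfun]
  refine ⟨(hi.comp_div hh.ne').const_mul _, ?_⟩
  rw [integral_const_mul, Measure.integral_comp_div
    (fun r => (truncPow (ρ - 1/2) (1 + r) - truncPow (ρ - 1/2) r) ^ 2) h, hv, abs_of_pos hh,
    smul_eq_mul, ← mul_assoc]
  nth_rewrite 2 [← rpow_one h]
  rw [← rpow_add hh, mul_comm]
  ring_nf

/-- The kernel of the moving average representation of fractional Brownian motion. -/
noncomputable def mvnKernel (ρ t r : ℝ) : ℝ :=
  truncPow (ρ - 1/2) (t - r) - truncPow (ρ - 1/2) (-r)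

lemma mvnKernel_zero (ρ r : ℝ) : mvnKernel ρ 0 r = 0 := by simp [mvnKernel]

lemma mvnKernel_sub (ρ s t r : ℝ) : mvnKernel ρ t r - mvnKernel ρ s r =
    truncPow (ρ - 1/2) (t - r) - truncPow (ρ - 1/2) (s - r) := by
  unfold mvnKernel; ring

lemma measurable_mvnKernel (ρ : ℝ) : Measurable (Function.uncurry (mvnKernel ρ)) :=
  ((measurable_truncPow _).comp (measurable_fst.sub measurable_snd)).sub
    ((measurable_truncPow _).comp measurable_snd.neg)

lemma integral_sq_mvnKernel_sub {ρ : ℝ} (h0 : 0 < ρ) (h1 : ρ < 1) (s t : ℝ) :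
    Integrable (fun r => (mvnKernel ρ t r - mvnKernel ρ s r) ^ 2) ∧
    ∫ r, (mvnKernel ρ t r - mvnKernel ρ s r) ^ 2 = fbmConst ρ * |t - s| ^ (2 * ρ) := by
  wlog hst : s ≤ t generalizing s t
  · have := this t s (by linarith)
    rw [abs_sub_comm t s]
    simp_rw [sub_sq_comm (mvnKernel ρ t _)]
    exact this
  rcases hst.eq_or_lt with rfl | hst
  · simp only [sub_self, abs_zero]
    rw [zero_rpow (by linarith)]
    simp
  · obtain ⟨hi, hv⟩ := integral_sq_truncPow_sub_of_pos h0 h1 (sub_pos.2 hst)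
    have hfun : (fun r => (mvnKernel ρ t r - mvnKernel ρ s r) ^ 2) = fun r =>
        (truncPow (ρ - 1/2) (t - s + (s - r)) - truncPow (ρ - 1/2) (s - r)) ^ 2 := by
      ext r
      rw [mvnKernel_sub]; congr 4; ring
    rw [hfun, abs_of_pos (sub_pos.2 hst), ← hv]
    exact ⟨hi.comp_sub_left s, integral_sub_left_eq_self
      (fun r => (truncPow (ρ - 1/2) (t - s + r) - truncPow (ρ - 1/2) r) ^ 2) volume s⟩

lemma memLp_mvnKernel {ρ : ℝ} (h0 : 0 < ρ) (h1 : ρ < 1) (t : ℝ) :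
    MemLp (mvnKernel ρ t) 2 volume := by
  have hm : Measurable (mvnKernel ρ t) := (measurable_mvnKernel ρ).comp measurable_prodMk_left
  rw [memLp_two_iff_integrable_sq hm.aestronglyMeasurable]
  simpa [mvnKernel_zero] using (integral_sq_mvnKernel_sub h0 h1 0 t).1

/-- The moving average kernel yields the covariance of fractional Brownian motion. -/
lemma integral_mvnKernel_mul {ρ s t : ℝ} (h0 : 0 < ρ) (h1 : ρ < 1) (hs : 0 ≤ s) (ht : 0 ≤ t) :
    ∫ r, mvnKernel ρ s r * mvnKernel ρ t r = fbmConst ρ * fbmKernel ρ s t := by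
  have hsq : ∀ t : ℝ, 0 ≤ t → ∫ r, mvnKernel ρ t r ^ 2 = fbmConst ρ * t ^ (2 * ρ) := fun t ht => by
    simpa [mvnKernel_zero, abs_of_nonneg ht] using (integral_sq_mvnKernel_sub h0 h1 0 t).2
  have hd := (integral_sq_mvnKernel_sub h0 h1 t s).2
  have hms := memLp_mvnKernel h0 h1 s
  have hmt := memLp_mvnKernel h0 h1 t
  have hexp : ∀ r, (mvnKernel ρ s r - mvnKernel ρ t r) ^ 2 =
      (mvnKernel ρ s r ^ 2 + mvnKernel ρ t r ^ 2) - 2 * (mvnKernel ρ s r * mvnKernel ρ t r) :=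
    fun r => by ring
  simp_rw [hexp] at hd
  rw [integral_sub (f := fun r => mvnKernel ρ s r ^ 2 + mvnKernel ρ t r ^ 2)
    (g := fun r => 2 * (mvnKernel ρ s r * mvnKernel ρ t r))
    (hms.integrable_sq.add hmt.integrable_sq) ((hms.integrable_mul hmt).const_mul 2),
    integral_add hms.integrable_sq hmt.integrable_sq, integral_const_mul, hsq s hs, hsq t ht] at hd
  unfold fbmKernel
  linarith

/-- The moving average kernel restricted to the positive half-line yields the covariance of the
Riemann–Liouville process. -/
lemma setIntegral_mvnKernel_mul {ρ s t : ℝ} (hs : 0 ≤ s) (ht : 0 ≤ t) :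
    ∫ r in Set.Ioi 0, mvnKernel ρ s r * mvnKernel ρ t r = rlKernel ρ s t := by
  unfold rlKernel
  rw [intervalIntegral.integral_of_le (le_min hs ht), integral_Ioc_eq_integral_Ioo,
    ← integral_indicator measurableSet_Ioi, ← integral_indicator measurableSet_Ioo]
  congr 1
  ext r
  rcases le_or_gt r 0 with hr | hr
  · rw [Set.indicator_of_notMem (by simpa using hr),
      Set.indicator_of_notMem (fun h => (h.1.not_ge hr))]
  · rw [Set.indicator_of_mem (by simpa using hr)]
    simp only [mvnKernel, truncPow_of_nonpos (by linarith : -r ≤ 0), sub_zero]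
    by_cases h : r < min s t
    · rw [Set.indicator_of_mem (Set.mem_Ioo.2 ⟨hr, h⟩), truncPow_of_pos, truncPow_of_pos, mul_comm]
      · linarith [h.trans_le (min_le_right s t)]
      · linarith [h.trans_le (min_le_left s t)]
    · rw [Set.indicator_of_notMem fun h' => h h'.2]
      rcases min_le_iff.1 (not_lt.1 h) with h' | h'
      · rw [truncPow_of_nonpos (x := s - r) (by linarith), zero_mul]
      · rw [truncPow_of_nonpos (x := t - r) (by linarith), mul_zero]

end MovingAverage

section MovingAverageCounting

lemma IsHSKernel.of_integral_le {S R : Type*} [MeasurableSpace S] [MeasurableSpace R]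
    {μ : Measure S} {ν : Measure R} [SFinite μ] [SFinite ν] {a : S → R → ℝ}
    (hm : Measurable (Function.uncurry a)) (hi : ∀ᵐ t ∂μ, Integrable (fun r => a t r ^ 2) ν)
    {g : S → ℝ} (hg : Integrable g μ) (hb : ∀ᵐ t ∂μ, ∫ r, a t r ^ 2 ∂ν ≤ g t) :
    IsHSKernel μ ν a ∧ ∫ r, ∫ t, a t r ^ 2 ∂μ ∂ν ≤ ∫ t, g t ∂μ := by
  have hInt : Integrable (fun p : S × R => a p.1 p.2 ^ 2) (μ.prod ν) := by
    have hms : AEStronglyMeasurable (fun p : S × R => a p.1 p.2 ^ 2) (μ.prod ν) :=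
      (hm.pow_const 2).aestronglyMeasurable
    rw [integrable_prod_iff hms]
    refine ⟨hi, hg.mono' hms.norm.integral_prod_right' ?_⟩
    filter_upwards [hb] with t ht
    have h : ∫ r, ‖a t r ^ 2‖ ∂ν = ∫ r, a t r ^ 2 ∂ν := by simp
    rwa [h, norm_of_nonneg (integral_nonneg fun r => sq_nonneg _)]
  refine ⟨⟨hm, (memLp_two_iff_integrable_sq hm.aestronglyMeasurable).2 hInt⟩, ?_⟩
  rw [← integral_integral_swap (f := fun t r => a t r ^ 2) hInt]
  exact integral_mono_ae hInt.integral_prod_left hg hb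

lemma IsHSKernel.restrict {S R : Type*} [MeasurableSpace S] [MeasurableSpace R]
    {μ : Measure S} {ν : Measure R} [SFinite μ] [SFinite ν] {a : S → R → ℝ}
    (ha : IsHSKernel μ ν a) (s : Set R) : IsHSKernel μ (ν.restrict s) a where
  measurable := ha.measurable
  memLp := by
    have h : μ.prod (ν.restrict s) = (μ.prod ν).restrict (Set.univ ×ˢ s) := by
      rw [← Measure.prod_restrict, Measure.restrict_univ]
    rw [h]
    exact ha.memLp.restrict _

lemma IsHSKernel.norm_op_restrict_add_compl {S R : Type*} [MeasurableSpace S] [MeasurableSpace R]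
    {μ : Measure S} {ν : Measure R} [SFinite μ] [SFinite ν] {a : S → R → ℝ}
    (ha : IsHSKernel μ ν a) {s : Set R} (hs : MeasurableSet s) (f : Lp ℝ 2 μ) :
    ‖(ha.restrict s).op f‖ ^ 2 + ‖(ha.restrict sᶜ).op f‖ ^ 2 = ‖ha.op f‖ ^ 2 := by
  rw [norm_op_sq, norm_op_sq, norm_op_sq]
  exact integral_add_compl hs (ha.memLp_integral f).integrable_sq

variable {ρ : ℝ}

lemma isHSKernel_mvnKernel (h0 : 0 < ρ) (h1 : ρ < 1) : IsHSKernel μ01 volume (mvnKernel ρ) := by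
  refine (IsHSKernel.of_integral_le (measurable_mvnKernel ρ)
    (ae_of_all _ fun t => (memLp_mvnKernel h0 h1 t).integrable_sq)
    (integrable_const (fbmConst ρ)) ?_).1
  filter_upwards [ae_mem_Ioc_μ01] with t ht
  have := (integral_sq_mvnKernel_sub h0 h1 0 t).2
  simp only [mvnKernel_zero, sub_zero] at this
  rw [this]
  refine mul_le_of_le_one_right (fbmConst_pos h0 h1).le (rpow_le_one (abs_nonneg _) ?_ (by linarith))
  rw [abs_of_pos ht.1]; exact ht.2

lemma measurable_mvnKernel_step (ρ : ℝ) (m : ℕ) :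
    Measurable (Function.uncurry fun t r : ℝ =>
      mvnKernel ρ t r - mvnKernel ρ (⌈(m:ℝ) * t⌉₊ / m) r) := by
  refine (measurable_mvnKernel ρ).sub ((measurable_mvnKernel ρ).comp
    (g := Function.uncurry (mvnKernel ρ)) (f := fun p : ℝ × ℝ => ((⌈(m:ℝ) * p.1⌉₊ / m : ℝ), p.2)) ?_)
  have : Measurable fun x : ℝ => (⌈(m:ℝ) * x⌉₊ : ℝ) :=
    (measurable_from_nat (f := fun n : ℕ => (n:ℝ))).comp
      (Nat.measurable_ceil.comp (measurable_const_mul (m:ℝ)))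
  exact ((this.comp measurable_fst).div_const _).prodMk measurable_snd

lemma step_sub_mem {m : ℕ} (hm : 0 < m) {t : ℝ} (ht : 0 ≤ t) :
    0 ≤ (⌈(m:ℝ) * t⌉₊ : ℝ) / m - t ∧ (⌈(m:ℝ) * t⌉₊ : ℝ) / m - t ≤ (m:ℝ)⁻¹ := by
  have hm' : (0:ℝ) < m := by exact_mod_cast hm
  have h1 := Nat.le_ceil ((m:ℝ) * t)
  have h2 := (Nat.ceil_lt_add_one (by positivity : 0 ≤ (m:ℝ) * t)).le
  constructor
  · rw [sub_nonneg, le_div_iff₀ hm']; linarith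
  · rw [sub_le_iff_le_add, div_le_iff₀ hm', add_mul, inv_mul_cancel₀ hm'.ne']; linarith

instance : IsProbabilityMeasure μ01 := ⟨by simp [μ01]⟩

lemma exists_finrank_le_mvnKernel (h0 : 0 < ρ) (h1 : ρ < 1) :
    ∃ D : ℝ, 0 < D ∧ ∀ u : ℝ, 0 < u → ∀ E : Submodule ℝ (Lp ℝ 2 μ01), FiniteDimensional ℝ E →
      (∀ f ∈ E, f ≠ 0 → u * ‖f‖ ^ 2 < ‖(isHSKernel_mvnKernel h0 h1).op f‖ ^ 2) →
      (Module.finrank ℝ E : ℝ) ≤ D * u ^ (-(1 / (2 * ρ + 1))) := by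
  refine (isHSKernel_mvnKernel h0 h1).exists_finrank_le (K := fbmConst ρ) (q := 2 * ρ)
    (fbmConst_pos h0 h1).le (by linarith) fun m hm => ?_
  have h := IsHSKernel.of_integral_le (μ := μ01) (ν := volume) (measurable_mvnKernel_step ρ m)
    (ae_of_all _ fun t => (integral_sq_mvnKernel_sub h0 h1 _ t).1)
    (integrable_const (fbmConst ρ * (m:ℝ) ^ (-(2 * ρ)))) (by
      filter_upwards [ae_mem_Ioc_μ01] with t ht
      rw [(integral_sq_mvnKernel_sub h0 h1 _ t).2]
      obtain ⟨h2, h3⟩ := step_sub_mem hm ht.1.le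
      refine mul_le_mul_of_nonneg_left ?_ (fbmConst_pos h0 h1).le
      rw [rpow_neg (by positivity), ← inv_rpow (by positivity), abs_sub_comm, abs_of_nonneg h2]
      exact rpow_le_rpow h2 h3 (by linarith))
  refine ⟨h.1, h.2.trans_eq ?_⟩
  simp

lemma setIntegral_Iio_rpow {t b : ℝ} (ht : 0 < t) (hb : b < -1) :
    IntegrableOn (fun r : ℝ => (t - r) ^ b) (Set.Iio 0) ∧
      ∫ r in Set.Iio 0, (t - r) ^ b = -t ^ (b + 1) / (b + 1) := by
  have hfun : (Set.Iio 0).indicator (fun r : ℝ => (t - r) ^ b) =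
      fun r => (Set.Ioi t).indicator (fun x : ℝ => x ^ b) (t - r) := by
    ext r
    by_cases hr : r < 0
    · rw [Set.indicator_of_mem (by simpa using hr), Set.indicator_of_mem (by simp; linarith)]
    · rw [Set.indicator_of_notMem (by simpa using hr), Set.indicator_of_notMem (by simp; linarith)]
  have hi := (integrableOn_Ioi_rpow_of_lt hb ht).integrable_indicator measurableSet_Ioi
  rw [← integrable_indicator_iff measurableSet_Iio, ← integral_indicator measurableSet_Iio, hfun]
  refine ⟨hi.comp_sub_left t, ?_⟩
  rw [integral_sub_left_eq_self ((Set.Ioi t).indicator fun x : ℝ => x ^ b) volume t,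
    integral_indicator measurableSet_Ioi, integral_Ioi_rpow_of_lt hb ht]

lemma setIntegral_Iio_sq_mvnKernel_sub_le (h1 : ρ < 1) {s t : ℝ} (ht : 0 < t) (hst : t ≤ s) :
    ∫ r in Set.Iio 0, (mvnKernel ρ t r - mvnKernel ρ s r) ^ 2 ≤
      (ρ - 1/2) ^ 2 / (2 - 2 * ρ) * (s - t) ^ 2 * t ^ (2 * ρ - 2) := by
  obtain ⟨hi, hv⟩ := setIntegral_Iio_rpow (b := 2 * ρ - 3) ht (by linarith)
  have e : 2 * ρ - 3 + 1 = 2 * ρ - 2 := by ring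
  rw [e] at hv
  calc ∫ r in Set.Iio 0, (mvnKernel ρ t r - mvnKernel ρ s r) ^ 2
      ≤ ∫ r in Set.Iio 0, ((ρ - 1/2) ^ 2 * (s - t) ^ 2) * (t - r) ^ (2 * ρ - 3) := by
        refine integral_mono_of_nonneg (ae_of_all _ fun r => sq_nonneg _) (hi.const_mul _) ?_
        filter_upwards [ae_restrict_mem measurableSet_Iio] with r hr
        have hr : r < 0 := hr
        rw [mvnKernel_sub, truncPow_of_pos (by linarith), truncPow_of_pos (by linarith),
          sub_sq_comm]
        have h := abs_rpow_sub_rpow_le (α := ρ - 1/2) (by linarith : 0 < t - r)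
          (by linarith : t - r ≤ s - r) (by linarith)
        have h2 := pow_le_pow_left₀ (abs_nonneg _) h 2
        rw [sq_abs, mul_pow, mul_pow, sq_abs, ← rpow_natCast ((t - r) ^ _),
          ← rpow_mul (by linarith)] at h2
        have e1 : s - r - (t - r) = s - t := by ring
        have e2 : (ρ - 1/2 - 1) * ((2:ℕ):ℝ) = 2 * ρ - 3 := by push_cast; ring
        rwa [e1, e2] at h2
    _ = _ := by
        rw [integral_const_mul, hv]
        have h2 : 2 * ρ - 2 ≠ 0 := by linarith
        have h3 : 2 - 2 * ρ ≠ 0 := by linarith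
        rw [show 2 * ρ - 2 = -(2 - 2 * ρ) by ring, neg_div_neg_eq]
        field_simp

lemma exists_finrank_le_mvnKernel_Iio (h0 : 0 < ρ) (h1 : ρ < 1) :
    ∃ D : ℝ, 0 < D ∧ ∀ u : ℝ, 0 < u → ∀ E : Submodule ℝ (Lp ℝ 2 μ01), FiniteDimensional ℝ E →
      (∀ f ∈ E, f ≠ 0 →
        u * ‖f‖ ^ 2 < ‖((isHSKernel_mvnKernel h0 h1).restrict (Set.Iio 0)).op f‖ ^ 2) →
      (Module.finrank ℝ E : ℝ) ≤ D * u ^ (-(1 / (1 + ρ + 1))) := by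
  set C := √(fbmConst ρ * ((ρ - 1/2) ^ 2 / (2 - 2 * ρ))) with hC
  have hCnn : 0 ≤ C := sqrt_nonneg _
  have hFC := fbmConst_pos h0 h1
  have hInt : Integrable (fun t : ℝ => t ^ (ρ - 1)) μ01 := by
    have := intervalIntegral.intervalIntegrable_rpow' (a := 0) (b := 1) (r := ρ - 1) (by linarith)
    rw [intervalIntegrable_iff_integrableOn_Ioc_of_le zero_le_one] at this
    unfold μ01
    rwa [← restrict_Ioc_eq_restrict_Icc]
  refine ((isHSKernel_mvnKernel h0 h1).restrict _).exists_finrank_le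
    (K := C * ∫ t, t ^ (ρ - 1) ∂μ01) (q := 1 + ρ) ?_ (by linarith) fun m hm => ?_
  · refine mul_nonneg hCnn (integral_nonneg_of_ae ?_)
    filter_upwards [ae_mem_Ioc_μ01] with t ht using rpow_nonneg ht.1.le _
  have h := IsHSKernel.of_integral_le (μ := μ01) (ν := volume.restrict (Set.Iio 0))
    (measurable_mvnKernel_step ρ m)
    (ae_of_all _ fun t => (integral_sq_mvnKernel_sub h0 h1 _ t).1.restrict)
    (hInt.const_mul (C * (m:ℝ) ^ (-(1 + ρ)))) (by
      filter_upwards [ae_mem_Ioc_μ01] with t ht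
      obtain ⟨h2, h3⟩ := step_sub_mem hm ht.1.le
      set s : ℝ := ⌈(m:ℝ) * t⌉₊ / m with hs
      have b1 := setIntegral_Iio_sq_mvnKernel_sub_le h1 ht.1 (sub_nonneg.1 h2)
      have b2 : ∫ r in Set.Iio 0, (mvnKernel ρ t r - mvnKernel ρ s r) ^ 2 ≤
          fbmConst ρ * (s - t) ^ (2 * ρ) := by
        obtain ⟨hi, hv⟩ := integral_sq_mvnKernel_sub h0 h1 s t
        rw [abs_sub_comm, abs_of_nonneg h2] at hv
        rw [← hv]
        exact setIntegral_le_integral hi (ae_of_all _ fun r => sq_nonneg _)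
      have b0 : 0 ≤ ∫ r in Set.Iio 0, (mvnKernel ρ t r - mvnKernel ρ s r) ^ 2 :=
        integral_nonneg fun r => sq_nonneg _
      generalize ∫ r in Set.Iio 0, (mvnKernel ρ t r - mvnKernel ρ s r) ^ 2 = v at b0 b1 b2
      have b3 : v ≤ C * (s - t) ^ (1 + ρ) * t ^ (ρ - 1) := by
        refine le_of_sq_le_sq ?_ (by have := ht.1; positivity)
        calc v ^ 2 = v * v := sq v
          _ ≤ (fbmConst ρ * (s - t) ^ (2 * ρ)) *
              ((ρ - 1/2) ^ 2 / (2 - 2 * ρ) * (s - t) ^ 2 * t ^ (2 * ρ - 2)) :=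
            mul_le_mul b2 b1 b0 (by positivity)
          _ = _ := by
            have hnn : 0 ≤ fbmConst ρ * ((ρ - 1/2) ^ 2 / (2 - 2 * ρ)) :=
              mul_nonneg hFC.le (div_nonneg (sq_nonneg _) (by linarith))
            have e1 : t ^ (2 * ρ - 2) = (t ^ (ρ - 1)) ^ 2 := by
              rw [← rpow_natCast, ← rpow_mul ht.1.le]; congr 1; push_cast; ring
            have e2 : (s - t) ^ (2 * ρ) * (s - t) ^ 2 = ((s - t) ^ (1 + ρ)) ^ 2 := by
              rw [← rpow_natCast _ 2, ← rpow_natCast _ 2, ← rpow_mul h2,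
                ← rpow_add_of_nonneg h2 (by linarith) (by norm_num)]
              congr 1; push_cast; ring
            rw [mul_pow, mul_pow, hC, sq_sqrt hnn, ← e1, ← e2]; ring
      refine b3.trans ?_
      refine mul_le_mul_of_nonneg_right (mul_le_mul_of_nonneg_left ?_ hCnn) (rpow_nonneg ht.1.le _)
      rw [rpow_neg (by positivity), ← inv_rpow (by positivity)]
      exact rpow_le_rpow h2 h3 (by linarith))
  refine ⟨h.1, h.2.trans_eq ?_⟩
  rw [integral_const_mul]; ring

end MovingAverageCounting

section FractionalIntegration

variable {ρ : ℝ}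

lemma isHSKernel_mvnKernel_μ01 (h0 : 0 < ρ) (h1 : ρ < 1) : IsHSKernel μ01 μ01 (mvnKernel ρ) :=
  (isHSKernel_mvnKernel h0 h1).restrict (Set.Icc 0 1)

lemma IsHSKernel.norm_op_restrict_mono {S R : Type*} [MeasurableSpace S] [MeasurableSpace R]
    {μ : Measure S} {ν : Measure R} [SFinite μ] [SFinite ν] {a : S → R → ℝ}
    (ha : IsHSKernel μ ν a) {s t : Set R} (hst : s ≤ᵐ[ν] t) (f : Lp ℝ 2 μ) :
    ‖(ha.restrict s).op f‖ ^ 2 ≤ ‖(ha.restrict t).op f‖ ^ 2 := by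
  rw [norm_op_sq, norm_op_sq]
  exact setIntegral_mono_set (ha.memLp_integral f).integrable_sq.integrableOn
    (ae_of_all _ fun r => sq_nonneg _) hst

lemma IsHSKernel.norm_op_restrict_le {S R : Type*} [MeasurableSpace S] [MeasurableSpace R]
    {μ : Measure S} {ν : Measure R} [SFinite μ] [SFinite ν] {a : S → R → ℝ}
    (ha : IsHSKernel μ ν a) (s : Set R) (f : Lp ℝ 2 μ) :
    ‖(ha.restrict s).op f‖ ^ 2 ≤ ‖ha.op f‖ ^ 2 := by
  rw [norm_op_sq, norm_op_sq]
  exact setIntegral_le_integral (ha.memLp_integral f).integrable_sq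
    (ae_of_all _ fun r => sq_nonneg _)

lemma mvnKernel_of_pos {t r : ℝ} (hr : 0 < r) : mvnKernel ρ t r = truncPow (ρ - 1/2) (t - r) := by
  rw [mvnKernel, truncPow_of_nonpos (x := -r) (by linarith), sub_zero]

lemma integral_truncPow_mul_truncPow {α r x : ℝ} (h1 : -1 < α) (h2 : α < 1) (hr : 0 < r)
    (hx : x ≤ 1) :
    ∫ t, truncPow α (t - r) * truncPow (-α) (x - t) ∂μ01 = beta (α + 1) (1 - α) * truncPow 1 (x - r) := by
  rcases le_or_gt x r with hxr | hxr
  · rw [truncPow_of_nonpos (by linarith), mul_zero]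
    refine integral_eq_zero_of_ae (ae_of_all _ fun t => ?_)
    rcases le_or_gt t r with h | h
    · simp [truncPow_of_nonpos (sub_nonpos.2 h)]
    · simp [truncPow_of_nonpos (show x - t ≤ 0 by linarith)]
  · have e1 : ∫ t, truncPow α (t - r) * truncPow (-α) (x - t) ∂μ01 =
        ∫ t in r..x, (t - r) ^ α * (x - t) ^ (-α) := by
      rw [intervalIntegral.integral_of_le hxr.le, integral_Ioc_eq_integral_Ioo, μ01,
        setIntegral_eq_of_subset_of_forall_sdiff_eq_zero measurableSet_Icc
          (s := Set.Ioo r x) (fun t ht => ⟨by linarith [ht.1], by linarith [ht.2]⟩)]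
      · refine setIntegral_congr_fun measurableSet_Ioo fun t ht => ?_
        rw [truncPow_of_pos (by linarith [ht.1]), truncPow_of_pos (by linarith [ht.2])]
      · rintro t ⟨_, ht⟩
        rcases le_or_gt t r with h | h
        · simp [truncPow_of_nonpos (sub_nonpos.2 h)]
        · have : x ≤ t := not_lt.1 fun h' => ht ⟨h, h'⟩
          simp [truncPow_of_nonpos (show x - t ≤ 0 by linarith)]
    have hh : 0 < x - r := by linarith
    have e2 := intervalIntegral.smul_integral_comp_add_mul (a := 0) (b := 1)
      (fun t => (t - r) ^ α * (x - t) ^ (-α)) (x - r) r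
    rw [mul_zero, mul_one, add_zero, add_sub_cancel] at e2
    rw [e1, ← e2, truncPow_of_pos hh, rpow_one, smul_eq_mul, mul_comm,
      ← integral_beta (by linarith) (by linarith), intervalIntegral.integral_of_le zero_le_one,
      integral_Ioc_eq_integral_Ioo]
    congr 1
    refine setIntegral_congr_fun measurableSet_Ioo fun t ht => ?_
    have e3 : r + (x - r) * t - r = (x - r) * t := by ring
    have e4 : x - (r + (x - r) * t) = (x - r) * (1 - t) := by ring
    rw [e3, e4, mul_rpow hh.le ht.1.le, mul_rpow hh.le (by linarith [ht.2]), rpow_neg hh.le,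
      show α + 1 - 1 = α by ring, show 1 - α - 1 = -α by ring]
    have := (rpow_pos_of_pos hh α).ne'
    field_simp

lemma op_op_mvnKernel (h0 : 0 < ρ) (h1 : ρ < 1) (g : Lp ℝ 2 μ01) :
    (isHSKernel_mvnKernel_μ01 h0 h1).op
      ((isHSKernel_mvnKernel_μ01 (sub_pos.2 h1) (sub_lt_self 1 h0)).op g) =ᵐ[μ01]
      fun r => beta (ρ + 1/2) (3/2 - ρ) * ∫ x, g x * truncPow 1 (x - r) ∂μ01 := by
  set ha := isHSKernel_mvnKernel_μ01 h0 h1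
  set hb := isHSKernel_mvnKernel_μ01 (sub_pos.2 h1) (sub_lt_self 1 h0)
  filter_upwards [ha.coeFn_op (hb.op g), ha.ae_memLp_left, ae_mem_Ioc_μ01] with r hr hm hr0
  rw [hr]
  calc ∫ t, hb.op g t * mvnKernel ρ t r ∂μ01
      = ∫ t, mvnKernel ρ t r * ∫ x, g x * mvnKernel (1 - ρ) x t ∂μ01 ∂μ01 := by
        refine integral_congr_ae ?_
        filter_upwards [hb.coeFn_op g] with t ht
        rw [ht, mul_comm]
    _ = ∫ x, g x * ∫ t, mvnKernel ρ t r * mvnKernel (1 - ρ) x t ∂μ01 ∂μ01 :=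
        hb.integral_swap (Lp.memLp g) hm
    _ = ∫ x, beta (ρ + 1/2) (3/2 - ρ) * (g x * truncPow 1 (x - r)) ∂μ01 := by
        refine integral_congr_ae ?_
        filter_upwards [ae_mem_Ioc_μ01] with x hx
        have := integral_truncPow_mul_truncPow (α := ρ - 1/2) (by linarith) (by linarith) hr0.1 hx.2
        rw [show ρ - 1/2 + 1 = ρ + 1/2 by ring, show 1 - (ρ - 1/2) = 3/2 - ρ by ring] at this
        rw [mul_left_comm, ← this]
        congr 1
        refine integral_congr_ae ?_
        filter_upwards [ae_mem_Ioc_μ01] with t ht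
        rw [mvnKernel_of_pos hr0.1, mvnKernel_of_pos ht.1, show 1 - ρ - 1/2 = -(ρ - 1/2) by ring]
    _ = _ := integral_const_mul _ _

end FractionalIntegration

section Sines

lemma memLp_μ01_of_continuous {f : ℝ → ℝ} (hf : Continuous f) : MemLp f 2 μ01 :=
  (memLp_two_iff_integrable_sq hf.aestronglyMeasurable).2 (hf.pow 2).integrableOn_Icc

lemma integral_cos_int_mul_pi (m : ℤ) : ∫ t in (0:ℝ)..1, cos (m * π * t) = if m = 0 then 1 else 0 := by
  split_ifs with hm
  · simp [hm]
  · have : (m * π : ℝ) ≠ 0 := mul_ne_zero (by exact_mod_cast hm) pi_ne_zero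
    rw [intervalIntegral.integral_comp_mul_left _ this, integral_cos]
    simp [sin_int_mul_pi]

/-- The normalised sines `√2 sin ((k + 1) π t)` as elements of `L²[0,1]`. -/
noncomputable def sineLp (k : ℕ) : Lp ℝ 2 μ01 :=
  (memLp_μ01_of_continuous (f := fun t => √2 * sin ((k + 1) * π * t)) (by fun_prop)).toLp _

lemma coeFn_sineLp (k : ℕ) : sineLp k =ᵐ[μ01] fun t => √2 * sin ((k + 1) * π * t) :=
  MemLp.coeFn_toLp _

lemma orthonormal_sineLp : Orthonormal ℝ sineLp := by
  rw [orthonormal_iff_ite]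
  intro j k
  have h1 : ∫ t, sineLp j t * sineLp k t ∂μ01 =
      ∫ t in (0:ℝ)..1, (cos (((j - k : ℤ) : ℝ) * π * t) - cos (((j + k + 2 : ℤ) : ℝ) * π * t)) := by
    rw [intervalIntegral_eq_μ01]
    refine integral_congr_ae ?_
    filter_upwards [coeFn_sineLp j, coeFn_sineLp k] with t hj hk
    rw [hj, hk]
    push_cast
    have e1 : ((j:ℝ) - k) * π * t = (j + 1) * π * t - (k + 1) * π * t := by ring
    have e2 : ((j:ℝ) + k + 2) * π * t = (j + 1) * π * t + (k + 1) * π * t := by ring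
    rw [e1, e2, cos_sub, cos_add]
    have := mul_self_sqrt (zero_le_two (α := ℝ))
    linear_combination (sin ((j + 1) * π * t) * sin ((k + 1) * π * t)) * this
  rw [inner_Lp_two, h1, intervalIntegral.integral_sub (Continuous.intervalIntegrable (by fun_prop) _ _)
    (Continuous.intervalIntegrable (by fun_prop) _ _), integral_cos_int_mul_pi,
    integral_cos_int_mul_pi, if_neg (by omega : ¬ (j + k + 2 : ℤ) = 0), sub_zero]
  simp [sub_eq_zero]

lemma integral_sub_mul_sin {κ r : ℝ} (hκ : κ ≠ 0) :
    ∫ x in r..1, (x - r) * sin (κ * x) =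
      -((1 - r) * cos κ / κ) + sin κ / κ ^ 2 - sin (κ * r) / κ ^ 2 := by
  have hd : ∀ x, HasDerivAt (fun x => -((x - r) * cos (κ * x) / κ) + sin (κ * x) / κ ^ 2)
      ((x - r) * sin (κ * x)) x := fun x => by
    have hl : HasDerivAt (fun x => κ * x) κ x := by simpa using (hasDerivAt_id x).const_mul κ
    have h1 := ((((hasDerivAt_id x).sub_const r).mul hl.cos).div_const κ).neg
    have h2 := hl.sin.div_const (κ ^ 2)
    refine (h1.add h2).congr_deriv ?_
    simp only [id]
    field_simp
    ring
  rw [intervalIntegral.integral_eq_sub_of_hasDerivAt (fun x _ => hd x)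
    (Continuous.intervalIntegrable (by fun_prop) _ _)]
  simp

lemma integral_sineLp_mul_truncPow (k : ℕ) {r : ℝ} (hr : r ∈ Set.Ioc (0:ℝ) 1) :
    ∫ x, sineLp k x * truncPow 1 (x - r) ∂μ01 =
      -(cos ((k + 1) * π) / ((k + 1) * π)) * (√2 * (1 - r)) -
        (((k + 1) * π) ^ 2)⁻¹ * (√2 * sin ((k + 1) * π * r)) := by
  have hκ : ((k:ℝ) + 1) * π ≠ 0 := by positivity
  have h1 : ∫ x, sineLp k x * truncPow 1 (x - r) ∂μ01 =
      √2 * ∫ x in r..1, (x - r) * sin ((k + 1) * π * x) := by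
    have h2 : ∫ x, sineLp k x * truncPow 1 (x - r) ∂μ01 =
        ∫ x, √2 * sin ((k + 1) * π * x) * truncPow 1 (x - r) ∂μ01 := by
      refine integral_congr_ae ?_
      filter_upwards [coeFn_sineLp k] with x hx
      rw [hx]
    rw [h2, ← intervalIntegral.integral_const_mul, intervalIntegral.integral_of_le hr.2, μ01,
      setIntegral_eq_of_subset_of_forall_sdiff_eq_zero measurableSet_Icc
        (s := Set.Ioc r 1) (fun x hx => ⟨by linarith [hx.1, hr.1], hx.2⟩)]
    · refine setIntegral_congr_fun measurableSet_Ioc fun x hx => ?_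
      rw [truncPow_of_pos (by linarith [hx.1]), rpow_one]
      ring
    · rintro x ⟨hx, hx'⟩
      have : x ≤ r := not_lt.1 fun h => hx' ⟨h, hx.2⟩
      simp [truncPow_of_nonpos (sub_nonpos.2 this)]
  have hs : sin ((k + 1) * π) = 0 := by exact_mod_cast sin_nat_mul_pi (k + 1)
  rw [h1, integral_sub_mul_sin hκ, hs]
  ring

end Sines

section AbstractLowerBound

variable {H : Type*} [NormedAddCommGroup H] [InnerProductSpace ℝ H]

lemma exists_submodule_of_diagonal_add_rankOne {S V : H →ₗ[ℝ] H} {N : ℕ} {e : Fin N → H}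
    (he : Orthonormal ℝ e) {L : H} {w d : Fin N → ℝ} {d₀ u : ℝ} {M : ℕ} (hd₀ : 0 < d₀)
    (hd : ∀ k, d₀ ≤ |d k|) (hVS : ∀ k, V (S (e k)) = w k • L + d k • e k)
    (hM : ∀ E : Submodule ℝ H, FiniteDimensional ℝ E → (∀ f ∈ E, f ≠ 0 → u * ‖f‖ ^ 2 < ‖S f‖ ^ 2) →
      Module.finrank ℝ E ≤ M) :
    ∃ F : Submodule ℝ H, FiniteDimensional ℝ F ∧ N ≤ Module.finrank ℝ F + 1 + M ∧
      ∀ f ∈ F, d₀ ^ 2 * ‖f‖ ^ 2 ≤ u * ‖V f‖ ^ 2 := by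
  let T : EuclideanSpace ℝ (Fin N) →ₗ[ℝ] H :=
    (Fintype.linearCombination ℝ e) ∘ₗ (WithLp.linearEquiv 2 ℝ (Fin N → ℝ)).toLinearMap
  have hT : ∀ c, T c = ∑ k, c k • e k := fun c => rfl
  have hsum : ∀ c : Fin N → ℝ, ‖∑ k, c k • e k‖ ^ 2 = ∑ k, c k ^ 2 := fun c => by
    rw [← real_inner_self_eq_norm_sq, he.inner_sum]
    simp [sq]
  have hTn : ∀ c, ‖T c‖ ^ 2 = ‖c‖ ^ 2 := fun c => by
    rw [hT, hsum, EuclideanSpace.norm_sq_eq]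
    simp
  have hTi : Function.Injective T := by
    rw [← LinearMap.ker_eq_bot, LinearMap.ker_eq_bot']
    intro c hc
    have := hTn c
    rw [hc, norm_zero] at this
    simpa using this.symm
  let B : EuclideanSpace ℝ (Fin N) →ₗ[ℝ] EuclideanSpace ℝ (Fin N) →ₗ[ℝ] ℝ :=
    (innerₗ H).compl₁₂ (S ∘ₗ T) (S ∘ₗ T)
  have hB : ∀ f g, B f g = ⟪S (T f), S (T g)⟫ := fun f g => rfl
  obtain ⟨b, v, hbv⟩ := exists_orthonormalBasis_diagonal B
    (fun f g => by rw [hB, hB, real_inner_comm]) (fun f => by rw [hB]; exact real_inner_self_nonneg)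
  have hQ : ∀ c, ‖S (T c)‖ ^ 2 = ∑ k, (v k : ℝ) * ⟪b k, c⟫ ^ 2 := fun c => by
    rw [← real_inner_self_eq_norm_sq, ← hB]
    conv_lhs => rw [← b.sum_repr' c]
    simp only [map_sum, map_smul, LinearMap.sum_apply, LinearMap.smul_apply, hbv, smul_eq_mul,
      mul_ite, mul_zero, Finset.sum_ite_eq', Finset.mem_univ, if_true]
    exact Finset.sum_congr rfl fun k _ => by ring
  obtain ⟨N₁, hN₁, hN₁'⟩ := exists_submodule_le b v hQ u
  obtain ⟨E, hE, hE'⟩ := exists_submodule_lt b v hQ u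
  have hcount : countAbove v u ≤ M := by
    have h := hM (E.map T) inferInstance (by
      rintro _ ⟨c, hc, rfl⟩ h0
      rw [hTn]
      exact hE' c hc (by rintro rfl; simp at h0))
    rwa [(Submodule.equivMapOfInjective T hTi E).finrank_eq.symm, hE] at h
  let φ : EuclideanSpace ℝ (Fin N) →ₗ[ℝ] ℝ :=
    (Fintype.linearCombination ℝ w) ∘ₗ (WithLp.linearEquiv 2 ℝ (Fin N → ℝ)).toLinearMap
  have hφ : ∀ c, φ c = ∑ k, c k * w k := fun c => rfl
  have hker : N ≤ Module.finrank ℝ (LinearMap.ker φ) + 1 := by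
    have h1 := LinearMap.finrank_range_add_finrank_ker φ
    have h2 := Submodule.finrank_le (LinearMap.range φ)
    rw [Module.finrank_self] at h2
    rw [finrank_euclideanSpace_fin] at h1
    omega
  have hinf := finrank_add_finrank_le_add_inf N₁ (LinearMap.ker φ)
  have hN := finrank_euclideanSpace_fin (𝕜 := ℝ) (n := N)
  have hlow : ∀ c ∈ N₁ ⊓ LinearMap.ker φ, d₀ ^ 2 * ‖c‖ ^ 2 ≤ ‖V (S (T c))‖ ^ 2 := by
    rintro c ⟨-, hc⟩
    have hc0 : ∑ k, c k * w k = 0 := hc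
    have h1 : V (S (T c)) = ∑ k, (c k * d k) • e k := by
      rw [hT]
      simp only [map_sum, map_smul, hVS, smul_add, smul_smul, Finset.sum_add_distrib]
      rw [← Finset.sum_smul, hc0, zero_smul, zero_add]
    rw [h1, hsum, EuclideanSpace.norm_sq_eq, Finset.mul_sum]
    refine Finset.sum_le_sum fun k _ => ?_
    rw [Real.norm_eq_abs, sq_abs, mul_pow, mul_comm, ← sq_abs (d k)]
    have := hd k
    gcongr
  have hinj : Set.InjOn (S ∘ₗ T) (N₁ ⊓ LinearMap.ker φ : Submodule ℝ _) := by
    intro c hc c' hc' h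
    have h1 := hlow (c - c') (Submodule.sub_mem _ hc hc')
    have h2 : S (T (c - c')) = 0 := by
      rw [map_sub, map_sub, sub_eq_zero]; exact h
    rw [h2, map_zero, norm_zero] at h1
    have h3 : ‖c - c'‖ ^ 2 ≤ 0 := by
      by_contra! h4
      have := mul_pos (pow_pos hd₀ 2) h4
      norm_num at h1
      linarith
    rw [← sub_eq_zero, ← norm_eq_zero]
    exact pow_eq_zero_iff (two_ne_zero) |>.1 (le_antisymm h3 (sq_nonneg _))
  refine ⟨(N₁ ⊓ LinearMap.ker φ).map (S ∘ₗ T), inferInstance, ?_, ?_⟩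
  · have h1 : Module.finrank ℝ ((N₁ ⊓ LinearMap.ker φ).map (S ∘ₗ T)) =
        Module.finrank ℝ (N₁ ⊓ LinearMap.ker φ : Submodule ℝ _) := by
      rw [← LinearMap.range_domRestrict]
      refine LinearMap.finrank_range_of_inj fun x y h => Subtype.ext (hinj x.2 y.2 h)
    omega
  · rintro _ ⟨c, hc, rfl⟩
    have h1 := hlow c hc
    have h2 := hN₁' c hc.1
    have hu : 0 ≤ u ∨ u < 0 := le_or_gt 0 u
    rw [LinearMap.comp_apply]
    rcases hu with hu | hu
    · nlinarith [sq_nonneg d₀]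
    · have : ‖S (T c)‖ ^ 2 ≤ 0 := h2.trans (mul_nonpos_of_nonpos_of_nonneg hu.le (sq_nonneg _))
      have h3 : S (T c) = 0 := by
        rw [← norm_eq_zero]
        exact pow_eq_zero_iff (two_ne_zero) |>.1 (le_antisymm this (sq_nonneg _))
      simp [h3]

end AbstractLowerBound

section LowerCounting

variable {ρ : ℝ}

lemma op_op_sineLp (h0 : 0 < ρ) (h1 : ρ < 1) (k : ℕ) :
    (isHSKernel_mvnKernel_μ01 h0 h1).op
      ((isHSKernel_mvnKernel_μ01 (sub_pos.2 h1) (sub_lt_self 1 h0)).op (sineLp k)) =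
      (-(beta (ρ + 1/2) (3/2 - ρ) * (cos ((k + 1) * π) / ((k + 1) * π)))) •
        (memLp_μ01_of_continuous (f := fun r => √2 * (1 - r)) (by fun_prop)).toLp _ +
      (-(beta (ρ + 1/2) (3/2 - ρ) * (((k + 1) * π) ^ 2)⁻¹)) • sineLp k := by
  refine Lp.ext ?_
  filter_upwards [op_op_mvnKernel h0 h1 (sineLp k), ae_mem_Ioc_μ01, coeFn_sineLp k,
    (memLp_μ01_of_continuous (f := fun r => √2 * (1 - r)) (by fun_prop)).coeFn_toLp,
    Lp.coeFn_add ((-(beta (ρ + 1/2) (3/2 - ρ) * (cos ((k + 1) * π) / ((k + 1) * π)))) •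
        (memLp_μ01_of_continuous (f := fun r => √2 * (1 - r)) (by fun_prop)).toLp _)
      ((-(beta (ρ + 1/2) (3/2 - ρ) * (((k + 1) * π) ^ 2)⁻¹)) • sineLp k),
    Lp.coeFn_smul (-(beta (ρ + 1/2) (3/2 - ρ) * (cos ((k + 1) * π) / ((k + 1) * π))))
      ((memLp_μ01_of_continuous (f := fun r => √2 * (1 - r)) (by fun_prop)).toLp _),
    Lp.coeFn_smul (-(beta (ρ + 1/2) (3/2 - ρ) * (((k + 1) * π) ^ 2)⁻¹)) (sineLp k)]
    with r e1 hr e2 e3 e4 e5 e6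
  rw [e1, e4, Pi.add_apply, e5, e6, Pi.smul_apply, Pi.smul_apply, e2, e3,
    integral_sineLp_mul_truncPow k hr, smul_eq_mul, smul_eq_mul]
  ring

lemma exists_submodule_lt_norm_op_mvnKernel (h0 : 0 < ρ) (h1 : ρ < 1) :
    ∃ c : ℝ, 0 < c ∧ ∀ r : ℕ, 0 < r → ∃ F : Submodule ℝ (Lp ℝ 2 μ01), FiniteDimensional ℝ F ∧
      r ≤ Module.finrank ℝ F ∧ ∀ f ∈ F, f ≠ 0 →
        c * (r:ℝ) ^ (-(2 * ρ + 1)) * ‖f‖ ^ 2 < ‖(isHSKernel_mvnKernel_μ01 h0 h1).op f‖ ^ 2 := by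
  obtain ⟨D, hD, hcount⟩ := exists_finrank_le_mvnKernel (sub_pos.2 h1) (sub_lt_self 1 h0)
  have hB : 0 < beta (ρ + 1/2) (3/2 - ρ) := beta_pos (by linarith) (by linarith)
  set b := beta (ρ + 1/2) (3/2 - ρ) with hb
  have hq : (0:ℝ) < 2 * (1 - ρ) + 1 := by linarith
  refine ⟨(b / (3 * π) ^ 2) ^ 2 * D ^ (-(2 * (1 - ρ) + 1)) / 2, by positivity, fun r hr => ?_⟩
  have hr' : (1:ℝ) ≤ r := by exact_mod_cast hr
  have hr0 : (0:ℝ) < r := by linarith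
  have hu : 0 < ((r:ℝ) / D) ^ (-(2 * (1 - ρ) + 1)) := by positivity
  obtain ⟨F, hF, hrF, hlow⟩ := exists_submodule_of_diagonal_add_rankOne
    (S := (isHSKernel_mvnKernel_μ01 (sub_pos.2 h1) (sub_lt_self 1 h0)).op)
    (V := (isHSKernel_mvnKernel_μ01 h0 h1).op) (N := 2 * r + 1) (e := fun k => sineLp k)
    (d := fun k => -(b * ((((k:ℕ) + 1) * π) ^ 2)⁻¹)) (d₀ := b / (3 * r * π) ^ 2)
    (u := ((r:ℝ) / D) ^ (-(2 * (1 - ρ) + 1))) (M := r)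
    (orthonormal_sineLp.comp _ Fin.val_injective) (by positivity) (fun k => by
      have hk : ((k:ℕ) : ℝ) + 1 ≤ 3 * r := by
        have := k.2
        exact_mod_cast (by omega : (k:ℕ) + 1 ≤ 3 * r)
      rw [abs_neg, abs_of_pos (by positivity), div_eq_mul_inv]
      gcongr)
    (fun k => op_op_sineLp h0 h1 k) (fun E hE h => by
      have h2 := hcount _ hu E hE fun f hf hf0 => (h f hf hf0).trans_le
        ((isHSKernel_mvnKernel (sub_pos.2 h1) (sub_lt_self 1 h0)).norm_op_restrict_le _ f)
      rw [← rpow_mul (by positivity), show -(2 * (1 - ρ) + 1) * -(1 / (2 * (1 - ρ) + 1)) = 1 by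
        field_simp, rpow_one, mul_div_cancel₀ _ hD.ne'] at h2
      exact_mod_cast h2)
  refine ⟨F, hF, by omega, fun f hf hf0 => ?_⟩
  have h2 := hlow f hf
  have h3 : 0 < ‖f‖ ^ 2 := by positivity
  have h4 : (b / (3 * π) ^ 2) ^ 2 * D ^ (-(2 * (1 - ρ) + 1)) * (r:ℝ) ^ (-(2 * ρ + 1)) *
      ((r:ℝ) / D) ^ (-(2 * (1 - ρ) + 1)) = (b / (3 * r * π) ^ 2) ^ 2 := by
    rw [div_rpow hr0.le hD.le, mul_assoc, mul_assoc, mul_div_assoc', ← rpow_add hr0,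
      mul_div_assoc', mul_div_cancel_left₀ _ (by positivity),
      show -(2 * ρ + 1) + -(2 * (1 - ρ) + 1) = -((4:ℕ):ℝ) by push_cast; ring, rpow_neg hr0.le,
      rpow_natCast]
    field_simp
  rw [← h4] at h2
  have h5 : (b / (3 * π) ^ 2) ^ 2 * D ^ (-(2 * (1 - ρ) + 1)) * (r:ℝ) ^ (-(2 * ρ + 1)) * ‖f‖ ^ 2 ≤
      ‖(isHSKernel_mvnKernel_μ01 h0 h1).op f‖ ^ 2 := by
    refine le_of_mul_le_mul_left ?_ hu
    refine le_trans (le_of_eq ?_) h2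
    ring
  have h6 : 0 < (b / (3 * π) ^ 2) ^ 2 * D ^ (-(2 * (1 - ρ) + 1)) * (r:ℝ) ^ (-(2 * ρ + 1)) * ‖f‖ ^ 2 := by
    positivity
  refine lt_of_lt_of_le ?_ h5
  calc _ = (b / (3 * π) ^ 2) ^ 2 * D ^ (-(2 * (1 - ρ) + 1)) * (r:ℝ) ^ (-(2 * ρ + 1)) * ‖f‖ ^ 2 / 2 := by
        ring
    _ < _ := half_lt_self h6

end LowerCounting

section QuantizationError

variable {H : Type*} [NormedAddCommGroup H] [InnerProductSpace ℝ H]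
  {Ω : Type*} [MeasurableSpace Ω] {P : Measure Ω} {A B : Ω → H} {n : ℕ}

lemma quantErr_eq (P : Measure Ω) (A : Ω → H) (n : ℕ) :
    quantErr P A n = sInf {r : ℝ | ∃ α : Finset H, α.Nonempty ∧ α.card ≤ n ∧
      r = √(distortion P A α)} := by
  simp_rw [sqrt_eq_rpow]
  rfl

lemma quantErr_nonneg (P : Measure Ω) (A : Ω → H) (n : ℕ) : 0 ≤ quantErr P A n := by
  rw [quantErr_eq]
  exact Real.sInf_nonneg (by rintro _ ⟨α, -, -, rfl⟩; exact sqrt_nonneg _)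

lemma quantErr_le {α : Finset H} (hα : α.Nonempty) (hn : α.card ≤ n) :
    quantErr P A n ≤ √(distortion P A α) := by
  rw [quantErr_eq]
  exact csInf_le ⟨0, by rintro _ ⟨α, -, -, rfl⟩; exact sqrt_nonneg _⟩ ⟨α, hα, hn, rfl⟩

lemma le_quantErr (hn : 0 < n) {c : ℝ}
    (h : ∀ α : Finset H, α.Nonempty → α.card ≤ n → c ≤ √(distortion P A α)) :
    c ≤ quantErr P A n := by
  rw [quantErr_eq]
  refine le_csInf ⟨_, {0}, Finset.singleton_nonempty _, by rwa [Finset.card_singleton], rfl⟩ ?_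
  rintro _ ⟨α, h1, h2, rfl⟩
  exact h α h1 h2

lemma quantErr_le_of_distortion_le (hn : 0 < n) {δ : ℝ} (hδ : 0 < δ)
    (h : ∀ α' : Finset H, α'.Nonempty → α'.card ≤ n → ∀ ε > 0,
      ∃ α : Finset H, α.Nonempty ∧ α.card ≤ n ∧
        distortion P A α ≤ (1 + δ) * distortion P B α' + ε) :
    quantErr P A n ≤ (1 + δ) * quantErr P B n := by
  rw [← div_le_iff₀' (by linarith)]
  refine le_quantErr hn fun α' hα' hc' => ?_
  rw [div_le_iff₀' (by linarith)]
  have h1 : quantErr P A n ^ 2 ≤ (1 + δ) * distortion P B α' := by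
    refine le_of_forall_pos_le_add fun ε hε => ?_
    obtain ⟨α, hα, hc, hle⟩ := h α' hα' hc' ε hε
    refine le_trans ?_ hle
    rw [← sq_sqrt (distortion_nonneg (P := P) (A := A) α)]
    exact pow_le_pow_left₀ (quantErr_nonneg P A n) (quantErr_le hα hc) 2
  refine (sq_le_sq₀ (quantErr_nonneg P A n) (by positivity)).1 ?_
  rw [mul_pow, sq_sqrt (distortion_nonneg _)]
  refine h1.trans (mul_le_mul_of_nonneg_right ?_ (distortion_nonneg _))
  nlinarith

lemma quantErr_const_smul_le {c : ℝ} (hc : 0 < c) (hn : 0 < n) :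
    quantErr P (fun ω => c • A ω) n ≤ c * quantErr P A n := by
  classical
  rw [← div_le_iff₀' hc]
  refine le_quantErr hn fun α hα hcard => ?_
  rw [div_le_iff₀' hc]
  refine (quantErr_le (hα.image (c • ·)) (Finset.card_image_le.trans hcard)).trans_eq ?_
  have h : distortion P (fun ω => c • A ω) (α.image (c • ·)) = c ^ 2 * distortion P A α := by
    rw [distortion, distortion, ← integral_const_mul]
    congr 1
    ext ω
    rw [Finset.coe_image, Set.image_image, ← smul_eq_mul, ← Real.sInf_smul_of_nonneg (sq_nonneg c)]
    congr 1
    rw [← Set.image_smul, Set.image_image]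
    refine Set.image_congr fun a _ => ?_
    rw [← smul_sub, norm_smul, mul_pow, Real.norm_eq_abs, sq_abs, smul_eq_mul]
  rw [h, sqrt_mul (sq_nonneg c), sqrt_sq hc.le]

lemma quantErr_const_smul {c : ℝ} (hc : 0 < c) (hn : 0 < n) :
    quantErr P (fun ω => c • A ω) n = c * quantErr P A n := by
  refine le_antisymm (quantErr_const_smul_le hc hn) ?_
  have h := quantErr_const_smul_le (P := P) (A := fun ω => c • A ω) (inv_pos.2 hc) hn
  simp only [inv_smul_smul₀ hc.ne'] at h
  rwa [inv_mul_eq_div, le_div_iff₀' hc] at h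

lemma IsCenteredGaussian.quantErr_pos [IsProbabilityMeasure P] (hA : IsCenteredGaussian P A)
    (hn : 0 < n) {f : H} (hf : 0 < ∫ ω, ⟪f, A ω⟫ ^ 2 ∂P) : 0 < quantErr P A n := by
  obtain ⟨e, v, hQ, hlaw⟩ := hA.exists_diagGaussian (Submodule.span ℝ {f})
  obtain ⟨k, hk⟩ : ∃ k, 0 < v k := by
    by_contra! h
    have h1 := hQ ⟨f, Submodule.mem_span_singleton_self f⟩
    have h2 : ∀ k, v k = 0 := fun k => nonpos_iff_eq_zero.1 (h k)
    simp only [h2, NNReal.coe_zero, zero_mul, Finset.sum_const_zero] at h1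
    exact hf.ne' h1
  have hk' : (0:ℝ) < v k := by exact_mod_cast hk
  have hn' : (0:ℝ) < n := by exact_mod_cast hn
  set θ : ℝ := v k / n ^ 2 with hθ
  have hθ0 : 0 < θ := by positivity
  have hθk : θ ≤ v k := div_le_self hk'.le (one_le_pow₀ (by exact_mod_cast hn))
  have hdist : θ ≤ waterDist v θ := by
    refine le_trans ?_ (Finset.single_le_sum (f := fun j => min (v j : ℝ) θ)
      (fun j _ => le_min (v j).coe_nonneg hθ0.le) (Finset.mem_univ k))
    simp [hθk]
  have hrate : Real.log n ≤ waterRate v θ := by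
    have h1 := Finset.single_le_sum (f := fun j => max 0 (Real.log (v j / θ)))
      (fun j _ => le_max_left _ _) (Finset.mem_univ k)
    have h2 : Real.log (v k / θ) = 2 * Real.log n := by
      rw [hθ, div_div_cancel₀ hk'.ne', Real.log_pow]
      norm_num
    have h3 := le_max_right 0 (Real.log (v k / θ))
    rw [waterRate]
    linarith
  refine (sqrt_pos.2 hθ0).trans_le (le_quantErr hn fun α hα hcard => sqrt_le_sqrt ?_)
  obtain ⟨α', hα', hcard', hle⟩ := hA.exists_code_projection e hlaw hα
  have h1 := diagGaussian_quantization_lower v hθ0 hα'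
  have h2 : Real.log α'.card ≤ Real.log n :=
    Real.log_le_log (by exact_mod_cast hα'.card_pos) (by exact_mod_cast hcard'.trans hcard)
  have h3 : 0 ≤ 2 * θ * (waterRate v θ - Real.log α'.card) :=
    mul_nonneg (by positivity) (by linarith)
  linarith

end QuantizationError

section Comparison

variable {H : Type*} [NormedAddCommGroup H] [InnerProductSpace ℝ H]
  {Ω : Type*} [MeasurableSpace Ω] {P : Measure Ω} {A B : Ω → H}

lemma tendsto_div_of_le_of_le {a b : ℕ → ℝ} (ha : ∀ᶠ n in atTop, 0 < a n)
    (hb : ∀ᶠ n in atTop, 0 < b n)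
    (hab : ∀ δ > 0, δ ≤ 1 → ∀ᶠ n in atTop, a n ≤ (1 + δ) * b n)
    (hba : ∀ δ > 0, δ ≤ 1 → ∀ᶠ n in atTop, b n ≤ (1 + δ) * a n) :
    Tendsto (fun n => a n / b n) atTop (nhds 1) := by
  rw [Metric.tendsto_nhds]
  intro ε hε
  have hδ : 0 < min 1 (ε / 2) := by positivity
  have h1 : min 1 (ε / 2) < ε := (min_le_right _ _).trans_lt (half_lt_self hε)
  filter_upwards [ha, hb, hab _ hδ (min_le_left _ _), hba _ hδ (min_le_left _ _)]
    with n ha hb hab hba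
  set δ := min 1 (ε / 2)
  rw [Real.dist_eq, abs_sub_lt_iff]
  have h2 : a n / b n ≤ 1 + δ := (div_le_iff₀ hb).2 hab
  have h3 : 1 - δ ≤ a n / b n := by
    rw [le_div_iff₀ hb]
    have : (1 - δ) * b n ≤ (1 - δ) * ((1 + δ) * a n) :=
      mul_le_mul_of_nonneg_left hba (by linarith [min_le_left 1 (ε / 2)])
    nlinarith [mul_nonneg (sq_nonneg δ) ha.le]
  constructor <;> linarith

/-- Gaussian vectors whose covariance operators differ by an operator with faster decaying
eigenvalues have asymptotically equivalent quantization errors. -/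
theorem IsCenteredGaussian.tendsto_quantErr_div [IsProbabilityMeasure P]
    [TopologicalSpace.SeparableSpace H]
    (hA : IsCenteredGaussian P A) (hB : IsCenteredGaussian P B)
    {β γ C c D : ℝ} (hγ : 0 < γ) (hγβ : γ < β) (hβ : β < 1) (hC : 0 < C) (hc : 0 < c)
    (hle : ∀ f, ∫ ω, ⟪f, A ω⟫ ^ 2 ∂P ≤ ∫ ω, ⟪f, B ω⟫ ^ 2 ∂P)
    (hdiff : ∀ u > 0, ∀ E : Submodule ℝ H, FiniteDimensional ℝ E →
      (∀ f ∈ E, f ≠ 0 → u * ‖f‖ ^ 2 < (∫ ω, ⟪f, B ω⟫ ^ 2 ∂P) - ∫ ω, ⟪f, A ω⟫ ^ 2 ∂P) →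
        (Module.finrank ℝ E : ℝ) ≤ D * u ^ (-γ))
    (hup : ∀ u > 0, ∀ E : Submodule ℝ H, FiniteDimensional ℝ E →
      (∀ f ∈ E, f ≠ 0 → u * ‖f‖ ^ 2 < ∫ ω, ⟪f, B ω⟫ ^ 2 ∂P) →
        (Module.finrank ℝ E : ℝ) ≤ C * u ^ (-β))
    (hlow : ∀ r : ℕ, 0 < r → ∃ F : Submodule ℝ H, FiniteDimensional ℝ F ∧ r ≤ Module.finrank ℝ F ∧
      ∀ f ∈ F, f ≠ 0 → c * (r : ℝ) ^ (-(1 / β)) * ‖f‖ ^ 2 < ∫ ω, ⟪f, A ω⟫ ^ 2 ∂P) :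
    Tendsto (fun n => quantErr P A n / quantErr P B n) atTop (nhds 1) := by
  obtain ⟨f, hfA⟩ : ∃ f, 0 < ∫ ω, ⟪f, A ω⟫ ^ 2 ∂P := by
    obtain ⟨F, _, hF, hlow⟩ := hlow 1 one_pos
    have : Nontrivial F := Module.finrank_pos_iff.1 hF
    obtain ⟨f, hf⟩ := exists_ne (0 : F)
    refine ⟨f, lt_trans ?_ (hlow f f.2 (by simpa using hf))⟩
    have : 0 < ‖(f : H)‖ := norm_pos_iff.2 (by simpa using hf)
    positivity
  refine tendsto_div_of_le_of_le ?_ ?_ (fun δ hδ hδ1 => ?_) (fun δ hδ hδ1 => ?_)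
  · filter_upwards [eventually_gt_atTop 0] with n hn using hA.quantErr_pos hn hfA
  · filter_upwards [eventually_gt_atTop 0] with n hn using hB.quantErr_pos hn (hfA.trans_le (hle f))
  · obtain ⟨n₀, h⟩ := hA.exists_distortion_le hB (D := 0) hγ hγβ hβ hC hc hδ hδ1
      (fun u hu E hE h => by
        have : E = ⊥ := by
          refine (Submodule.eq_bot_iff E).2 fun f hf => ?_
          by_contra hf0
          have h1 := h f hf hf0
          have h2 := hle f
          have : 0 ≤ δ / 16 * u * ‖f‖ ^ 2 := by positivity
          linarith
        simp [this])
      (fun u hu E hE h => hup u hu E hE fun f hf hf0 => (h f hf hf0).trans_le (hle f)) hlow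
    filter_upwards [eventually_gt_atTop 0, eventually_ge_atTop n₀] with n hn hn₀
    exact quantErr_le_of_distortion_le hn hδ (h n hn₀)
  · obtain ⟨n₀, h⟩ := hB.exists_distortion_le hA (D := D * (δ / 16) ^ (-γ)) hγ hγβ hβ hC hc hδ hδ1
      (fun u hu E hE h => by
        rw [mul_assoc, ← mul_rpow (by positivity) hu.le]
        exact hdiff _ (by positivity) E hE h)
      hup (fun r hr => by
        obtain ⟨F, h1, h2, h3⟩ := hlow r hr
        exact ⟨F, h1, h2, fun f hf hf0 => (h3 f hf hf0).trans_le (hle f)⟩)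
    filter_upwards [eventually_gt_atTop 0, eventually_ge_atTop n₀] with n hn hn₀
    exact quantErr_le_of_distortion_le hn hδ (h n hn₀)

end Comparison

section Covariance

variable {ρ : ℝ}

lemma integral_rlKernel (h0 : 0 < ρ) (h1 : ρ < 1) (f : Lp ℝ 2 μ01) :
    ∫ s in (0:ℝ)..1, (∫ t in (0:ℝ)..1, f s * rlKernel ρ s t * f t) =
      ‖((isHSKernel_mvnKernel h0 h1).restrict (Set.Ioi 0)).op f‖ ^ 2 := by
  simp_rw [intervalIntegral_eq_μ01]
  rw [← IsHSKernel.integral_kernel_eq]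
  refine integral_congr_ae ?_
  filter_upwards [ae_mem_Ioc_μ01] with s hs
  refine integral_congr_ae ?_
  filter_upwards [ae_mem_Ioc_μ01] with t ht
  rw [setIntegral_mvnKernel_mul hs.1.le ht.1.le]

lemma fbmConst_mul_integral_fbmKernel (h0 : 0 < ρ) (h1 : ρ < 1) (f : Lp ℝ 2 μ01) :
    fbmConst ρ * ∫ s in (0:ℝ)..1, (∫ t in (0:ℝ)..1, f s * fbmKernel ρ s t * f t) =
      ‖(isHSKernel_mvnKernel h0 h1).op f‖ ^ 2 := by
  simp_rw [intervalIntegral_eq_μ01]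
  rw [← IsHSKernel.integral_kernel_eq, ← integral_const_mul]
  refine integral_congr_ae ?_
  filter_upwards [ae_mem_Ioc_μ01] with s hs
  rw [← integral_const_mul]
  refine integral_congr_ae ?_
  filter_upwards [ae_mem_Ioc_μ01] with t ht
  rw [integral_mvnKernel_mul h0 h1 hs.1.le ht.1.le]
  ring

lemma norm_op_sub_norm_op_restrict_Ioi (h0 : 0 < ρ) (h1 : ρ < 1) (f : Lp ℝ 2 μ01) :
    ‖(isHSKernel_mvnKernel h0 h1).op f‖ ^ 2 -
      ‖((isHSKernel_mvnKernel h0 h1).restrict (Set.Ioi 0)).op f‖ ^ 2 ≤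
      ‖((isHSKernel_mvnKernel h0 h1).restrict (Set.Iio 0)).op f‖ ^ 2 := by
  rw [← (isHSKernel_mvnKernel h0 h1).norm_op_restrict_add_compl measurableSet_Ioi, add_sub_cancel_left]
  refine (isHSKernel_mvnKernel h0 h1).norm_op_restrict_mono ?_ f
  rw [Set.compl_Ioi]
  exact Iio_ae_eq_Iic.symm.le

instance : TopologicalSpace.SeparableSpace (Lp ℝ 2 μ01) := by
  have : Fact ((2 : ENNReal) ≠ ⊤) := ⟨by simp⟩
  unfold μ01
  infer_instance

lemma sqrt_fbmConst (h0 : 0 < ρ) : √(fbmConst ρ) =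
    Real.Gamma (ρ + 1/2) / (Real.Gamma (2*ρ + 1) * Real.sin (Real.pi * ρ)) ^ (1/2 : ℝ) := by
  rw [fbmConst, sqrt_div (sq_nonneg _), sqrt_sq (Real.Gamma_pos_of_pos (by linarith)).le,
    sqrt_eq_rpow]

end Covariance

/-- Relation between the quantization errors of the Riemann–Liouville process `X^ρ` and of
fractional Brownian motion `Z^ρ` with Hurst exponent `ρ ∈ (0,1)`:
`e_n(X^ρ) ~ (Γ(ρ+1/2)/(Γ(2ρ+1) sin(πρ))^{1/2}) e_n(Z^ρ)`. -/
theorem riemann_liouville_vs_fbm_quantization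
    (ρ : ℝ) (hρ : 0 < ρ) (hρ1 : ρ < 1)
    {Ω : Type*} [MeasurableSpace Ω] (P : Measure Ω) [IsProbabilityMeasure P]
    (X Z : Ω → Lp ℝ 2 μ01)
    (hXmeas : AEStronglyMeasurable X P) (hZmeas : AEStronglyMeasurable Z P)
    (hXint : Integrable (fun ω => ‖X ω‖ ^ 2) P)
    (hZint : Integrable (fun ω => ‖Z ω‖ ^ 2) P)
    -- `X` and `Z` are centered Gaussian random vectors in `L²([0,1],dt)` ...
    (hXGauss : ∀ f : Lp ℝ 2 μ01, ∃ v : ℝ≥0,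
      Measure.map (fun ω => ⟪f, X ω⟫) P = gaussianReal 0 v)
    (hZGauss : ∀ f : Lp ℝ 2 μ01, ∃ v : ℝ≥0,
      Measure.map (fun ω => ⟪f, Z ω⟫) P = gaussianReal 0 v)
    -- ... with the covariance kernels of `X^ρ` and `Z^ρ` respectively
    (hXcov : ∀ f g : Lp ℝ 2 μ01,
      (∫ ω, ⟪f, X ω⟫ * ⟪g, X ω⟫ ∂P)
        = ∫ s in (0:ℝ)..1, (∫ t in (0:ℝ)..1, f s * rlKernel ρ s t * g t))
    (hZcov : ∀ f g : Lp ℝ 2 μ01,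
      (∫ ω, ⟪f, Z ω⟫ * ⟪g, Z ω⟫ ∂P)
        = ∫ s in (0:ℝ)..1, (∫ t in (0:ℝ)..1, f s * fbmKernel ρ s t * g t)) :
    Tendsto (fun n : ℕ =>
        quantErr P X n /
          ((Real.Gamma (ρ + 1/2) / (Real.Gamma (2*ρ + 1) * Real.sin (Real.pi * ρ)) ^ (1/2 : ℝ)) *
            quantErr P Z n))
      atTop (nhds 1) := by
  have hX : IsCenteredGaussian P X := ⟨hXmeas, hXint, hXGauss⟩
  have hZ : IsCenteredGaussian P Z := ⟨hZmeas, hZint, hZGauss⟩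
  have hc : 0 < fbmConst ρ := fbmConst_pos hρ hρ1
  have hQX : ∀ f : Lp ℝ 2 μ01, ∫ ω, ⟪f, X ω⟫ ^ 2 ∂P =
      ‖((isHSKernel_mvnKernel hρ hρ1).restrict (Set.Ioi 0)).op f‖ ^ 2 := fun f => by
    simp_rw [sq (⟪f, X _⟫)]
    rw [hXcov, integral_rlKernel hρ hρ1]
  have hQW : ∀ f : Lp ℝ 2 μ01, ∫ ω, ⟪f, √(fbmConst ρ) • Z ω⟫ ^ 2 ∂P =
      ‖(isHSKernel_mvnKernel hρ hρ1).op f‖ ^ 2 := fun f => by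
    simp_rw [inner_smul_right, mul_pow, sq_sqrt hc.le]
    rw [integral_const_mul, ← fbmConst_mul_integral_fbmKernel hρ hρ1]
    simp_rw [sq (⟪f, Z _⟫)]
    rw [hZcov]
  obtain ⟨C, hC, hup⟩ := exists_finrank_le_mvnKernel hρ hρ1
  obtain ⟨D, -, hdiff⟩ := exists_finrank_le_mvnKernel_Iio hρ hρ1
  obtain ⟨c, hc0, hlow⟩ := exists_submodule_lt_norm_op_mvnKernel hρ hρ1
  have main := hX.tendsto_quantErr_div (hZ.const_smul √(fbmConst ρ)) (β := 1 / (2 * ρ + 1))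
    (γ := 1 / (1 + ρ + 1)) (C := C) (D := D) (c := c) (by positivity)
    (one_div_lt_one_div_of_lt (by linarith) (by linarith))
    (by rw [div_lt_one (by linarith)]; linarith) hC hc0
    (fun f => by rw [hQX, hQW]; exact IsHSKernel.norm_op_restrict_le _ _ f)
    (fun u hu E hE h => hdiff u hu E hE fun f hf hf0 => by
      have := h f hf hf0
      rw [hQX, hQW] at this
      exact this.trans_le (norm_op_sub_norm_op_restrict_Ioi hρ hρ1 f))
    (fun u hu E hE h => hup u hu E hE fun f hf hf0 => by
      rw [← hQW]; exact h f hf hf0)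
    (fun r hr => by
      obtain ⟨F, hF, hrF, h⟩ := hlow r hr
      refine ⟨F, hF, hrF, fun f hf hf0 => ?_⟩
      rw [hQX, one_div_one_div]
      refine (h f hf hf0).trans_le ((isHSKernel_mvnKernel hρ hρ1).norm_op_restrict_mono ?_ f)
      exact Ioc_ae_eq_Icc.symm.le.trans (LE.le.eventuallyLE Set.Ioc_subset_Ioi_self))
  refine main.congr' ?_
  filter_upwards [eventually_gt_atTop 0] with n hn
  rw [quantErr_const_smul (sqrt_pos.2 hc) hn, sqrt_fbmConst hρ]
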